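/- Let φ ∈ PGL_2(ℂ) be an involution other than the identity, and let 𝐚 = {a_1,…,a_N} ⊂ ℂℙ¹ be a set of N distinct points with φ(𝐚) = 𝐚 such that the fibre X(𝐚) := Wr^{−1}(∏_{a_i ≠ ∞}(z+a_i)) is reduced. Then the number of φ-fixed points in X(𝐚) depends only on the number of φ-fixed elements of the set 𝐚 (which is 0, 1, or 2). -/

import Mathlib

open Polynomial

noncomputable section

/-! ### The Grassmannian `X = Gr(d, ℂ_{n-1}[z])` and the Wronski map -/

/-- The Wronskian determinant of a `d`-tuple of polynomials. -/
def wronskDet (d : ℕ) (f : Fin d → Polynomial ℂ) : Polynomial ℂ :=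
  Matrix.det (Matrix.of fun i j : Fin d =>
    (fun p : Polynomial ℂ => Polynomial.derivative p)^[(j : ℕ)] (f i))

/-- `x` is a point of the Grassmannian `Gr(d, ℂ_{n-1}[z])`. -/
def IsGrPoint (n d : ℕ) (x : Submodule ℂ (Polynomial ℂ)) : Prop :=
  x ≤ Polynomial.degreeLT ℂ n ∧ Module.finrank ℂ x = d

/-- `x` lies in the fibre of the Wronski map over `h` (an element of the
projective space `ℙ(ℂ_N[z])`, i.e. the Wronskian of a basis of `x` is a nonzero
scalar multiple of `h`). -/
def InFibre (d : ℕ) (x : Submodule ℂ (Polynomial ℂ)) (h : Polynomial ℂ) : Prop :=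
  ∃ (f : Fin d → Polynomial ℂ) (c : ℂ), c ≠ 0 ∧ LinearIndependent ℂ f ∧
    Submodule.span ℂ (Set.range f) = x ∧ wronskDet d f = c • h

/-- The linear substitution `f(z) ↦ f(c·z)` on polynomials. -/
def rotMap (c : ℂ) : Polynomial ℂ →ₗ[ℂ] Polynomial ℂ :=
  (Polynomial.aeval (Polynomial.C c * Polynomial.X) :
    Polynomial ℂ →ₐ[ℂ] Polynomial ℂ).toLinearMap

/-- `x` is fixed by the cyclic group `C_r ⊂ PGL₂(ℂ)` of classes of
`diag(e^{πij/r}, e^{-πij/r})`, `j = 0, …, r-1`; the induced (projective) action on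
`Gr(d, ℂ_{n-1}[z])` is via the substitutions `z ↦ e^{-2πij/r} z`. -/
def CrFixed (r : ℕ) (x : Submodule ℂ (Polynomial ℂ)) : Prop :=
  ∀ j : Fin r,
    Submodule.map
      (rotMap (Complex.exp (-(2 * (Real.pi : ℂ) * Complex.I * ((j : ℕ) : ℂ)) / (r : ℂ)))) x = x

/-- The linear map `f(z) ↦ z^{n-1} f(1/z)` on `ℂ_{n-1}[z]`,
realizing the reflection `(0 1; 1 0) ∈ PGL₂(ℂ)`. -/
def reflectMap (n : ℕ) : Polynomial ℂ →ₗ[ℂ] Polynomial ℂ :=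
  ∑ k ∈ Finset.range n,
    (Polynomial.lcoeff ℂ k).smulRight ((Polynomial.X : Polynomial ℂ) ^ (n - 1 - k))

/-- `x` is fixed by the dihedral group `D_r ⊂ PGL₂(ℂ)` generated by `C_r` and the
reflection `z ↦ 1/z`. -/
def DrFixed (n r : ℕ) (x : Submodule ℂ (Polynomial ℂ)) : Prop :=
  CrFixed r x ∧ Submodule.map (reflectMap n) x = x

/-! ### Partitions, Richardson varieties, compatibility -/

/-- A partition with at most `d` parts, each of size at most `w`
(recorded as a function `ℕ → ℕ` vanishing from index `d` on; part `i` (0-based)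
is the `(i+1)`-st part). -/
structure PartitionIn (d w : ℕ) where
  part : ℕ → ℕ
  antitone : ∀ ⦃i j : ℕ⦄, i ≤ j → part j ≤ part i
  le_w : ∀ i, part i ≤ w
  eq_zero : ∀ i, d ≤ i → part i = 0

/-- The size `|λ|` of a partition. -/
def PartitionIn.size {d w : ℕ} (lam : PartitionIn d w) : ℕ :=
  ∑ i ∈ Finset.range d, lam.part i

/-- Containment `μ ⊆ λ` of partitions. -/
def SubPartition {d w : ℕ} (mu lam : PartitionIn d w) : Prop :=
  ∀ i, mu.part i ≤ lam.part i

/-- The full rectangular partition `(w)^d`. -/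
def rectPart (d w : ℕ) : PartitionIn d w :=
  { part := fun i => if i < d then w else 0
    antitone := by
      intro i j hij
      by_cases hj : j < d
      · have hi : i < d := lt_of_le_of_lt hij hj
        simp [hi, hj]
      · simp [hj]
    le_w := by intro i; by_cases hi : i < d <;> simp [hi]
    eq_zero := by intro i hi; simp [Nat.not_lt.mpr hi] }

/-- The empty partition. -/
def zeroPart (d w : ℕ) : PartitionIn d w :=
  { part := fun _ => 0
    antitone := by intro i j _; exact le_rfl
    le_w := fun _ => Nat.zero_le _
    eq_zero := fun _ _ => rfl }

/-- The flag `F_i = z^{n-i} ℂ_{i-1}[z]` inside `ℂ_{n-1}[z]`. -/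
def Fflag (n i : ℕ) : Submodule ℂ (Polynomial ℂ) :=
  Polynomial.degreeLT ℂ n ⊓
    Submodule.restrictScalars ℂ (Ideal.span {(Polynomial.X : Polynomial ℂ) ^ (n - i)})

/-- The flag `F̃_i = ℂ_{i-1}[z]`. -/
def Ftilde (i : ℕ) : Submodule ℂ (Polynomial ℂ) := Polynomial.degreeLT ℂ i

/-- Membership in the Richardson variety `X_{λ/μ}`. -/
def InRichardson (n d : ℕ) (lam mu : PartitionIn d (n - d))
    (x : Submodule ℂ (Polynomial ℂ)) : Prop :=
  ∀ i : ℕ, i < d →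
    i + 1 ≤ Module.finrank ℂ ↥(x ⊓ Fflag n (n - d - mu.part i + (i + 1))) ∧
    i + 1 ≤ Module.finrank ℂ ↥(x ⊓ Ftilde (lam.part (d - 1 - i) + (i + 1)))

/-- The Richardson variety `X_{λ/μ}` is compatible with the polynomial `h`:
`μ ⊆ λ`, `|λ| = deg h` and `|μ| = mindeg h`. -/
def Compatible (n d : ℕ) (lam mu : PartitionIn d (n - d)) (h : Polynomial ℂ) : Prop :=
  SubPartition mu lam ∧ lam.size = h.natDegree ∧ mu.size = h.rootMultiplicity 0

/-! ### Ribbons and tableaux -/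

/-- Two boxes (row, column) are adjacent. -/
def BoxAdj (p q : ℕ × ℕ) : Prop :=
  (p.1 = q.1 ∧ (p.2 + 1 = q.2 ∨ q.2 + 1 = p.2)) ∨
  (p.2 = q.2 ∧ (p.1 + 1 = q.1 ∨ q.1 + 1 = p.1))

/-- A set of boxes is an `r`-ribbon: it has `r` boxes, is connected,
and contains no 2×2 square. -/
def IsRibbon (r : ℕ) (S : Set (ℕ × ℕ)) : Prop :=
  S.ncard = r ∧
  (∀ p ∈ S, ∀ q ∈ S, Relation.ReflTransGen (fun u v => u ∈ S ∧ v ∈ S ∧ BoxAdj u v) p q) ∧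
  ¬ ∃ i j : ℕ, (i, j) ∈ S ∧ (i + 1, j) ∈ S ∧ (i, j + 1) ∈ S ∧ (i + 1, j + 1) ∈ S

/-- The box `(i,j)` (0-based row and column) lies in the skew diagram `λ/μ`. -/
def InShape {d w : ℕ} (lam mu : PartitionIn d w) (i j : ℕ) : Prop :=
  i < d ∧ mu.part i ≤ j ∧ j < lam.part i

/-- `E` is a standard `r`-ribbon tableau of skew shape `λ/μ` with entries `1, …, ℓ`
(recorded as a function on boxes, normalized to `0` off the shape). -/
def IsSRT {d w : ℕ} (r ℓ : ℕ) (lam mu : PartitionIn d w) (E : ℕ → ℕ → ℕ) : Prop :=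
  (∀ i j, ¬ InShape lam mu i j → E i j = 0) ∧
  (∀ i j, InShape lam mu i j → 1 ≤ E i j ∧ E i j ≤ ℓ) ∧
  (∀ i j j', InShape lam mu i j → InShape lam mu i j' → j ≤ j' → E i j ≤ E i j') ∧
  (∀ i i' j, InShape lam mu i j → InShape lam mu i' j → i ≤ i' → E i j ≤ E i' j) ∧
  (∀ k, 1 ≤ k → k ≤ ℓ → IsRibbon r {p : ℕ × ℕ | InShape lam mu p.1 p.2 ∧ E p.1 p.2 = k})

/-- A tableau (with boxes inside the `d × w` rectangle and largest entry `m`) is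
rotationally invariant: it is fixed by rotating `180°` inside the rectangle and
replacing each entry `k` by `m + 1 - k`. -/
def RotInvariant {d w : ℕ} (m : ℕ) (lam mu : PartitionIn d w) (E : ℕ → ℕ → ℕ) : Prop :=
  ∀ i j, InShape lam mu i j →
    InShape lam mu (d - 1 - i) (w - 1 - j) ∧
    E (d - 1 - i) (w - 1 - j) = m + 1 - E i j

/-- For `ℓ` even: a tableau of shape `λ/μ` with entries `1, …, ℓ-1`, in which the
boxes with entry `k ≠ ℓ/2` form `r`-ribbons and the boxes with entry `ℓ/2`
form a `2r`-ribbon. -/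
def IsHatSRT {d w : ℕ} (r ℓ : ℕ) (lam mu : PartitionIn d w) (E : ℕ → ℕ → ℕ) : Prop :=
  (∀ i j, ¬ InShape lam mu i j → E i j = 0) ∧
  (∀ i j, InShape lam mu i j → 1 ≤ E i j ∧ E i j ≤ ℓ - 1) ∧
  (∀ i j j', InShape lam mu i j → InShape lam mu i j' → j ≤ j' → E i j ≤ E i j') ∧
  (∀ i i' j, InShape lam mu i j → InShape lam mu i' j → i ≤ i' → E i j ≤ E i' j) ∧
  (∀ k, 1 ≤ k → k ≤ ℓ - 1 → k ≠ ℓ / 2 →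
    IsRibbon r {p : ℕ × ℕ | InShape lam mu p.1 p.2 ∧ E p.1 p.2 = k}) ∧
  IsRibbon (2 * r) {p : ℕ × ℕ | InShape lam mu p.1 p.2 ∧ E p.1 p.2 = ℓ / 2}

/-! ### Rectangular standard Young tableaux, promotion and evacuation -/

/-- `E` is a standard Young tableau of rectangular shape `d × w`
(normalized to `0` outside the rectangle). -/
def IsSYT (d w : ℕ) (E : ℕ → ℕ → ℕ) : Prop :=
  (∀ i j, d ≤ i ∨ w ≤ j → E i j = 0) ∧
  (∀ i j, i < d → j < w → 1 ≤ E i j ∧ E i j ≤ d * w) ∧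
  (∀ i j, i < d → j + 1 < w → E i j < E i (j + 1)) ∧
  (∀ i j, i + 1 < d → j < w → E i j < E (i + 1) j) ∧
  (∀ m, 1 ≤ m → m ≤ d * w → ∃ i j, i < d ∧ j < w ∧ E i j = m)

/-- One step of the jeu de taquin slide of the empty box, restricted to the
subtableau of entries `≤ i₀`: the empty box swaps with the smaller of its east
and south neighbours (among entries `≤ i₀`), if any. -/
def slideStep (d w i₀ : ℕ) (E : ℕ → ℕ → ℕ) (p : ℕ × ℕ) : ℕ × ℕ :=
  if (p.1 + 1 < d ∧ E (p.1 + 1) p.2 ≤ i₀) ∧ (p.2 + 1 < w ∧ E p.1 (p.2 + 1) ≤ i₀) then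
    (if E (p.1 + 1) p.2 < E p.1 (p.2 + 1) then (p.1 + 1, p.2) else (p.1, p.2 + 1))
  else if p.1 + 1 < d ∧ E (p.1 + 1) p.2 ≤ i₀ then (p.1 + 1, p.2)
  else if p.2 + 1 < w ∧ E p.1 (p.2 + 1) ≤ i₀ then (p.1, p.2 + 1)
  else p

/-- The path of the empty box in the jeu de taquin slide, starting in the
northwest corner. -/
def slidePath (d w i₀ : ℕ) (E : ℕ → ℕ → ℕ) : ℕ → ℕ × ℕ
  | 0 => (0, 0)
  | k + 1 => slideStep d w i₀ E (slidePath d w i₀ E k)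

/-- Promotion restricted to the entries `1, …, i₀` (the operator `𝑗_{i₀}`):
delete the entry `1`, slide the empty box through the entries `≤ i₀`, decrement
those entries by one and place `i₀` in the final empty box. -/
def partialPromo (d w i₀ : ℕ) (E : ℕ → ℕ → ℕ) : ℕ → ℕ → ℕ := fun i j =>
  if d ≤ i ∨ w ≤ j then 0
  else if (i, j) = slidePath d w i₀ E i₀ then i₀
  else if slidePath d w i₀ E (i + j) = (i, j) then
    E (slidePath d w i₀ E (i + j + 1)).1 (slidePath d w i₀ E (i + j + 1)).2 - 1
  else if E i j ≤ i₀ then E i j - 1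
  else E i j

/-- Jeu de taquin promotion `𝑗` on fillings of the `d × w` rectangle. -/
def promo (d w : ℕ) (E : ℕ → ℕ → ℕ) : ℕ → ℕ → ℕ := partialPromo d w (d * w) E

/-- `evacAux d w i = 𝑗_1 ∘ 𝑗_2 ∘ ⋯ ∘ 𝑗_i`. -/
def evacAux (d w : ℕ) : ℕ → (ℕ → ℕ → ℕ) → (ℕ → ℕ → ℕ)
  | 0, E => E
  | i + 1, E => evacAux d w i (partialPromo d w (i + 1) E)

/-- Evacuation `𝑒 = 𝑗_1 ∘ 𝑗_2 ∘ ⋯ ∘ 𝑗_N` on fillings of the `d × w` rectangle. -/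
def evac (d w : ℕ) (E : ℕ → ℕ → ℕ) : ℕ → ℕ → ℕ := evacAux d w (d * w) E

/-- The `C_r`-fixed polynomial `z^m (z^r + h_1) ⋯ (z^r + h_ℓ)`. -/
def crPoly (r m ℓ : ℕ) (hs : Fin ℓ → ℂ) : Polynomial ℂ :=
  Polynomial.X ^ m * ∏ i : Fin ℓ, (Polynomial.X ^ r + Polynomial.C (hs i))

/-- The product `∏ (z^r + a_i)(z^r + a_i⁻¹)` of generic inverse pairs. -/
def pairsPoly (r t : ℕ) (a : Fin t → ℂ) : Polynomial ℂ :=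
  ∏ i : Fin t,
    ((Polynomial.X ^ r + Polynomial.C (a i)) * (Polynomial.X ^ r + Polynomial.C (a i)⁻¹))

/-- A `D_r`-fixed polynomial of type (1). -/
def type1poly (r m t : ℕ) (ε : ℂ) (a : Fin t → ℂ) : Polynomial ℂ :=
  Polynomial.X ^ m * (Polynomial.X ^ r + Polynomial.C ε) * pairsPoly r t a

/-- A `D_r`-fixed polynomial of type (2). -/
def type2poly (r m t : ℕ) (a : Fin t → ℂ) : Polynomial ℂ :=
  Polynomial.X ^ m * pairsPoly r t a

/-- A `D_r`-fixed polynomial of type (3). -/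
def type3poly (r m t : ℕ) (a : Fin t → ℂ) : Polynomial ℂ :=
  Polynomial.X ^ m * (Polynomial.X ^ r + 1) * (Polynomial.X ^ r - 1) * pairsPoly r t a

/-- `x` is an even-odd point: it has a basis each of whose members is an even or
an odd polynomial. -/
def IsEvenOddPoint (d : ℕ) (x : Submodule ℂ (Polynomial ℂ)) : Prop :=
  ∃ f : Fin d → Polynomial ℂ, LinearIndependent ℂ f ∧
    Submodule.span ℂ (Set.range f) = x ∧
    ∀ i, (f i).comp (-Polynomial.X) = f i ∨ (f i).comp (-Polynomial.X) = -(f i)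

/-- `x` is a real point: it has a basis of polynomials with real coefficients. -/
def IsRealPoint (d : ℕ) (x : Submodule ℂ (Polynomial ℂ)) : Prop :=
  ∃ f : Fin d → Polynomial ℂ, LinearIndependent ℂ f ∧
    Submodule.span ℂ (Set.range f) = x ∧
    ∀ i k, ((f i).coeff k).im = 0

/-- The Möbius action of a matrix on `ℂℙ¹ = ℂ ∪ {∞}` (modelled by `Option ℂ`,
with `none` playing the role of `∞`). -/
def mobP1 (M : Matrix (Fin 2) (Fin 2) ℂ) : Option ℂ → Option ℂ := fun p =>
  match p with
  | none => if M 1 0 = 0 then none else some (M 0 0 / M 1 0)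
  | some a =>
      if M 1 0 * a + M 1 1 = 0 then none
      else some ((M 0 0 * a + M 0 1) / (M 1 0 * a + M 1 1))

/-- The action of a matrix `φ` on `ℂ_{n-1}[z] `:
`(φf)(z) = (φ₂₁ z + φ₁₁)^{n-1} f((φ₂₂ z + φ₁₂)/(φ₂₁ z + φ₁₁))`. -/
def mobiusMap (n : ℕ) (M : Matrix (Fin 2) (Fin 2) ℂ) : Polynomial ℂ →ₗ[ℂ] Polynomial ℂ :=
  ∑ k ∈ Finset.range n, (Polynomial.lcoeff ℂ k).smulRight
    ((Polynomial.C (M 1 1) * Polynomial.X + Polynomial.C (M 0 1)) ^ k *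
     (Polynomial.C (M 1 0) * Polynomial.X + Polynomial.C (M 0 0)) ^ (n - 1 - k))

/-- The polynomial `∏_{a_i ≠ ∞} (z + a_i)` attached to a tuple of points of `ℂℙ¹`. -/
def rootsPoly (N : ℕ) (a : Fin N → Option ℂ) : Polynomial ℂ :=
  ∏ i : Fin N, (a i).elim 1 (fun c => Polynomial.X + Polynomial.C c)

/-- The eigenspace `M_k`: the span of the monomials `z^j`, `j < n`, `j ≡ k (mod r)`. -/
def eigSpace (n r : ℕ) (k : Fin r) : Submodule ℂ (Polynomial ℂ) :=
  Submodule.span ℂ {p : Polynomial ℂ | ∃ j : ℕ, j < n ∧ j % r = (k : ℕ) ∧ p = Polynomial.X ^ j}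

/-- The operator `c` on `ℂ_{n-1}[z]` with `c · z^k = ζ^{n-1-2k} z^k`, `ζ = e^{πi/r}`. -/
def cMap (n r : ℕ) : Polynomial ℂ →ₗ[ℂ] Polynomial ℂ :=
  (Complex.exp ((Real.pi : ℂ) * Complex.I / (r : ℂ))) ^ (n - 1) •
    (Polynomial.aeval
        (Polynomial.C (((Complex.exp ((Real.pi : ℂ) * Complex.I / (r : ℂ))) ^ 2)⁻¹) *
          Polynomial.X) :
      Polynomial ℂ →ₐ[ℂ] Polynomial ℂ).toLinearMap

/-- `μ` is obtained from `λ` by removing a single `r`-ribbon. -/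
def RibbonStep {d w : ℕ} (r : ℕ) (lam mu : PartitionIn d w) : Prop :=
  SubPartition mu lam ∧ IsRibbon r {p : ℕ × ℕ | InShape lam mu p.1 p.2}

/-- `λ` and `μ` have the same `r`-core: they are related by the equivalence
relation generated by removal of a single `r`-ribbon. -/
def RibbonEquiv {d w : ℕ} (r : ℕ) (lam mu : PartitionIn d w) : Prop :=
  Relation.EqvGen (fun a b => RibbonStep r a b) lam mu

/-- `κ` is an `r`-core: no `r`-ribbon can be removed from it. -/
def IsRCore {d w : ℕ} (r : ℕ) (kappa : PartitionIn d w) : Prop :=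
  ¬ ∃ mu : PartitionIn d w, RibbonStep r kappa mu

/-- The column set `J(λ) = {i - 1 + λ^{d+1-i} : 1 ≤ i ≤ d}` of the Plücker
coordinate `p_λ`, as a function of `i`. -/
def pluckerIndex {d w : ℕ} (lam : PartitionIn d w) (i : Fin d) : ℕ :=
  (i : ℕ) + lam.part (d - 1 - (i : ℕ))

/-- The Plücker coordinate `p_λ(x)` of `x` is nonzero (this does not depend on
the choice of basis of `x`). -/
def PluckerNonzero (d : ℕ) {w : ℕ} (lam : PartitionIn d w)
    (x : Submodule ℂ (Polynomial ℂ)) : Prop :=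
  ∃ f : Fin d → Polynomial ℂ, LinearIndependent ℂ f ∧
    Submodule.span ℂ (Set.range f) = x ∧
    Matrix.det (Matrix.of fun i i' : Fin d => (f i).coeff (pluckerIndex lam i')) ≠ 0

end

open Polynomial

namespace WrFix
open MvPolynomial in
lemma whc_mul {ι : Type*} (w : ι → ℕ) (f q : MvPolynomial ι ℂ) (v m : ℕ)
    (hf : f.IsWeightedHomogeneous w v) (hvm : v ≤ m) :
    weightedHomogeneousComponent w m (f * q) = f * weightedHomogeneousComponent w (m - v) q := by
  classical
  letI : GradedAlgebra (weightedHomogeneousSubmodule ℂ w) := weightedGradedAlgebra ℂ w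
  have h := DirectSum.coe_decompose_mul_of_left_mem_of_le (weightedHomogeneousSubmodule ℂ w)
    (a := f) (b := q) (i := v) (n := m) hf hvm
  have e : ∀ (a : MvPolynomial ι ℂ) (k : ℕ),
      ((DirectSum.decompose (weightedHomogeneousSubmodule ℂ w) a) k : MvPolynomial ι ℂ) =
        weightedHomogeneousComponent w k a := fun a k => weightedDecomposition.decompose'_apply ℂ w a k
  rw [e, e] at h
  exact h

open MvPolynomial in
lemma whc_mul_lt {ι : Type*} (w : ι → ℕ) (f q : MvPolynomial ι ℂ) (v m : ℕ)
    (hf : f.IsWeightedHomogeneous w v) (hvm : m < v) :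
    weightedHomogeneousComponent w m (f * q) = 0 := by
  classical
  letI : GradedAlgebra (weightedHomogeneousSubmodule ℂ w) := weightedGradedAlgebra ℂ w
  have h := DirectSum.coe_decompose_mul_of_left_mem_of_not_le (weightedHomogeneousSubmodule ℂ w)
    (a := f) (b := q) (i := v) (n := m) hf (by omega)
  have e : ∀ (a : MvPolynomial ι ℂ) (k : ℕ),
      ((DirectSum.decompose (weightedHomogeneousSubmodule ℂ w) a) k : MvPolynomial ι ℂ) =
        weightedHomogeneousComponent w k a := fun a k => weightedDecomposition.decompose'_apply ℂ w a k
  rw [e] at h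
  exact h

open MvPolynomial in
lemma monomial_mem_of_large {ι : Type*} [Fintype ι] (w : ι → ℕ)
    (I : Ideal (MvPolynomial ι ℂ)) (hI : ∀ i, ∃ m : ℕ, (X i : MvPolynomial ι ℂ) ^ m ∈ I) :
    ∃ W : ℕ, ∀ s : ι →₀ ℕ, W ≤ Finsupp.weight w s → ∀ c : ℂ, monomial s c ∈ I := by
  classical
  choose m hm using hI
  refine ⟨∑ i, m i * w i + 1, fun s hs c => ?_⟩
  have : ∃ i, m i ≤ s i := by
    by_contra! hcon
    have : Finsupp.weight w s ≤ ∑ i, m i * w i := by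
      rw [Finsupp.weight_apply, Finsupp.sum_fintype _ _ (by simp)]
      exact Finset.sum_le_sum fun i _ => by
        simpa using Nat.mul_le_mul_right (w i) (hcon i).le
    omega
  obtain ⟨i, hi⟩ := this
  have : monomial s c = monomial (s - Finsupp.single i (m i)) c * X i ^ m i := by
    rw [MvPolynomial.X_pow_eq_monomial, MvPolynomial.monomial_mul, mul_one]
    congr 1
    rw [tsub_add_cancel_of_le]
    simpa using hi
  rw [this]
  exact I.mul_mem_left _ (hm i)

open MvPolynomial in
lemma finite_of_zero_fibre {ι : Type*} [Fintype ι] {N : ℕ} (w : ι → ℕ) (hw : ∀ i, 0 < w i)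
    (v : Fin N → ℕ) (hv : ∀ r, 0 < v r) (Φ : Fin N → MvPolynomial ι ℂ)
    (hΦ : ∀ r, (Φ r).IsWeightedHomogeneous w (v r))
    (h0 : ∀ c : ι → ℂ, (∀ r, eval c (Φ r) = 0) → c = 0) :
    Module.Finite (Algebra.adjoin ℂ (Set.range Φ)) (MvPolynomial ι ℂ) := by
  classical
  set A := Algebra.adjoin ℂ (Set.range Φ)
  set I := Ideal.span (Set.range Φ)
  have hI : ∀ i, ∃ m : ℕ, (X i : MvPolynomial ι ℂ) ^ m ∈ I := by
    intro i
    have : X i ∈ I.radical := by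
      rw [← vanishingIdeal_zeroLocus_eq_radical (K := ℂ), mem_vanishingIdeal_iff]
      intro x hx
      have : x = 0 := h0 x fun r => by
        have := (mem_zeroLocus_iff.1 hx) (Φ r) (Ideal.subset_span ⟨r, rfl⟩)
        simpa [aeval_eq_eval] using this
      simp [this]
    exact this
  obtain ⟨W, hW⟩ := monomial_mem_of_large w I hI
  set S : Set (MvPolynomial ι ℂ) := (fun s : ι →₀ ℕ => monomial s (1 : ℂ)) '' {s | Finsupp.weight w s < W}
  have hfin : {s : ι →₀ ℕ | Finsupp.weight w s < W}.Finite := by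
    have hsub : {s : ι →₀ ℕ | Finsupp.weight w s < W} ⊆
        {s | s ≤ Finsupp.equivFunOnFinite.symm fun _ : ι => W} := by
      intro s hs i
      simp only [Set.mem_ofPred_eq] at hs
      have h2 := Finsupp.le_weight w (hw i).ne' s
      show s i ≤ W
      omega
    exact (Set.finite_Iic _).subset hsub
  have key : ∀ m : ℕ, ∀ p : MvPolynomial ι ℂ, p.IsWeightedHomogeneous w m →
      p ∈ Submodule.span A S := by
    intro m
    induction m using Nat.strong_induction_on with
    | _ m ih =>
      intro p hp
      by_cases hm : m < W
      · rw [p.as_sum]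
        refine Submodule.sum_mem _ fun s hs => ?_
        have : monomial s (coeff s p) = (algebraMap ℂ A (coeff s p)) • monomial s (1 : ℂ) := by
          rw [algebraMap_smul, MvPolynomial.smul_monomial, smul_eq_mul, mul_one]
        rw [this]
        refine Submodule.smul_mem _ _ (Submodule.subset_span ⟨s, ?_, rfl⟩)
        simp only [Set.mem_ofPred_eq]
        rw [hp (mem_support_iff.1 hs)]
        exact hm
      · have hpI : p ∈ I := by
          rw [p.as_sum]
          refine Ideal.sum_mem _ fun s hs => hW s ?_ _
          rw [hp (mem_support_iff.1 hs)]
          omega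
        obtain ⟨q, hq⟩ := (Ideal.mem_span_range_iff_exists_fun).1 hpI
        have hp' : p = ∑ r, weightedHomogeneousComponent w m (Φ r * q r) := by
          rw [← map_sum]
          conv_lhs => rw [← hp.weightedHomogeneousComponent_same, ← hq]
          simp [mul_comm]
        rw [hp']
        refine Submodule.sum_mem _ fun r _ => ?_
        by_cases hr : v r ≤ m
        · rw [whc_mul w _ _ _ _ (hΦ r) hr]
          have := ih (m - v r) (by have := hv r; omega) _
            (weightedHomogeneousComponent_isWeightedHomogeneous (w := w) (m - v r) (q r))
          exact Submodule.smul_mem _ (⟨Φ r, Algebra.subset_adjoin ⟨r, rfl⟩⟩ : A) this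
        · rw [whc_mul_lt w _ _ _ _ (hΦ r) (by omega)]
          exact Submodule.zero_mem _
  refine ⟨⟨(hfin.image (fun s : ι →₀ ℕ => MvPolynomial.monomial s (1 : ℂ))).toFinset, ?_⟩⟩
  rw [Set.Finite.coe_toFinset]
  refine eq_top_iff.2 fun p _ => ?_
  rw [p.as_sum]
  exact Submodule.sum_mem _ fun s _ => key _ _ (isWeightedHomogeneous_monomial w s _ rfl)

open MvPolynomial in
lemma algInd_of_zero_fibre {ι : Type} [Fintype ι] {N : ℕ} (hN : Fintype.card ι = N)
    (Φ : Fin N → MvPolynomial ι ℂ)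
    (hfin : Module.Finite (Algebra.adjoin ℂ (Set.range Φ)) (MvPolynomial ι ℂ)) :
    AlgebraicIndependent ℂ Φ := by
  have : Algebra.IsAlgebraic (Algebra.adjoin ℂ (Set.range Φ)) (MvPolynomial ι ℂ) := inferInstance
  exact (Algebra.IsAlgebraic.isTranscendenceBasis_of_le_trdeg_of_finite ℂ Φ (by
    rw [MvPolynomial.trdeg_of_isDomain]; simp [hN])).1

end WrFix

open Polynomial

namespace WrFix
open MvPolynomial in
lemma exists_values_poly {ι : Type} [Fintype ι] {N : ℕ}
    (Φ : Fin N → MvPolynomial ι ℂ)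
    (hfin : Module.Finite (Algebra.adjoin ℂ (Set.range Φ)) (MvPolynomial ι ℂ))
    (hind : AlgebraicIndependent ℂ Φ) (g : MvPolynomial ι ℂ) :
    ∃ μ : Polynomial (MvPolynomial (Fin N) ℂ), μ.Monic ∧
      (∀ (h : Fin N → ℂ) (α : ℂ), (μ.map (eval h)).eval α = 0 ↔
        ∃ c : ι → ℂ, (∀ r, eval c (Φ r) = h r) ∧ eval c g = α) ∧
      (∀ p : Polynomial (MvPolynomial (Fin N) ℂ),
        p.eval₂ (aeval Φ : MvPolynomial (Fin N) ℂ →ₐ[ℂ] MvPolynomial ι ℂ).toRingHom g = 0 →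
          μ ∣ p) := by
  classical
  let f : MvPolynomial (Fin N) ℂ →+* MvPolynomial ι ℂ :=
    (aeval Φ : MvPolynomial (Fin N) ℂ →ₐ[ℂ] MvPolynomial ι ℂ).toRingHom
  have hfi : Function.Injective f := hind
  have hevf : ∀ (c : ι → ℂ) (b : MvPolynomial (Fin N) ℂ),
      eval c (f b) = eval (fun r => eval c (Φ r)) b := by
    intro c b
    show eval c (aeval Φ b) = _
    induction b using MvPolynomial.induction_on with
    | C a => simp
    | add p q hp hq => rw [map_add, map_add, map_add, hp, hq]
    | mul_X p i hp => rw [map_mul, map_mul, map_mul, hp]; simp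
  have hfint : f.IsIntegral := by
    intro x
    have hx : IsIntegral (Algebra.adjoin ℂ (Set.range Φ)) x := Algebra.IsIntegral.isIntegral x
    obtain ⟨p, hp, hpx⟩ := hx
    have hsurj : ∀ a : Algebra.adjoin ℂ (Set.range Φ), ∃ b, f b = a := by
      intro a
      obtain ⟨a, ha⟩ := a
      rw [Algebra.adjoin_range_eq_range_aeval] at ha
      exact ha
    let q : (MvPolynomial ι ℂ)[X] := p.map (algebraMap (Algebra.adjoin ℂ (Set.range Φ)) (MvPolynomial ι ℂ))
    have hq : q ∈ Polynomial.lifts f := by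
      rw [Polynomial.lifts_iff_coeff_lifts]
      intro k
      rw [Polynomial.coeff_map]
      exact hsurj _
    obtain ⟨q', hq', -, hq'm⟩ := Polynomial.lifts_and_natDegree_eq_and_monic hq (hp.map _)
    refine ⟨q', hq'm, ?_⟩
    rw [← Polynomial.eval_map, hq', Polynomial.eval_map]
    exact hpx
  letI : Algebra (MvPolynomial (Fin N) ℂ) (MvPolynomial ι ℂ) := f.toAlgebra
  have : FaithfulSMul (MvPolynomial (Fin N) ℂ) (MvPolynomial ι ℂ) :=
    (faithfulSMul_iff_algebraMap_injective _ _).2 hfi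
  have hgint : IsIntegral (MvPolynomial (Fin N) ℂ) g := hfint g
  refine ⟨minpoly (MvPolynomial (Fin N) ℂ) g, minpoly.monic hgint, ?_, ?_⟩
  · intro h α
    constructor
    · intro hα
      let F : (MvPolynomial (Fin N) ℂ)[X] →+* MvPolynomial ι ℂ := Polynomial.eval₂RingHom f g
      let E : (MvPolynomial (Fin N) ℂ)[X] →+* ℂ := Polynomial.eval₂RingHom (eval h) α
      have hker : RingHom.ker F ≤ RingHom.ker E := by
        intro p hp
        have hd : minpoly (MvPolynomial (Fin N) ℂ) g ∣ p :=
          minpoly.isIntegrallyClosed_dvd hgint hp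
        obtain ⟨q, rfl⟩ := hd
        have : E (minpoly (MvPolynomial (Fin N) ℂ) g) = 0 := by
          rw [Polynomial.eval_map] at hα
          exact hα
        rw [RingHom.mem_ker, map_mul, this, zero_mul]
      have hEs : Function.Surjective E := fun z => ⟨Polynomial.C (MvPolynomial.C z), by simp [E]⟩
      have hmax : (RingHom.ker E).IsMaximal := RingHom.ker_isMaximal_of_surjective E hEs
      letI : Algebra (MvPolynomial (Fin N) ℂ)[X] (MvPolynomial ι ℂ) := F.toAlgebra
      have hFint : Algebra.IsIntegral (MvPolynomial (Fin N) ℂ)[X] (MvPolynomial ι ℂ) := by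
        constructor
        intro x
        obtain ⟨p, hp, hpx⟩ := hfint x
        refine ⟨p.map Polynomial.C, hp.map _, ?_⟩
        rw [Polynomial.eval₂_map]
        have : (algebraMap (MvPolynomial (Fin N) ℂ)[X] (MvPolynomial ι ℂ)).comp Polynomial.C = f := by
          refine RingHom.ext fun b => ?_
          show F (Polynomial.C b) = f b
          simp [F]
        rw [this]
        exact hpx
      obtain ⟨Q, hQ, hQE⟩ := Ideal.exists_ideal_over_maximal_of_isIntegral
        (S := MvPolynomial ι ℂ) (RingHom.ker E) hker
      obtain ⟨c, hc⟩ := MvPolynomial.isMaximal_iff_eq_vanishingIdeal_singleton.1 hQ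
      have hz : ∀ p : (MvPolynomial (Fin N) ℂ)[X], E p = 0 → eval c (F p) = 0 := by
        intro p hp
        have : p ∈ Q.comap (algebraMap (MvPolynomial (Fin N) ℂ)[X] (MvPolynomial ι ℂ)) := by
          rw [hQE]; exact hp
        rw [Ideal.mem_comap, hc, mem_vanishingIdeal_singleton_iff] at this
        rw [aeval_eq_eval] at this
        exact this
      refine ⟨c, fun r => ?_, ?_⟩
      · have := hz (Polynomial.C (MvPolynomial.X r - MvPolynomial.C (h r))) (by simp [E])
        simp only [F, Polynomial.coe_eval₂RingHom, Polynomial.eval₂_C] at this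
        rw [hevf] at this
        simpa [sub_eq_zero] using this
      · have := hz (Polynomial.X - Polynomial.C (MvPolynomial.C α)) (by simp [E])
        simp only [F, Polynomial.coe_eval₂RingHom, Polynomial.eval₂_C, Polynomial.eval₂_sub,
          Polynomial.eval₂_X, map_sub] at this
        rw [hevf] at this
        simpa [sub_eq_zero] using this
    · rintro ⟨c, hc, rfl⟩
      have h1 : Polynomial.eval₂ f g (minpoly (MvPolynomial (Fin N) ℂ) g) = 0 :=
        minpoly.aeval (MvPolynomial (Fin N) ℂ) g
      have h2 := congrArg (MvPolynomial.eval c) h1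
      rw [Polynomial.hom_eval₂, map_zero] at h2
      have h3 : (MvPolynomial.eval c).comp f = MvPolynomial.eval h := by
        refine RingHom.ext fun b => ?_
        rw [RingHom.comp_apply, hevf, funext hc]
      rw [h3] at h2
      rw [Polynomial.eval_map]
      exact h2
  · intro p hp
    exact minpoly.isIntegrallyClosed_dvd hgint hp
end WrFix

open Polynomial

namespace WrFix

lemma interp_one {ι : Type} [Fintype ι] (S : Finset (ι → ℂ)) (x : ι → ℂ) :
    ∃ p : MvPolynomial ι ℂ, MvPolynomial.eval x p = 1 ∧
      ∀ y ∈ S, y ≠ x → MvPolynomial.eval y p = 0 := by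
  classical
  have key : ∀ y : ι → ℂ, ∃ p : MvPolynomial ι ℂ, MvPolynomial.eval x p = 1 ∧
      (y ≠ x → MvPolynomial.eval y p = 0) := by
    intro y
    by_cases hy : y = x
    · exact ⟨1, by simp, fun h => absurd hy h⟩
    · obtain ⟨i, hi⟩ : ∃ i, y i ≠ x i := by
        by_contra hcon
        push Not at hcon
        exact hy (funext hcon)
      refine ⟨MvPolynomial.C ((x i - y i)⁻¹) * (MvPolynomial.X i - MvPolynomial.C (y i)), ?_, ?_⟩
      · have : x i - y i ≠ 0 := sub_ne_zero.2 (Ne.symm hi)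
        simp [inv_mul_cancel₀ this]
      · intro _; simp
  choose p hp1 hp2 using key
  refine ⟨∏ y ∈ S, p y, ?_, ?_⟩
  · rw [map_prod]; exact Finset.prod_eq_one fun y _ => hp1 y
  · intro y hy hne
    rw [map_prod]
    exact Finset.prod_eq_zero hy (hp2 y hne)

lemma interp {ι : Type} [Fintype ι] (S : Finset (ι → ℂ)) (u : (ι → ℂ) → ℂ) :
    ∃ p : MvPolynomial ι ℂ, ∀ x ∈ S, MvPolynomial.eval x p = u x := by
  classical
  choose p hp1 hp2 using interp_one S
  refine ⟨∑ y ∈ S, MvPolynomial.C (u y) * p y, fun x hx => ?_⟩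
  rw [map_sum, Finset.sum_eq_single x]
  · simp [hp1]
  · intro y _ hne
    rw [map_mul, hp2 y x hx (Ne.symm hne), mul_zero]
  · intro h; exact absurd hx h

/-- lattice points of weight at most `m` -/
def latt {ι : Type} [Fintype ι] [DecidableEq ι] (w : ι → ℕ) (m : ℕ) : Finset (ι → ℕ) :=
  (Fintype.piFinset fun _ : ι => Finset.range (m + 1)).filter (fun e => ∑ i, w i * e i ≤ m)

lemma mem_latt {ι : Type} [Fintype ι] [DecidableEq ι] {w : ι → ℕ} (hw : ∀ i, 0 < w i) {m : ℕ}
    {e : ι → ℕ} : e ∈ latt w m ↔ ∑ i, w i * e i ≤ m := by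
  simp only [latt, Finset.mem_filter, Fintype.mem_piFinset, Finset.mem_range, and_iff_right_iff_imp]
  intro h i
  have h1 : w i * e i ≤ ∑ i, w i * e i := 
    Finset.single_le_sum (f := fun i => w i * e i) (fun _ _ => Nat.zero_le _) (Finset.mem_univ i)
  have h2 : e i ≤ w i * e i := Nat.le_mul_of_pos_left _ (hw i)
  omega

lemma latt_one_le {ι : Type} [Fintype ι] [DecidableEq ι] (v : ι → ℕ) (hv : ∀ i, 0 < v i) (m : ℕ) :
    (latt (fun _ : ι => 1) m).card ≤ (∏ i, v i) * (latt v m).card := by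
  have : (∏ i, v i) * (latt v m).card =
    ((Fintype.piFinset fun i : ι => Finset.range (v i)) ×ˢ latt v m).card := by
    rw [Finset.card_product, Fintype.card_piFinset]; simp
  rw [this]
  refine Finset.card_le_card_of_injOn (fun e => (fun i => e i % v i, fun i => e i / v i)) ?_ ?_
  · intro e he
    simp only [Finset.coe_product, Set.mem_prod, Finset.mem_coe, Fintype.mem_piFinset,
      Finset.mem_range]
    refine ⟨fun i => Nat.mod_lt _ (hv i), ?_⟩
    rw [mem_latt hv]
    have he : e ∈ latt (fun _ : ι => 1) m := he
    rw [mem_latt (fun _ => one_pos)] at he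
    refine le_trans (Finset.sum_le_sum fun i _ => ?_) he
    rw [one_mul]; exact Nat.mul_div_le _ _
  · intro e _ e' _ h
    simp only [Prod.mk.injEq] at h
    funext i
    rw [← Nat.mod_add_div (e i) (v i), ← Nat.mod_add_div (e' i) (v i),
      congrFun h.1 i, congrFun h.2 i]

lemma latt_le_one {ι : Type} [Fintype ι] [DecidableEq ι] (v : ι → ℕ) (hv : ∀ i, 0 < v i) (m : ℕ) :
    (∏ i, v i) * (latt v m).card ≤ (latt (fun _ : ι => 1) (m + ∑ i, v i)).card := by
  have : (∏ i, v i) * (latt v m).card =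
    ((Fintype.piFinset fun i : ι => Finset.range (v i)) ×ˢ latt v m).card := by
    rw [Finset.card_product, Fintype.card_piFinset]; simp
  rw [this]
  refine Finset.card_le_card_of_injOn (fun q i => q.1 i + v i * q.2 i) ?_ ?_
  · rintro ⟨a, e⟩ he
    simp only [Finset.coe_product, Set.mem_prod, Finset.mem_coe, Fintype.mem_piFinset,
      Finset.mem_range] at he
    show _ ∈ latt _ _
    rw [mem_latt (fun _ => one_pos)]
    have h2 := he.2
    rw [mem_latt hv] at h2
    have h1 : ∑ i, a i ≤ ∑ i, v i := Finset.sum_le_sum fun i _ => (he.1 i).le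
    simp only [one_mul, Finset.sum_add_distrib]
    omega
  · rintro ⟨a, e⟩ he ⟨a', e'⟩ he' h
    simp only [Finset.coe_product, Set.mem_prod, Finset.mem_coe, Fintype.mem_piFinset,
      Finset.mem_range] at he he'
    have h' : ∀ i, a i + v i * e i = a' i + v i * e' i := fun i => congrFun h i
    have hm : ∀ i, a i = a' i := by
      intro i
      have := congrArg (· % v i) (h' i)
      simpa [Nat.add_mul_mod_self_left, Nat.mod_eq_of_lt (he.1 i), Nat.mod_eq_of_lt (he'.1 i)]
        using this
    have hd : ∀ i, e i = e' i := by
      intro i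
      have h3 := h' i
      rw [hm i] at h3
      exact Nat.eq_of_mul_eq_mul_left (hv i) (by omega)
    simp only [Prod.mk.injEq]
    exact ⟨funext hm, funext hd⟩

lemma latt_congr {ι κ : Type} [Fintype ι] [DecidableEq ι] [Fintype κ] [DecidableEq κ]
    (e : ι ≃ κ) (m : ℕ) :
    (latt (fun _ : ι => 1) m).card = (latt (fun _ : κ => 1) m).card := by
  refine Finset.card_bij' (fun a _ => a ∘ e.symm) (fun a _ => a ∘ e) ?_ ?_ ?_ ?_
  · intro a ha
    rw [mem_latt (fun _ => one_pos)] at ha ⊢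
    simpa [Equiv.sum_comp e.symm] using ha
  · intro a ha
    rw [mem_latt (fun _ => one_pos)] at ha ⊢
    simpa [Equiv.sum_comp e] using ha
  · intro a _; funext i; simp
  · intro a _; funext i; simp

lemma latt_growth {ι : Type} [Fintype ι] [DecidableEq ι] (A B L : ℕ)
    (h : ∀ m, A * (latt (fun _ : ι => 1) m).card ≤ B * (latt (fun _ : ι => 1) (m + L)).card) :
    A ≤ B := by
  by_contra hAB
  push Not at hAB
  set b : ℕ → ℝ := fun m => ((latt (fun _ : ι => 1) m).card : ℝ) with hb
  have hb0 : 1 ≤ b 0 := by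
    have : (0 : ι → ℕ) ∈ latt (fun _ : ι => 1) 0 := by
      rw [mem_latt (fun _ => one_pos)]; simp
    have := Finset.card_pos.2 ⟨_, this⟩
    simp only [hb]; exact_mod_cast this
  have hB : 0 < B := by
    rcases Nat.eq_zero_or_pos B with h0 | h0
    · exfalso
      have := h 0
      rw [h0, zero_mul] at this
      have h1 : 0 < (latt (fun _ : ι => 1) 0).card := by
        have : (1:ℝ) ≤ (latt (fun _ : ι => 1) 0).card := hb0
        exact_mod_cast this
      have := Nat.mul_pos (show 0 < A by omega) h1
      omega
    · exact h0
  set ρ : ℝ := (A : ℝ) / B with hρ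
  have hB' : (0:ℝ) < B := by exact_mod_cast hB
  have hρ1 : 1 < ρ := by
    rw [hρ, one_lt_div hB']; exact_mod_cast hAB
  have step : ∀ m, ρ * b m ≤ b (m + L) := by
    intro m
    rw [hρ, div_mul_eq_mul_div, div_le_iff₀ hB', mul_comm (b (m+L))]
    simp only [hb]
    exact_mod_cast h m
  have hpow : ∀ k, ρ ^ k ≤ b (k * L) := by
    intro k
    induction k with
    | zero => simpa using hb0
    | succ k ih =>
      calc ρ ^ (k+1) = ρ * ρ ^ k := by ring
        _ ≤ ρ * b (k * L) := by gcongr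
        _ ≤ b (k * L + L) := step _
        _ = b ((k+1) * L) := by ring_nf
  have hup : ∀ m, b m ≤ ((m : ℝ) + 1) ^ (Fintype.card ι) := by
    intro m
    have h1 : (latt (fun _ : ι => 1) m).card ≤ (m + 1) ^ (Fintype.card ι) := by
      refine le_trans (Finset.card_filter_le _ _) ?_
      rw [Fintype.card_piFinset]; simp
    simp only [hb]; exact_mod_cast h1
  have hlim := tendsto_pow_const_div_const_pow_of_one_lt (Fintype.card ι) hρ1
  have hev := hlim.eventually (gt_mem_nhds (show (0:ℝ) < 1 / ((L:ℝ) + 1) ^ (Fintype.card ι) by positivity))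
  obtain ⟨k, hk1, hk⟩ := (hev.and (Filter.eventually_ge_atTop 1)).exists
  have hkk : (1:ℝ) ≤ k := by exact_mod_cast hk
  have : ρ ^ k ≤ ((L : ℝ) + 1) ^ (Fintype.card ι) * (k:ℝ) ^ (Fintype.card ι) := by
    refine (hpow k).trans ((hup _).trans ?_)
    rw [← mul_pow]
    apply pow_le_pow_left₀ (by positivity)
    push_cast
    nlinarith
  rw [div_lt_div_iff₀ (by positivity) (by positivity)] at hk1
  nlinarith

end WrFix

open Polynomial

namespace WrFix

/-- polynomials of weight at most `m` -/
def WtLE {ι : Type} [Fintype ι] (w : ι → ℕ) (m : ℕ) (p : MvPolynomial ι ℂ) : Prop :=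
  ∀ e ∈ p.support, ∑ i, w i * e i ≤ m

lemma WtLE.mono {ι : Type} [Fintype ι] {w : ι → ℕ} {m m' : ℕ} {p : MvPolynomial ι ℂ}
    (h : WtLE w m p) (hm : m ≤ m') : WtLE w m' p := fun e he => (h e he).trans hm

lemma WtLE.mul {ι : Type} [Fintype ι] {w : ι → ℕ} {m m' : ℕ} {p q : MvPolynomial ι ℂ}
    (h : WtLE w m p) (h' : WtLE w m' q) : WtLE w (m + m') (p * q) := by
  classical
  intro e he
  obtain ⟨a, ha, b, hb, rfl⟩ := Finset.mem_add.1 (MvPolynomial.support_mul p q he)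
  have := h a ha
  have := h' b hb
  simp only [Finsupp.add_apply, mul_add, Finset.sum_add_distrib]
  omega

lemma WtLE.one {ι : Type} [Fintype ι] {w : ι → ℕ} : WtLE w 0 (1 : MvPolynomial ι ℂ) := by
  classical
  intro e he
  rw [MvPolynomial.mem_support_iff, MvPolynomial.coeff_one] at he
  have : e = 0 := by by_contra hne; exact he (if_neg (fun h => hne h.symm))
  simp [this]

lemma WtLE.pow {ι : Type} [Fintype ι] {w : ι → ℕ} {m : ℕ} {p : MvPolynomial ι ℂ}
    (h : WtLE w m p) (k : ℕ) : WtLE w (k * m) (p ^ k) := by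
  induction k with
  | zero => simpa using WtLE.one
  | succ k ih => rw [pow_succ, add_mul, one_mul]; exact ih.mul h

lemma WtLE.prod {ι κ : Type} [Fintype ι] {w : ι → ℕ} (s : Finset κ) {m : κ → ℕ}
    {p : κ → MvPolynomial ι ℂ}
    (h : ∀ k ∈ s, WtLE w (m k) (p k)) : WtLE w (∑ k ∈ s, m k) (∏ k ∈ s, p k) := by
  classical
  induction s using Finset.induction_on with
  | empty => simpa using WtLE.one
  | insert a s ha ih =>
    rw [Finset.sum_insert ha, Finset.prod_insert ha]
    exact (h a (Finset.mem_insert_self _ _)).mul (ih fun k hk => h k (Finset.mem_insert_of_mem hk))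

lemma WtLE.sum {ι κ : Type} [Fintype ι] {w : ι → ℕ} (s : Finset κ) {m : ℕ}
    {p : κ → MvPolynomial ι ℂ}
    (h : ∀ k ∈ s, WtLE w m (p k)) : WtLE w m (∑ k ∈ s, p k) := by
  classical
  intro e he
  obtain ⟨k, hk, hke⟩ := Finset.mem_biUnion.1 (MvPolynomial.support_sum he)
  exact h k hk e hke

lemma WtLE.smul {ι : Type} [Fintype ι] {w : ι → ℕ} {m : ℕ} {p : MvPolynomial ι ℂ} (a : ℂ)
    (h : WtLE w m p) : WtLE w m (a • p) := by
  intro e he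
  refine h e ?_
  rw [MvPolynomial.mem_support_iff] at he ⊢
  intro h0
  exact he (by simp [h0])

lemma wtLE_exists {ι : Type} [Fintype ι] (w : ι → ℕ) (p : MvPolynomial ι ℂ) :
    ∃ m, WtLE w m p := 
  ⟨p.support.sup (fun e => ∑ i, w i * e i), fun e he => 
    Finset.le_sup (f := fun e : ι →₀ ℕ => ∑ i, w i * e i) he⟩

lemma wtLE_of_whom {ι : Type} [Fintype ι] {w : ι → ℕ} {p : MvPolynomial ι ℂ} {m : ℕ}
    (h : MvPolynomial.IsWeightedHomogeneous w p m) : WtLE w m p := by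
  intro e he
  have := h (MvPolynomial.mem_support_iff.1 he)
  rw [Finsupp.weight_apply, Finsupp.sum_fintype _ _ (by simp)] at this
  rw [← this]
  refine le_of_eq (Finset.sum_congr rfl fun i _ => ?_)
  simp [mul_comm]

open MvPolynomial in
lemma card_bound {ι : Type} [Fintype ι] [DecidableEq ι] {N : ℕ} (hN : Fintype.card ι = N)
    (w : ι → ℕ) (hw : ∀ i, 0 < w i) (v : Fin N → ℕ) (hv : ∀ i, 0 < v i)
    (Φ : Fin N → MvPolynomial ι ℂ)
    (hΦ : ∀ r, IsWeightedHomogeneous w (Φ r) (v r))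
    (hfin : Module.Finite (Algebra.adjoin ℂ (Set.range Φ)) (MvPolynomial ι ℂ))
    (hind : AlgebraicIndependent ℂ Φ) (h : Fin N → ℂ) (S : Finset (ι → ℂ))
    (hS : ∀ c ∈ S, ∀ r, eval c (Φ r) = h r) :
    S.card * ∏ i, w i ≤ ∏ r, v r := by
  classical
  set s := S.card with hs
  -- separating polynomial
  obtain ⟨g, hg⟩ := interp S (fun c => if hc : c ∈ S then ((S.equivFin ⟨c, hc⟩ : Fin _) : ℂ) else 0)
  have hginj : Set.InjOn (fun c => eval c g) (S : Set (ι → ℂ)) := by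
    intro c hc c' hc' hcc
    have hc : c ∈ S := hc
    have hc' : c' ∈ S := hc'
    simp only [hg c hc, hg c' hc', hc, hc', dif_pos] at hcc
    have h1 : ((S.equivFin ⟨c, hc⟩ : Fin _) : ℕ) = (S.equivFin ⟨c', hc'⟩ : Fin _) := by
      exact_mod_cast hcc
    have := S.equivFin.injective (Fin.ext h1)
    simpa using this
  obtain ⟨μ, hμm, hμr, hμd⟩ := exists_values_poly Φ hfin hind g
  have hdeg : s ≤ μ.natDegree := by
    have hne : μ.map (eval h) ≠ 0 := (hμm.map _).ne_zero
    have h1 : (S.image (fun c => eval c g)).card ≤ (μ.map (eval h)).natDegree := by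
      refine Polynomial.card_le_degree_of_subset_roots ?_
      intro α hα
      obtain ⟨c, hc, rfl⟩ := Finset.mem_image.1 hα
      rw [Polynomial.mem_roots hne]
      exact (hμr h _).2 ⟨c, hS c hc, rfl⟩
    rw [Finset.card_image_of_injOn hginj] at h1
    exact h1.trans Polynomial.natDegree_map_le
  obtain ⟨G, hG⟩ := wtLE_exists w g
  set L := s * G with hL
  have main : ∀ m, s * (latt v m).card ≤ (latt w (m + L)).card := by
    intro m
    let P : (Fin s × latt v m → ℂ) → Polynomial (MvPolynomial (Fin N) ℂ) := fun a =>
      ∑ k : Fin s, Polynomial.monomial (k : ℕ)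
        (∑ e : latt v m, MvPolynomial.monomial (Finsupp.equivFunOnFinite.symm (e : Fin N → ℕ)) (a (k, e)))
    let Q : (Fin s × latt v m → ℂ) → MvPolynomial ι ℂ := fun a =>
      ∑ q : Fin s × latt v m, a q • ((∏ r, Φ r ^ (q.2 : Fin N → ℕ) r) * g ^ (q.1 : ℕ))
    have hPQ : ∀ a, (P a).eval₂ (aeval Φ : MvPolynomial (Fin N) ℂ →ₐ[ℂ] MvPolynomial ι ℂ).toRingHom g = Q a := by
      intro a
      simp only [P, Q, Polynomial.eval₂_finsetSum, Polynomial.eval₂_monomial, Fintype.sum_prod_type]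
      refine Finset.sum_congr rfl fun k _ => ?_
      rw [map_sum, Finset.sum_mul]
      refine Finset.sum_congr rfl fun e _ => ?_
      simp only [AlgHom.toRingHom_eq_coe, RingHom.coe_coe, MvPolynomial.aeval_monomial]
      rw [Finsupp.prod_fintype _ _ (by simp)]
      simp [Algebra.smul_def, mul_assoc]
    have hPinj : ∀ a, P a = 0 → a = 0 := by
      intro a ha
      funext ⟨k, e⟩
      have h1 := congrArg (fun p => p.coeff (k : ℕ)) ha
      simp only [P, Polynomial.finsetSum_coeff, Polynomial.coeff_monomial, Polynomial.coeff_zero] at h1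
      rw [Finset.sum_eq_single k] at h1
      · rw [if_pos rfl] at h1
        have h2 := congrArg (MvPolynomial.coeff (Finsupp.equivFunOnFinite.symm (e : Fin N → ℕ))) h1
        rw [MvPolynomial.coeff_sum, Finset.sum_eq_single e] at h2
        · simpa using h2
        · intro e' _ hne
          rw [MvPolynomial.coeff_monomial, if_neg]
          intro hh
          exact hne (Subtype.ext (Finsupp.equivFunOnFinite.symm.injective hh))
        · intro hh; exact absurd (Finset.mem_univ _) hh
      · intro b _ hb
        rw [if_neg]
        intro hh; exact hb (Fin.ext hh)
      · intro hh; exact absurd (Finset.mem_univ _) hh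
    have hPdeg : ∀ a, (P a).degree < s := by
      intro a
      refine lt_of_le_of_lt (Polynomial.degree_sum_le _ _) ?_
      rw [Finset.sup_lt_iff (by exact WithBot.bot_lt_coe s)]
      intro k _
      refine lt_of_le_of_lt (Polynomial.degree_monomial_le _ _) ?_
      exact_mod_cast k.2
    have hQinj : ∀ a, Q a = 0 → a = 0 := by
      intro a ha
      refine hPinj a ?_
      have hdvd := hμd (P a) (by rw [hPQ, ha])
      by_contra hne
      have h1 := Polynomial.degree_le_of_dvd hdvd hne
      have h2 := lt_of_le_of_lt h1 (hPdeg a)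
      rw [Polynomial.degree_eq_natDegree hμm.ne_zero] at h2
      have : μ.natDegree < s := by exact_mod_cast h2
      omega
    have hQw : ∀ a, WtLE w (m + L) (Q a) := by
      intro a
      refine WtLE.sum _ fun q _ => WtLE.smul _ ?_
      have h1 : WtLE w (∑ r, (q.2 : Fin N → ℕ) r * v r) (∏ r, Φ r ^ (q.2 : Fin N → ℕ) r) :=
        WtLE.prod _ fun r _ => (wtLE_of_whom (hΦ r)).pow _
      have h2 := hG.pow (q.1 : ℕ)
      refine (h1.mul h2).mono ?_
      have h3 := (mem_latt hv).1 q.2.2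
      have h4 : (q.1 : ℕ) * G ≤ L := Nat.mul_le_mul_right _ q.1.2.le
      have h5 : ∑ r, (q.2 : Fin N → ℕ) r * v r = ∑ r, v r * (q.2 : Fin N → ℕ) r :=
        Finset.sum_congr rfl fun r _ => mul_comm _ _
      omega
    let T : (Fin s × latt v m → ℂ) →ₗ[ℂ] (latt w (m + L) → ℂ) :=
      { toFun := fun a e => (Q a).coeff (Finsupp.equivFunOnFinite.symm (e : ι → ℕ))
        map_add' := by
          intro a b
          funext e
          simp only [Q, Pi.add_apply, add_smul, Finset.sum_add_distrib, MvPolynomial.coeff_add]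
        map_smul' := by
          intro z a
          funext e
          simp only [Q, Pi.smul_apply, RingHom.id_apply, smul_eq_mul, mul_smul, ← Finset.smul_sum,
            MvPolynomial.coeff_smul] }
    have hT : Function.Injective T := by
      rw [injective_iff_map_eq_zero]
      intro a ha
      refine hQinj a ?_
      ext e
      rw [MvPolynomial.coeff_zero]
      by_contra hne
      have h1 := hQw a e (MvPolynomial.mem_support_iff.2 hne)
      have h2 : (e : ι → ℕ) ∈ latt w (m + L) := (mem_latt hw).2 h1
      have h3 := congrFun ha ⟨_, h2⟩
      apply hne
      have h4 : Finsupp.equivFunOnFinite.symm (e : ι → ℕ) = e := Finsupp.equivFunOnFinite.symm_apply_apply e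
      rw [← h4]
      exact h3
    have := LinearMap.finrank_le_finrank_of_injective hT
    simpa using this
  refine latt_growth (ι := ι) _ _ (L + ∑ i, w i) fun m => ?_
  have e1 : (latt (fun _ : ι => 1) m).card = (latt (fun _ : Fin N => 1) m).card :=
    latt_congr (Fintype.equivFinOfCardEq hN) m
  calc s * (∏ i, w i) * (latt (fun _ : ι => 1) m).card
      ≤ s * (∏ i, w i) * ((∏ r, v r) * (latt v m).card) := by
        rw [e1]; exact Nat.mul_le_mul_left _ (latt_one_le v hv m)
    _ = (∏ r, v r) * (∏ i, w i) * (s * (latt v m).card) := by ring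
    _ ≤ (∏ r, v r) * (∏ i, w i) * (latt w (m + L)).card := Nat.mul_le_mul_left _ (main m)
    _ = (∏ r, v r) * ((∏ i, w i) * (latt w (m + L)).card) := by ring
    _ ≤ (∏ r, v r) * (latt (fun _ : ι => 1) (m + L + ∑ i, w i)).card :=
        Nat.mul_le_mul_left _ (latt_le_one w hw _)
    _ = _ := by rw [add_assoc]

end WrFix

open Polynomial

namespace WrFix

/-- number of distinct roots -/
noncomputable def nroots (p : ℂ[X]) : ℕ := p.roots.toFinset.card

lemma nroots_le (p : ℂ[X]) : nroots p ≤ p.natDegree :=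
  (Multiset.toFinset_card_le _).trans (p.card_roots')

lemma nroots_of_sep (p : ℂ[X]) (h : p.Separable) : nroots p = p.natDegree := by
  rw [nroots, Multiset.toFinset_card_of_nodup (nodup_roots h)]
  exact (Polynomial.splits_iff_card_roots.1 (IsAlgClosed.splits p))

lemma nroots_congr {p q : ℂ[X]} (hp : p ≠ 0) (hq : q ≠ 0)
    (h : ∀ x, p.eval x = 0 ↔ q.eval x = 0) : nroots p = nroots q := by
  rw [nroots, nroots]
  congr 1
  ext x
  rw [Multiset.mem_toFinset, Multiset.mem_toFinset, mem_roots hp, mem_roots hq]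
  exact h x

lemma semicont (k : ℕ) : ∀ p : ℂ[X][X], p.Monic → p.natDegree = k →
    ∃ F : Finset ℂ, ∀ t ∉ F, ∀ s,
      nroots (p.map (evalRingHom s)) ≤ nroots (p.map (evalRingHom t)) := by
  induction k using Nat.strong_induction_on with
  | _ k ih =>
  intro p hp hk
  let K := FractionRing ℂ[X]
  have hinj : Function.Injective (algebraMap ℂ[X] K) := IsFractionRing.injective _ _
  by_cases hsep : (p.map (algebraMap ℂ[X] K)).Separable
  · obtain ⟨a, b, hab⟩ := hsep
    obtain ⟨⟨ra, hra⟩, hA⟩ := IsLocalization.integerNormalization_map_to_map (nonZeroDivisors ℂ[X]) a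
    obtain ⟨⟨rb, hrb⟩, hB⟩ := IsLocalization.integerNormalization_map_to_map (nonZeroDivisors ℂ[X]) b
    set A := IsLocalization.integerNormalization (nonZeroDivisors ℂ[X]) a
    set B := IsLocalization.integerNormalization (nonZeroDivisors ℂ[X]) b
    have hid : C rb * A * p + C ra * B * derivative p = C (ra * rb) := by
      apply Polynomial.map_injective _ hinj
      simp only [Polynomial.map_add, Polynomial.map_mul, Polynomial.map_C, ← derivative_map]
      rw [hA, hB]
      simp only [Algebra.smul_def, Submonoid.smul_def]
      have := congrArg (fun x => C (algebraMap ℂ[X] K (ra * rb)) * x) hab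
      simp only [mul_one] at this
      rw [← this]
      simp only [map_mul, Polynomial.algebraMap_apply]
      ring
    have hne : ra * rb ≠ 0 := mul_ne_zero (nonZeroDivisors.ne_zero hra) (nonZeroDivisors.ne_zero hrb)
    refine ⟨(ra * rb).roots.toFinset, fun t ht s => ?_⟩
    have ht' : (ra * rb).eval t ≠ 0 := by
      intro h0
      exact ht (by rw [Multiset.mem_toFinset, mem_roots hne]; exact h0)
    have hs : (p.map (evalRingHom t)).Separable := by
      have h1 := congrArg (Polynomial.map (evalRingHom t)) hid
      simp only [Polynomial.map_add, Polynomial.map_mul, Polynomial.map_C, ← derivative_map,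
        coe_evalRingHom] at h1
      refine ⟨C ((ra * rb).eval t)⁻¹ * (C (rb.eval t) * A.map (evalRingHom t)),
        C ((ra * rb).eval t)⁻¹ * (C (ra.eval t) * B.map (evalRingHom t)), ?_⟩
      rw [mul_assoc (C (eval t (ra * rb))⁻¹), mul_assoc (C (eval t (ra * rb))⁻¹), ← mul_add, h1, ← Polynomial.C_mul, inv_mul_cancel₀ ht', C_1]
    rw [nroots_of_sep _ hs, hp.natDegree_map, ← hp.natDegree_map (evalRingHom s)]
    exact nroots_le _
  · rw [PerfectField.separable_iff_squarefree] at hsep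
    rw [Squarefree] at hsep
    push Not at hsep
    obtain ⟨x, hx, hxu⟩ := hsep
    have hpK : (p.map (algebraMap ℂ[X] K)).Monic := hp.map _
    have hx0 : x ≠ 0 := by
      rintro rfl
      rw [zero_mul, zero_dvd_iff] at hx
      exact hpK.ne_zero hx
    have hxp : x ∣ p.map (algebraMap ℂ[X] K) := (dvd_mul_right x x).trans hx
    obtain ⟨r, hr⟩ := IsIntegrallyClosed.eq_map_mul_C_of_dvd K hp hxp
    have hlc : x.leadingCoeff ≠ 0 := leadingCoeff_ne_zero.2 hx0
    have hrm : r.Monic := by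
      refine Polynomial.monic_of_injective hinj ?_
      have h1 := congrArg leadingCoeff hr
      rw [leadingCoeff_mul, leadingCoeff_C] at h1
      exact mul_right_cancel₀ hlc (by rw [h1, one_mul])
    have hrr : r * r ∣ p := by
      rw [← Polynomial.map_dvd_map (algebraMap ℂ[X] K) hinj (hrm.mul hrm), Polynomial.map_mul]
      refine dvd_trans ?_ hx
      rw [← hr]
      exact ⟨C x.leadingCoeff * C x.leadingCoeff, by ring⟩
    have hrdeg : 0 < r.natDegree := by
      by_contra h0
      apply hxu
      have : r = 1 := by
        exact hrm.natDegree_eq_zero.1 (by omega)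
      rw [← hr, this, Polynomial.map_one, one_mul]
      exact Polynomial.isUnit_C.2 (isUnit_iff_ne_zero.2 hlc)
    obtain ⟨p1, hp1⟩ := hrr
    have hp1m : p1.Monic := (hrm.mul hrm).of_mul_monic_left (hp1 ▸ hp)
    have hdeg : (r * p1).natDegree < k := by
      rw [← hk, hp1, (hrm.mul hrm).natDegree_mul hp1m, hrm.natDegree_mul hp1m, hrm.natDegree_mul hrm]
      omega
    obtain ⟨F, hF⟩ := ih _ hdeg (r * p1) (hrm.mul hp1m) rfl
    have heq : ∀ s, nroots (p.map (evalRingHom s)) = nroots ((r * p1).map (evalRingHom s)) := by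
      intro s
      refine nroots_congr (hp.map _).ne_zero ((hrm.mul hp1m).map _).ne_zero fun x => ?_
      rw [hp1]
      simp only [Polynomial.map_mul, eval_mul, mul_eq_zero]
      tauto
    refine ⟨F, fun t ht s => ?_⟩
    rw [heq, heq]
    exact hF t ht s

end WrFix

open Polynomial

namespace WrFix

lemma invol_section {α : Type} [DecidableEq α] (Z : Finset α) (τ : α → α)
    (hτ : ∀ x ∈ Z, τ x ∈ Z) (hττ : ∀ x, τ (τ x) = x) :
    ∃ P ⊆ Z, 2 * P.card = Z.card + (Z.filter (fun x => τ x = x)).card ∧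
      (∀ x ∈ Z, x ∈ P ∨ τ x ∈ P) ∧ (∀ x ∈ P, τ x ∈ P → τ x = x) := by
  classical
  obtain ⟨lab, hlab⟩ : ∃ l : α → ℕ, Set.InjOn l (Z : Set α) := by
    refine ⟨fun x => if hx : x ∈ Z then Z.equivFin ⟨x, hx⟩ else 0, ?_⟩
    intro x hx y hy hxy
    have hx : x ∈ Z := hx
    have hy : y ∈ Z := hy
    simp only [hx, hy, dif_pos] at hxy
    have := Z.equivFin.injective (Fin.ext hxy)
    simpa using this
  refine ⟨Z.filter (fun x => lab x ≤ lab (τ x)), Finset.filter_subset _ _, ?_, ?_, ?_⟩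
  · have h1 : (Z.filter (fun x => lab x ≤ lab (τ x))).card =
        (Z.filter (fun x => lab (τ x) ≤ lab x)).card := by
      refine Finset.card_bij' (fun x _ => τ x) (fun x _ => τ x) ?_ ?_ ?_ ?_
      · intro x hx
        rw [Finset.mem_filter] at hx ⊢
        rw [hττ]; exact ⟨hτ x hx.1, hx.2⟩
      · intro x hx
        rw [Finset.mem_filter] at hx ⊢
        rw [hττ]; exact ⟨hτ x hx.1, hx.2⟩
      · intro x _; exact hττ x
      · intro x _; exact hττ x
    have h2 : Z.filter (fun x => lab x ≤ lab (τ x)) ∪ Z.filter (fun x => lab (τ x) ≤ lab x) = Z := by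
      ext x
      simp only [Finset.mem_union, Finset.mem_filter]
      constructor
      · rintro (h | h) <;> exact h.1
      · intro h
        rcases le_total (lab x) (lab (τ x)) with h' | h'
        · exact Or.inl ⟨h, h'⟩
        · exact Or.inr ⟨h, h'⟩
    have h3 : Z.filter (fun x => lab x ≤ lab (τ x)) ∩ Z.filter (fun x => lab (τ x) ≤ lab x)
        = Z.filter (fun x => τ x = x) := by
      ext x
      simp only [Finset.mem_inter, Finset.mem_filter]
      constructor
      · rintro ⟨h, h'⟩
        exact ⟨h.1, hlab (hτ x h.1) h.1 (le_antisymm h'.2 h.2)⟩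
      · rintro ⟨h, h'⟩
        rw [h']; simp [h]
    have := Finset.card_union_add_card_inter (Z.filter (fun x => lab x ≤ lab (τ x)))
      (Z.filter (fun x => lab (τ x) ≤ lab x))
    rw [h2, h3] at this
    omega
  · intro x hx
    simp only [Finset.mem_filter, hττ]
    rcases le_total (lab x) (lab (τ x)) with h' | h'
    · exact Or.inl ⟨hx, h'⟩
    · exact Or.inr ⟨hτ x hx, h'⟩
  · intro x hx hx'
    simp only [Finset.mem_filter, hττ] at hx hx'
    exact hlab hx'.1 hx.1 (le_antisymm hx'.2 hx.2)

/-- the fibre -/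
def Zf {ι : Type} {N : ℕ} (Φ : Fin N → MvPolynomial ι ℂ) (h : Fin N → ℂ) : Set (ι → ℂ) :=
  {c | ∀ r, MvPolynomial.eval c (Φ r) = h r}

lemma line_semicont {ι : Type} [Fintype ι] {N : ℕ}
    (Φ : Fin N → MvPolynomial ι ℂ)
    (hfin : Module.Finite (Algebra.adjoin ℂ (Set.range Φ)) (MvPolynomial ι ℂ))
    (hind : AlgebraicIndependent ℂ Φ) (g : MvPolynomial ι ℂ) (h h' : Fin N → ℂ) :
    ∃ F : Finset ℂ, ∀ t ∉ F, ∀ s,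
      Set.ncard (insert 0 ((fun c => MvPolynomial.eval c g) '' Zf Φ (fun r => h r + s * (h' r - h r)))) ≤
      Set.ncard (insert 0 ((fun c => MvPolynomial.eval c g) '' Zf Φ (fun r => h r + t * (h' r - h r)))) := by
  classical
  obtain ⟨μ, hμm, hμr, -⟩ := exists_values_poly Φ hfin hind g
  let ψ : MvPolynomial (Fin N) ℂ →+* ℂ[X] :=
    MvPolynomial.eval₂Hom Polynomial.C (fun r => C (h r) + X * C (h' r - h r))
  have hψ : ∀ s : ℂ, (evalRingHom s).comp ψ = MvPolynomial.eval (fun r => h r + s * (h' r - h r)) := by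
    intro s
    apply MvPolynomial.ringHom_ext
    · intro a; simp [ψ]
    · intro i; simp [ψ]
  obtain ⟨F, hF⟩ := semicont _ (X * μ.map ψ) (monic_X.mul (hμm.map _)) rfl
  refine ⟨F, fun t ht s => ?_⟩
  have key : ∀ s : ℂ, nroots ((X * μ.map ψ).map (evalRingHom s)) =
    Set.ncard (insert 0 ((fun c => MvPolynomial.eval c g) '' Zf Φ (fun r => h r + s * (h' r - h r)))) := by
    intro s
    have hne : (X * μ.map ψ).map (evalRingHom s) ≠ 0 :=
      ((monic_X.mul (hμm.map _)).map _).ne_zero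
    rw [nroots, ← Set.ncard_coe_finset]
    congr 1
    ext α
    rw [Finset.mem_coe, Multiset.mem_toFinset, mem_roots hne, IsRoot.def, Polynomial.map_mul,
      Polynomial.map_map, hψ, eval_mul, mul_eq_zero, hμr]
    simp [Zf]
  rw [← key, ← key]
  exact hF t ht s

/-- sign change -/
def tau {ι : Type} (w : ι → ℕ) (c : ι → ℂ) : ι → ℂ := fun i => (-1) ^ (w i) * c i

lemma tau_tau {ι : Type} (w : ι → ℕ) (c : ι → ℂ) : tau w (tau w c) = c := by
  funext i
  simp only [tau, ← mul_assoc, ← mul_pow]; simp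

lemma eval_tau_hom {ι : Type} [Fintype ι] {w : ι → ℕ} {p : MvPolynomial ι ℂ} {m : ℕ}
    (hp : MvPolynomial.IsWeightedHomogeneous w p m) (c : ι → ℂ) :
    MvPolynomial.eval (tau w c) p = (-1) ^ m * MvPolynomial.eval c p := by
  rw [MvPolynomial.eval_eq, MvPolynomial.eval_eq, Finset.mul_sum]
  refine Finset.sum_congr rfl fun e he => ?_
  have := hp (MvPolynomial.mem_support_iff.1 he)
  rw [Finsupp.weight_apply, Finsupp.sum_fintype _ _ (by simp)] at this
  have h2 : ∏ i ∈ e.support, tau w c i ^ e i = (-1) ^ m * ∏ i ∈ e.support, c i ^ e i := by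
    have h3 : ∀ b : ι → ℂ, ∏ i ∈ e.support, b i ^ e i = ∏ i, b i ^ e i := by
      intro b
      refine Finset.prod_subset (Finset.subset_univ _) fun i _ hi => ?_
      rw [Finsupp.notMem_support_iff.1 hi, pow_zero]
    rw [h3, h3, ← this, ← Finset.prod_pow_eq_pow_sum, ← Finset.prod_mul_distrib]
    refine Finset.prod_congr rfl fun i _ => ?_
    rw [tau, mul_pow, ← pow_mul]
    simp [mul_comm]
  rw [h2]; ring

lemma exists_tau_poly {ι : Type} (w : ι → ℕ) (q : MvPolynomial ι ℂ) :
    ∃ q' : MvPolynomial ι ℂ, ∀ c, MvPolynomial.eval c q' = MvPolynomial.eval (tau w c) q := by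
  refine ⟨MvPolynomial.bind₁ (fun i => MvPolynomial.C ((-1) ^ (w i)) * MvPolynomial.X i) q, fun c => ?_⟩
  rw [← MvPolynomial.aeval_eq_eval, ← MvPolynomial.aeval_eq_eval]
  change (MvPolynomial.aeval c) _ = (MvPolynomial.aeval (tau w c)) q
  rw [MvPolynomial.aeval_bind₁]
  congr 2
  funext i
  simp [tau]

lemma Zf_tau {ι : Type} [Fintype ι] {N : ℕ} {w : ι → ℕ} {v : Fin N → ℕ}
    {Φ : Fin N → MvPolynomial ι ℂ}
    (hΦ : ∀ r, MvPolynomial.IsWeightedHomogeneous w (Φ r) (v r)) {h : Fin N → ℂ}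
    (hodd : ∀ r, Odd (v r) → h r = 0) {c : ι → ℂ} (hc : c ∈ Zf Φ h) : tau w c ∈ Zf Φ h := by
  intro r
  rw [eval_tau_hom (hΦ r), hc r]
  rcases Nat.even_or_odd (v r) with he | ho
  · simp [he.neg_one_pow]
  · simp [hodd r ho]

end WrFix

open Polynomial

namespace WrFix

lemma fix_generic {ι : Type} [Fintype ι] {N : ℕ} {w : ι → ℕ} {v : Fin N → ℕ}
    {Φ : Fin N → MvPolynomial ι ℂ}
    (hΦ : ∀ r, MvPolynomial.IsWeightedHomogeneous w (Φ r) (v r))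
    (hfin : Module.Finite (Algebra.adjoin ℂ (Set.range Φ)) (MvPolynomial ι ℂ))
    (hind : AlgebraicIndependent ℂ Φ) (K : ℕ)
    (hbd : ∀ h, (Zf Φ h).Finite ∧ (Zf Φ h).ncard ≤ K)
    (h h' : Fin N → ℂ) (hodd : ∀ r, Odd (v r) → h r = 0) (hodd' : ∀ r, Odd (v r) → h' r = 0)
    (hK : (Zf Φ h).ncard = K) :
    ∃ F : Finset ℂ, ∀ t ∉ F, {c ∈ Zf Φ h | tau w c = c}.ncard =
      {c ∈ Zf Φ (fun r => h r + t * (h' r - h r)) | tau w c = c}.ncard := by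
  classical
  set Z0 : Finset (ι → ℂ) := (hbd h).1.toFinset with hZ0
  have mem0 : ∀ c, c ∈ Z0 ↔ c ∈ Zf Φ h := fun c => by simp [hZ0]
  have card0 : Z0.card = K := (Set.ncard_eq_toFinset_card _ (hbd h).1).symm.trans hK
  have τ0 : ∀ c ∈ Z0, tau w c ∈ Z0 := by
    intro c hc; rw [mem0] at hc ⊢; exact Zf_tau hΦ hodd hc
  obtain ⟨P, hPZ, hPc, hPor, hPeq⟩ := invol_section Z0 (tau w) τ0 (tau_tau w)
  obtain ⟨lab, hlab, hlab0⟩ : ∃ l : (ι → ℂ) → ℕ, Set.InjOn l (Z0 : Set (ι → ℂ)) ∧ ∀ x, 0 < l x := by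
    refine ⟨fun x => (if hx : x ∈ Z0 then (Z0.equivFin ⟨x, hx⟩ : ℕ) else 0) + 1, ?_, fun _ => Nat.succ_pos _⟩
    intro x hx y hy hxy
    have hx : x ∈ Z0 := hx
    have hy : y ∈ Z0 := hy
    simp only [hx, hy, dif_pos, add_left_inj] at hxy
    have := Z0.equivFin.injective (Fin.ext hxy)
    simpa using this
  -- invariant polynomial
  let u0 : (ι → ℂ) → ℂ := fun x => if x ∈ P then (lab x : ℂ) else lab (tau w x)
  have hu0 : ∀ x ∈ Z0, u0 (tau w x) = u0 x := by
    intro x hx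
    simp only [u0, tau_tau]
    by_cases h1 : x ∈ P <;> by_cases h2 : tau w x ∈ P
    · rw [hPeq x h1 h2]
    · simp [h1, h2]
    · simp [h1, h2]
    · rcases hPor x hx with h3 | h3
      · exact absurd h3 h1
      · exact absurd h3 h2
  obtain ⟨q, hq⟩ := interp Z0 u0
  obtain ⟨q', hq'⟩ := exists_tau_poly w q
  let u : MvPolynomial ι ℂ := MvPolynomial.C (1/2) * (q + q')
  have hu1 : ∀ x ∈ Z0, MvPolynomial.eval x u = u0 x := by
    intro x hx
    simp only [u, map_mul, map_add, MvPolynomial.eval_C, hq', hq x hx, hq _ (τ0 x hx), hu0 x hx]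
    ring
  have hu2 : ∀ x, MvPolynomial.eval (tau w x) u = MvPolynomial.eval x u := by
    intro x
    simp only [u, map_mul, map_add, MvPolynomial.eval_C, hq', tau_tau]
    ring
  -- odd polynomial
  let g0 : (ι → ℂ) → ℂ := fun x => if tau w x = x then 0 else
    if x ∈ P then (lab x : ℂ) else - lab (tau w x)
  have hg0 : ∀ x ∈ Z0, g0 (tau w x) = - g0 x := by
    intro x hx
    simp only [g0, tau_tau]
    by_cases h0 : tau w x = x
    · rw [if_pos h0.symm, if_pos h0, neg_zero]
    rw [if_neg (fun h => h0 h.symm), if_neg h0]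
    by_cases h1 : x ∈ P <;> by_cases h2 : tau w x ∈ P
    · exact absurd (hPeq x h1 h2) h0
    · simp [h1, h2]
    · simp [h1, h2]
    · rcases hPor x hx with h3 | h3
      · exact absurd h3 h1
      · exact absurd h3 h2
  obtain ⟨p, hp⟩ := interp Z0 g0
  obtain ⟨p', hp'⟩ := exists_tau_poly w p
  let g : MvPolynomial ι ℂ := MvPolynomial.C (1/2) * (p - p')
  have hg1 : ∀ x ∈ Z0, MvPolynomial.eval x g = g0 x := by
    intro x hx
    simp only [g, map_mul, map_sub, MvPolynomial.eval_C, hp', hp x hx, hp _ (τ0 x hx), hg0 x hx]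
    ring
  have hg2 : ∀ x, MvPolynomial.eval (tau w x) g = - MvPolynomial.eval x g := by
    intro x
    simp only [g, map_mul, map_sub, MvPolynomial.eval_C, hp', tau_tau]
    ring
  obtain ⟨F1, hF1⟩ := line_semicont Φ hfin hind u h h'
  obtain ⟨F2, hF2⟩ := line_semicont Φ hfin hind g h h'
  refine ⟨F1 ∪ F2, fun t ht => ?_⟩
  rw [Finset.mem_union, not_or] at ht
  have e0 : (fun r => h r + 0 * (h' r - h r)) = h := by funext r; ring
  have k1 := hF1 t ht.1 0
  have k2 := hF2 t ht.2 0
  rw [e0] at k1 k2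
  set ht' : Fin N → ℂ := fun r => h r + t * (h' r - h r) with hht
  have hoddt : ∀ r, Odd (v r) → ht' r = 0 := by
    intro r hr; simp [hht, hodd r hr, hodd' r hr]
  set Zt : Finset (ι → ℂ) := (hbd ht').1.toFinset with hZt
  have memt : ∀ c, c ∈ Zt ↔ c ∈ Zf Φ ht' := fun c => by simp [hZt]
  have cardt : Zt.card ≤ K := by
    have := (hbd ht').2
    rwa [Set.ncard_eq_toFinset_card _ (hbd ht').1] at this
  have τt : ∀ c ∈ Zt, tau w c ∈ Zt := by
    intro c hc; rw [memt] at hc ⊢; exact Zf_tau hΦ hoddt hc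
  obtain ⟨Pt, hPtZ, hPtc, hPtor, -⟩ := invol_section Zt (tau w) τt (tau_tau w)
  have f0 : {c ∈ Zf Φ h | tau w c = c} = ((Z0.filter (fun x => tau w x = x) : Finset _) : Set _) := by
    ext c; simp [mem0]
  have ft : {c ∈ Zf Φ ht' | tau w c = c} = ((Zt.filter (fun x => tau w x = x) : Finset _) : Set _) := by
    ext c; simp [memt]
  have z0 : Zf Φ h = (Z0 : Set _) := by ext c; simp [mem0]
  have zt : Zf Φ ht' = (Zt : Set _) := by ext c; simp [memt]
  rw [f0, ft, Set.ncard_coe_finset, Set.ncard_coe_finset]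
  rw [z0, zt, ← Finset.coe_image, ← Finset.coe_image, ← Finset.coe_insert, ← Finset.coe_insert,
    Set.ncard_coe_finset, Set.ncard_coe_finset] at k1 k2
  -- first inequality
  have a1 : P.card + 1 ≤ (insert 0 (Z0.image fun c => MvPolynomial.eval c u)).card := by
    have i1 : Set.InjOn (fun c => MvPolynomial.eval c u) (P : Set (ι → ℂ)) := by
      intro x hx y hy hxy
      have hx : x ∈ P := hx
      have hy : y ∈ P := hy
      simp only [hu1 x (hPZ hx), hu1 y (hPZ hy), u0, hx, hy, if_true] at hxy
      exact hlab (hPZ hx) (hPZ hy) (by exact_mod_cast hxy)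
    rw [← Finset.card_image_of_injOn i1, ← Finset.card_insert_of_notMem (a := (0:ℂ))]
    · exact Finset.card_le_card (Finset.insert_subset_insert _ (Finset.image_subset_image hPZ))
    · intro hmem
      obtain ⟨x, hx, hx0⟩ := Finset.mem_image.1 hmem
      simp only [hu1 x (hPZ hx), u0, hx, if_true] at hx0
      have := hlab0 x
      have h0 : lab x = 0 := by exact_mod_cast hx0
      omega
  have a2 : (insert 0 (Zt.image fun c => MvPolynomial.eval c u)).card ≤ Pt.card + 1 := by
    refine (Finset.card_insert_le _ _).trans ?_
    have : Zt.image (fun c => MvPolynomial.eval c u) ⊆ Pt.image (fun c => MvPolynomial.eval c u) := by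
      intro α hα
      obtain ⟨x, hx, rfl⟩ := Finset.mem_image.1 hα
      rcases hPtor x hx with h1 | h1
      · exact Finset.mem_image_of_mem _ h1
      · exact Finset.mem_image.2 ⟨_, h1, hu2 x⟩
    have := (Finset.card_le_card this).trans Finset.card_image_le
    omega
  -- second inequality
  have b1 : (Z0.filter (fun x => ¬ tau w x = x)).card + 1 ≤
      (insert 0 (Z0.image fun c => MvPolynomial.eval c g)).card := by
    have i1 : Set.InjOn (fun c => MvPolynomial.eval c g)
        ((Z0.filter (fun x => ¬ tau w x = x) : Finset _) : Set (ι → ℂ)) := by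
      intro x hx y hy hxy
      have hx := Finset.mem_filter.1 (Finset.mem_coe.1 hx)
      have hy := Finset.mem_filter.1 (Finset.mem_coe.1 hy)
      simp only [hg1 x hx.1, hg1 y hy.1, g0, hx.2, hy.2, if_false] at hxy
      have l1 := hlab0 x
      have l2 := hlab0 y
      have l3 := hlab0 (tau w x)
      have l4 := hlab0 (tau w y)
      split_ifs at hxy with c1 c2 c2
      · exact hlab hx.1 hy.1 (by exact_mod_cast hxy)
      · exfalso
        have : ((lab x + lab (tau w y) : ℕ) : ℂ) = 0 := by push_cast; rw [hxy]; ring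
        have : lab x + lab (tau w y) = 0 := by exact_mod_cast this
        omega
      · exfalso
        have : ((lab y + lab (tau w x) : ℕ) : ℂ) = 0 := by push_cast; rw [← hxy]; ring
        have : lab y + lab (tau w x) = 0 := by exact_mod_cast this
        omega
      · have := hlab (τ0 x hx.1) (τ0 y hy.1) (by exact_mod_cast neg_injective hxy)
        rw [← tau_tau w x, this, tau_tau]
    rw [← Finset.card_image_of_injOn i1, ← Finset.card_insert_of_notMem (a := (0:ℂ))]
    · exact Finset.card_le_card (Finset.insert_subset_insert _
        (Finset.image_subset_image (Finset.filter_subset _ _)))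
    · intro hmem
      obtain ⟨x, hx, hx0⟩ := Finset.mem_image.1 hmem
      have hx := Finset.mem_filter.1 hx
      simp only [hg1 x hx.1, g0, hx.2, if_false] at hx0
      have l1 := hlab0 x
      have l3 := hlab0 (tau w x)
      split_ifs at hx0
      · have h0 : lab x = 0 := by exact_mod_cast hx0
        omega
      · have h0 : lab (tau w x) = 0 := by exact_mod_cast neg_eq_zero.1 hx0
        omega
  have b2 : (insert 0 (Zt.image fun c => MvPolynomial.eval c g)).card ≤
      (Zt.filter (fun x => ¬ tau w x = x)).card + 1 := by
    have : insert 0 (Zt.image (fun c => MvPolynomial.eval c g)) ⊆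
        insert 0 ((Zt.filter (fun x => ¬ tau w x = x)).image (fun c => MvPolynomial.eval c g)) := by
      refine Finset.insert_subset (Finset.mem_insert_self _ _) ?_
      intro α hα
      obtain ⟨x, hx, rfl⟩ := Finset.mem_image.1 hα
      by_cases hfx : tau w x = x
      · have h1 := hg2 x
        rw [hfx] at h1
        have h2 : MvPolynomial.eval x g = 0 := by
          have : (2:ℂ) * MvPolynomial.eval x g = 0 := by linear_combination h1
          simpa using this
        simp only [h2]
        exact Finset.mem_insert_self _ _
      · exact Finset.mem_insert_of_mem (Finset.mem_image_of_mem _ (Finset.mem_filter.2 ⟨hx, hfx⟩))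
    refine (Finset.card_le_card this).trans ((Finset.card_insert_le _ _).trans ?_)
    have : ((Zt.filter (fun x => ¬ tau w x = x)).image (fun c => MvPolynomial.eval c g)).card ≤
      (Zt.filter (fun x => ¬ tau w x = x)).card := Finset.card_image_le
    omega
  have s0 := Finset.card_filter_add_card_filter_not (s := Z0) (fun x => tau w x = x)
  have st := Finset.card_filter_add_card_filter_not (s := Zt) (fun x => tau w x = x)
  omega

open MvPolynomial in
theorem abstract_fix {ι : Type} [Fintype ι] {N : ℕ} (hN : Fintype.card ι = N)
    (w : ι → ℕ) (hw : ∀ i, 0 < w i) (v : Fin N → ℕ) (hv : ∀ i, 0 < v i)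
    (Φ : Fin N → MvPolynomial ι ℂ)
    (hΦ : ∀ r, IsWeightedHomogeneous w (Φ r) (v r))
    (h0 : ∀ c : ι → ℂ, (∀ r, eval c (Φ r) = 0) → c = 0) (K : ℕ)
    (hK : ∏ r, v r ≤ K * ∏ i, w i) :
    (∀ h, (Zf Φ h).Finite ∧ (Zf Φ h).ncard ≤ K) ∧
    ∀ (h h' : Fin N → ℂ) (_ : ∀ r, Odd (v r) → h r = 0) (_ : ∀ r, Odd (v r) → h' r = 0)
    (_ : (Zf Φ h).ncard = K) (_ : (Zf Φ h').ncard = K),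
    {c ∈ Zf Φ h | tau w c = c}.ncard = {c ∈ Zf Φ h' | tau w c = c}.ncard := by
  classical
  have hfin := finite_of_zero_fibre w hw v hv Φ hΦ h0
  have hind := algInd_of_zero_fibre hN Φ hfin
  have hwp : 0 < ∏ i, w i := Finset.prod_pos fun i _ => hw i
  have hS : ∀ (h : Fin N → ℂ) (S : Finset (ι → ℂ)), (S : Set (ι → ℂ)) ⊆ Zf Φ h → S.card ≤ K := by
    intro h S hS
    have := card_bound hN w hw v hv Φ hΦ hfin hind h S (fun c hc => hS hc)
    exact Nat.le_of_mul_le_mul_right (this.trans hK) hwp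
  have hbd : ∀ h, (Zf Φ h).Finite ∧ (Zf Φ h).ncard ≤ K := by
    intro h
    have hf : (Zf Φ h).Finite := by
      by_contra hinf
      obtain ⟨S, hSs, hSc⟩ := Set.Infinite.exists_subset_card_eq hinf (K + 1)
      have := hS h S hSs
      omega
    refine ⟨hf, ?_⟩
    rw [Set.ncard_eq_toFinset_card _ hf]
    exact hS h _ (by simp)
  refine ⟨hbd, fun h h' hodd hodd' hc hc' => ?_⟩
  obtain ⟨F, hF⟩ := fix_generic hΦ hfin hind K hbd h h' hodd hodd' hc
  obtain ⟨F', hF'⟩ := fix_generic hΦ hfin hind K hbd h' h hodd' hodd hc'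
  obtain ⟨t, ht⟩ := Infinite.exists_notMem_finset (F ∪ F'.image (fun s => 1 - s))
  rw [Finset.mem_union, not_or] at ht
  have h1 := hF t ht.1
  have h2 := hF' (1 - t) (by
    intro hmem
    exact ht.2 (Finset.mem_image.2 ⟨_, hmem, by ring⟩))
  rw [h1, h2]
  have : (fun r => h r + t * (h' r - h r)) = (fun r => h' r + (1 - t) * (h r - h' r)) := by
    funext r; ring
  rw [this]

end WrFix

open Polynomial

namespace WrFix

/-- determinant of falling factorials -/
noncomputable def Vd {d : ℕ} (κ : Fin d → ℕ) : ℂ :=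
  Matrix.det (Matrix.of fun i j : Fin d => ((κ i).descFactorial j : ℂ))

/-- triangular number -/
def tri (d : ℕ) : ℕ := ∑ j : Fin d, (j : ℕ)

lemma Vd_eq {d : ℕ} (κ : Fin d → ℕ) :
    Vd κ = (Matrix.vandermonde (fun i => (κ i : ℂ))).det := by
  rw [Matrix.det_eval_matrixOfPolynomials_eq_det_vandermonde _
    (fun j : Fin d => descPochhammer ℂ (j : ℕ)) (fun i => descPochhammer_natDegree ℂ _)
    (fun i => monic_descPochhammer ℂ _)]
  rw [Vd]
  congr 1
  ext i j
  simp only [Matrix.of_apply]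
  rw [descPochhammer_eval_eq_descFactorial]

lemma Vd_ne_zero_iff {d : ℕ} (κ : Fin d → ℕ) : Vd κ ≠ 0 ↔ Function.Injective κ := by
  rw [Vd_eq, Matrix.det_vandermonde_ne_zero_iff]
  exact ⟨fun h i j hij => h (by simp [hij]), fun h i j hij => h (Nat.cast_injective (R := ℂ) hij)⟩

lemma X_pow_iterate {n : ℕ} {f : ℂ[X]} (hf : f ∈ degreeLT ℂ n) (j : ℕ) :
    X ^ j * (fun p : ℂ[X] => derivative p)^[j] f =
      ∑ k : Fin n, C (f.coeff k) * X ^ (k : ℕ) * C (((k : ℕ).descFactorial j : ℕ) : ℂ) := by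
  have hfe : f = ∑ k : Fin n, C (f.coeff k) * X ^ (k : ℕ) := by
    rw [Fin.sum_univ_eq_sum_range (fun k => C (f.coeff k) * X ^ k) n]
    rw [mem_degreeLT] at hf
    ext m
    simp only [finsetSum_coeff, coeff_C_mul_X_pow]
    rw [Finset.sum_ite_eq]
    split_ifs with h
    · rfl
    · rw [coeff_eq_zero_of_degree_lt]
      refine lt_of_lt_of_le hf ?_
      rw [Finset.mem_range, not_lt] at h
      exact_mod_cast h
  have e : (fun p : ℂ[X] => derivative p)^[j] f = (⇑derivative)^[j] f := rfl
  rw [e]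
  conv_lhs => rw [hfe]
  rw [iterate_derivative_sum, Finset.mul_sum]
  refine Finset.sum_congr rfl fun k _ => ?_
  rw [iterate_derivative_C_mul, iterate_derivative_X_pow_eq_natCast_mul]
  by_cases hjk : j ≤ k
  · obtain ⟨m, hm⟩ := Nat.exists_eq_add_of_le hjk
    rw [hm]
    simp only [Nat.add_sub_cancel_left, map_natCast]
    ring
  · rw [Nat.descFactorial_of_lt (not_le.1 hjk)]
    simp

lemma wronsk_expand {d n : ℕ} (f : Fin d → ℂ[X]) (hf : ∀ i, f i ∈ degreeLT ℂ n) :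
    X ^ tri d * wronskDet d f = ∑ κ : Fin d → Fin n,
      C (Vd (fun i => (κ i : ℕ)) * ∏ i, (f i).coeff (κ i)) * X ^ (∑ i, (κ i : ℕ)) := by
  have h1 : (X : ℂ[X]) ^ tri d = ∏ j : Fin d, X ^ (j : ℕ) := by
    rw [tri, Finset.prod_pow_eq_pow_sum]
  rw [h1, wronskDet, ← Matrix.det_mul_row]
  have h2 : (Matrix.of fun i j : Fin d => (X : ℂ[X]) ^ (j : ℕ) *
      (Matrix.of fun i j : Fin d => (fun p : ℂ[X] => derivative p)^[(j : ℕ)] (f i)) i j) =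
      fun i => ∑ k : Fin n, fun j : Fin d => C ((f i).coeff k) * X ^ (k : ℕ) *
        C (((k : ℕ).descFactorial j : ℕ) : ℂ) := by
    funext i j
    rw [Matrix.of_apply, Matrix.of_apply, X_pow_iterate (hf i), Finset.sum_apply]
  rw [h2]
  refine (MultilinearMap.map_sum (Matrix.detRowAlternating (n := Fin d) (R := ℂ[X])).toMultilinearMap
    (fun (i : Fin d) (k : Fin n) => fun j : Fin d => C ((f i).coeff k) * X ^ (k : ℕ) *
        C (((k : ℕ).descFactorial j : ℕ) : ℂ))).trans ?_
  refine Finset.sum_congr rfl fun κ _ => ?_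
  have h3 := Matrix.det_mul_column (fun i => C ((f i).coeff (κ i)) * X ^ (κ i : ℕ))
    (Matrix.of fun i j : Fin d => C (((κ i : ℕ).descFactorial j : ℕ) : ℂ))
  refine h3.trans ?_
  have h4 : (Matrix.of fun i j : Fin d => C (((κ i : ℕ).descFactorial j : ℕ) : ℂ)).det =
      C (Vd (fun i => (κ i : ℕ))) := by
    rw [Vd, RingHom.map_det]
    rfl
  rw [h4, Finset.prod_mul_distrib, Finset.prod_pow_eq_pow_sum, map_mul, map_prod]
  ring

lemma wronsk_coeff {d n : ℕ} (f : Fin d → ℂ[X]) (hf : ∀ i, f i ∈ degreeLT ℂ n) (m : ℕ) :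
    (wronskDet d f).coeff m = ∑ κ : Fin d → Fin n,
      if m + tri d = ∑ i, (κ i : ℕ) then Vd (fun i => (κ i : ℕ)) * ∏ i, (f i).coeff (κ i) else 0 := by
  have h1 := congrArg (fun p => p.coeff (m + tri d)) (wronsk_expand f hf)
  simp only [coeff_X_pow_mul, finsetSum_coeff, coeff_C_mul_X_pow] at h1
  rw [h1]

lemma wronsk_mat {d : ℕ} (B : Matrix (Fin d) (Fin d) ℂ) (f : Fin d → ℂ[X]) :
    wronskDet d (fun i => ∑ k, B i k • f k) = B.det • wronskDet d f := by
  have : (Matrix.of fun i j : Fin d =>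
    (fun p : ℂ[X] => derivative p)^[(j : ℕ)] (∑ k, B i k • f k)) = (B.map C) *
      (Matrix.of fun i j : Fin d => (fun p : ℂ[X] => derivative p)^[(j : ℕ)] (f i)) := by
    ext1 i j
    rw [Matrix.of_apply, Matrix.mul_apply]
    change (⇑derivative)^[(j : ℕ)] (∑ k, B i k • f k) = ∑ k, C (B i k) * (⇑derivative)^[(j : ℕ)] (f k)
    rw [iterate_derivative_sum]
    refine Finset.sum_congr rfl fun k _ => ?_
    rw [iterate_derivative_smul, smul_eq_C_mul]
  rw [wronskDet, this, Matrix.det_mul, wronskDet, smul_eq_C_mul, RingHom.map_det]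
  rfl

end WrFix

open Polynomial

namespace WrFix

/-- apply a matrix to a tuple of polynomials -/
noncomputable def matAct {d : ℕ} (B : Matrix (Fin d) (Fin d) ℂ) (f : Fin d → ℂ[X]) : Fin d → ℂ[X] :=
  fun i => ∑ k, B i k • f k

lemma matAct_mul {d : ℕ} (A B : Matrix (Fin d) (Fin d) ℂ) (f : Fin d → ℂ[X]) :
    matAct A (matAct B f) = matAct (A * B) f := by
  funext i
  simp only [matAct, Matrix.mul_apply, Finset.smul_sum, Finset.sum_smul, smul_smul]
  rw [Finset.sum_comm]

lemma matAct_one {d : ℕ} (f : Fin d → ℂ[X]) : matAct 1 f = f := by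
  funext i
  simp [matAct, Matrix.one_apply, Finset.sum_ite_eq]

lemma matAct_inv {d : ℕ} {B : Matrix (Fin d) (Fin d) ℂ} (hB : B.det ≠ 0) (f : Fin d → ℂ[X]) :
    matAct B⁻¹ (matAct B f) = f := by
  rw [matAct_mul, Matrix.nonsing_inv_mul _ (isUnit_iff_ne_zero.2 hB), matAct_one]

lemma span_matAct_le {d : ℕ} (B : Matrix (Fin d) (Fin d) ℂ) (f : Fin d → ℂ[X]) :
    Submodule.span ℂ (Set.range (matAct B f)) ≤ Submodule.span ℂ (Set.range f) := by
  rw [Submodule.span_le]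
  rintro _ ⟨i, rfl⟩
  exact Submodule.sum_mem _ fun k _ => Submodule.smul_mem _ _ (Submodule.subset_span ⟨k, rfl⟩)

lemma span_matAct {d : ℕ} {B : Matrix (Fin d) (Fin d) ℂ} (hB : B.det ≠ 0) (f : Fin d → ℂ[X]) :
    Submodule.span ℂ (Set.range (matAct B f)) = Submodule.span ℂ (Set.range f) := by
  refine le_antisymm (span_matAct_le _ _) ?_
  conv_lhs => rw [← matAct_inv hB f]
  exact span_matAct_le _ _

lemma li_iff_finrank {d : ℕ} (f : Fin d → ℂ[X]) :
    LinearIndependent ℂ f ↔ Module.finrank ℂ (Submodule.span ℂ (Set.range f)) = d := by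
  rw [linearIndependent_iff_card_eq_finrank_span, Fintype.card_fin, Set.finrank, eq_comm]

lemma li_matAct {d : ℕ} {B : Matrix (Fin d) (Fin d) ℂ} (hB : B.det ≠ 0) {f : Fin d → ℂ[X]}
    (hf : LinearIndependent ℂ f) : LinearIndependent ℂ (matAct B f) := by
  rw [li_iff_finrank, span_matAct hB]
  exact (li_iff_finrank f).1 hf

lemma wronsk_matAct {d : ℕ} (B : Matrix (Fin d) (Fin d) ℂ) (f : Fin d → ℂ[X]) :
    wronskDet d (matAct B f) = B.det • wronskDet d f := wronsk_mat B f

lemma exists_matAct {d : ℕ} {f f' : Fin d → ℂ[X]} (hf : LinearIndependent ℂ f)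
    (hs : Submodule.span ℂ (Set.range f) = Submodule.span ℂ (Set.range f')) :
    ∃ B : Matrix (Fin d) (Fin d) ℂ, B.det ≠ 0 ∧ f = matAct B f' := by
  have h1 : ∀ i, ∃ b : Fin d → ℂ, ∑ k, b k • f' k = f i := by
    intro i
    rw [← Submodule.mem_span_range_iff_exists_fun, ← hs]
    exact Submodule.subset_span ⟨i, rfl⟩
  choose B hB using h1
  refine ⟨Matrix.of B, ?_, funext fun i => (hB i).symm⟩
  intro h0
  obtain ⟨v, hv, hv0⟩ := Matrix.exists_vecMul_eq_zero_iff.2 h0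
  apply hv
  rw [Fintype.linearIndependent_iff] at hf
  funext i
  refine hf v ?_ i
  calc ∑ i, v i • f i = ∑ k, (∑ i, v i * B i k) • f' k := by
        simp only [← hB, Finset.smul_sum, Finset.sum_smul, smul_smul]
        rw [Finset.sum_comm]
    _ = 0 := by
        refine Finset.sum_eq_zero fun k _ => ?_
        have : ∑ i, v i * B i k = 0 := congrFun hv0 k
        rw [this, zero_smul]

lemma inFibre_iff {d : ℕ} {x : Submodule ℂ ℂ[X]} {h : ℂ[X]} {f : Fin d → ℂ[X]}
    (hf : LinearIndependent ℂ f) (hs : Submodule.span ℂ (Set.range f) = x) :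
    InFibre d x h ↔ ∃ c : ℂ, c ≠ 0 ∧ wronskDet d f = c • h := by
  constructor
  · rintro ⟨f', c, hc, hf', hs', hw⟩
    obtain ⟨B, hB, rfl⟩ := exists_matAct hf (hs.trans hs'.symm)
    refine ⟨B.det * c, mul_ne_zero hB hc, ?_⟩
    rw [wronsk_matAct, hw, smul_smul]
  · rintro ⟨c, hc, hw⟩
    exact ⟨f, c, hc, hf, hs, hw⟩

lemma exists_minor {d n : ℕ} {f : Fin d → ℂ[X]} (hf : LinearIndependent ℂ f)
    (hn : ∀ i, f i ∈ degreeLT ℂ n) :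
    ∃ κ : Fin d → Fin n, (Matrix.of fun i l : Fin d => (f i).coeff (κ l)).det ≠ 0 := by
  let A : Matrix (Fin d) (Fin n) ℂ := Matrix.of fun i k => (f i).coeff k
  have hli : LinearIndependent ℂ A.row := by
    rw [Fintype.linearIndependent_iff] at hf ⊢
    intro v hv
    refine hf v ?_
    ext m
    rw [finsetSum_coeff, coeff_zero]
    by_cases hm : m < n
    · have := congrFun hv ⟨m, hm⟩
      simpa [A, Matrix.row] using this
    · refine Finset.sum_eq_zero fun i _ => ?_
      rw [coeff_smul, coeff_eq_zero_of_degree_lt, smul_zero]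
      refine lt_of_lt_of_le (mem_degreeLT.1 (hn i)) ?_
      exact_mod_cast not_lt.1 hm
  have hr : A.rank = d := by rw [hli.rank_matrix, Fintype.card_fin]
  rw [Matrix.rank_eq_finrank_span_cols] at hr
  obtain ⟨g, hg, hgli⟩ : ∃ g : Fin d → Fin d → ℂ, (∀ i, g i ∈ Set.range A.col) ∧
      LinearIndependent ℂ g := by
    obtain ⟨g, hg, -, hgli⟩ := Submodule.exists_fun_fin_finrank_span_eq ℂ (Set.range A.col)
    exact ⟨g ∘ Fin.cast hr.symm, fun i => hg _, hgli.comp _ (Fin.cast_injective _)⟩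
  choose κ hκ using hg
  refine ⟨κ, ?_⟩
  have : (Matrix.of fun i l : Fin d => (f i).coeff (κ l)) = (Matrix.of g).transpose := by
    ext i l
    rw [Matrix.transpose_apply, Matrix.of_apply, Matrix.of_apply, ← hκ l]
    rfl
  rw [this, Matrix.det_transpose, ← isUnit_iff_ne_zero, ← Matrix.isUnit_iff_isUnit_det,
    ← Matrix.linearIndependent_rows_iff_isUnit]
  exact hgli

lemma echelon {d n : ℕ} {f : Fin d → ℂ[X]} (hf : LinearIndependent ℂ f)
    (hn : ∀ i, f i ∈ degreeLT ℂ n) (wt : Fin n → ℤ) :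
    ∃ (κ : Fin d → Fin n) (B : Matrix (Fin d) (Fin d) ℂ), B.det ≠ 0 ∧
      (∀ i l, (matAct B f i).coeff (κ l) = if i = l then 1 else 0) ∧
      (∀ i (j : Fin n), (matAct B f i).coeff j ≠ 0 → wt j ≤ wt (κ i)) ∧
      (∀ i, matAct B f i ∈ degreeLT ℂ n) := by
  classical
  obtain ⟨κ0, hκ0⟩ := exists_minor hf hn
  obtain ⟨κ, hκ, hmax⟩ := Finset.exists_max_image
    (Finset.univ.filter fun κ : Fin d → Fin n =>
      (Matrix.of fun i l : Fin d => (f i).coeff (κ l)).det ≠ 0)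
    (fun κ => ∑ l, wt (κ l)) ⟨κ0, by simpa using hκ0⟩
  rw [Finset.mem_filter] at hκ
  have hS := hκ.2
  set S : Matrix (Fin d) (Fin d) ℂ := Matrix.of fun i l : Fin d => (f i).coeff (κ l) with hSdef
  have hcoe : ∀ (B : Matrix (Fin d) (Fin d) ℂ) i m, (matAct B f i).coeff m = ∑ k, B i k * (f k).coeff m := by
    intro B i m
    simp [matAct, finsetSum_coeff]
  have hSinv : S⁻¹.det ≠ 0 := by
    rw [Matrix.det_nonsing_inv, Ring.inverse_eq_inv']
    exact inv_ne_zero hS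
  have h1 : ∀ i l, (matAct S⁻¹ f i).coeff (κ l) = if i = l then 1 else 0 := by
    intro i l
    rw [hcoe]
    have := congrFun (congrFun (Matrix.nonsing_inv_mul S (isUnit_iff_ne_zero.2 hS)) i) l
    rw [Matrix.mul_apply, Matrix.one_apply] at this
    exact this
  refine ⟨κ, S⁻¹, hSinv, h1, ?_, ?_⟩
  · intro i j hij
    let κ' := Function.update κ i j
    have h2 : S⁻¹ * (Matrix.of fun i l : Fin d => (f i).coeff (κ' l)) =
        (1 : Matrix (Fin d) (Fin d) ℂ).updateCol i (fun i' => (matAct S⁻¹ f i').coeff j) := by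
      ext i' l
      rw [Matrix.mul_apply, Matrix.updateCol_apply]
      by_cases hl : l = i
      · rw [if_pos hl, hcoe, hl]
        simp [κ']
      · rw [if_neg hl, Matrix.one_apply, ← h1 i' l, hcoe]
        simp [κ', hl]
    have h3 : ((1 : Matrix (Fin d) (Fin d) ℂ).updateCol i
        (fun i' => (matAct S⁻¹ f i').coeff j)).det = (matAct S⁻¹ f i).coeff j := by
      rw [← Matrix.cramer_apply, Matrix.cramer_one]
      rfl
    have h4 : (Matrix.of fun i l : Fin d => (f i).coeff (κ' l)).det ≠ 0 := by
      intro h0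
      have := congrArg Matrix.det h2
      rw [Matrix.det_mul, h0, mul_zero, h3] at this
      exact hij this.symm
    have h5 := hmax κ' (Finset.mem_filter.2 ⟨Finset.mem_univ _, h4⟩)
    have h6 : ∑ l, wt (κ' l) = ∑ l, wt (κ l) + (wt j - wt (κ i)) := by
      rw [← Finset.add_sum_erase _ _ (Finset.mem_univ i),
        ← Finset.add_sum_erase _ (fun l => wt (κ l)) (Finset.mem_univ i)]
      have : ∑ l ∈ Finset.univ.erase i, wt (κ' l) = ∑ l ∈ Finset.univ.erase i, wt (κ l) := by
        refine Finset.sum_congr rfl fun l hl => ?_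
        simp [κ', Finset.ne_of_mem_erase hl]
      rw [this]
      simp [κ']
      ring
    linarith
  · intro i
    exact Submodule.sum_mem _ fun k _ => Submodule.smul_mem _ _ (hn k)

end WrFix

open Polynomial

namespace WrFix

lemma echelon' {d n : ℕ} {f : Fin d → ℂ[X]} (hf : LinearIndependent ℂ f)
    (hn : ∀ i, f i ∈ degreeLT ℂ n) (wt : Fin n → ℤ) :
    ∃ (κ : Fin d → Fin n) (B : Matrix (Fin d) (Fin d) ℂ), StrictMono κ ∧ B.det ≠ 0 ∧
      (∀ i l, (matAct B f i).coeff (κ l) = if i = l then 1 else 0) ∧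
      (∀ i (j : Fin n), (matAct B f i).coeff j ≠ 0 → wt j ≤ wt (κ i)) ∧
      (∀ i, matAct B f i ∈ degreeLT ℂ n) := by
  obtain ⟨κ, B, hB, h1, h2, h3⟩ := echelon hf hn wt
  have hinj : Function.Injective κ := by
    intro l l' h
    by_contra hne
    have := h1 l l'
    rw [← h, h1 l l, if_pos rfl, if_neg hne] at this
    exact one_ne_zero this
  let σ : Equiv.Perm (Fin d) := Tuple.sort κ
  have hm : Monotone (κ ∘ σ) := Tuple.monotone_sort κ
  have hact : ∀ i, matAct (B.submatrix σ id) f i = matAct B f (σ i) := fun i => rfl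
  refine ⟨κ ∘ σ, B.submatrix σ id, hm.strictMono_of_injective (hinj.comp σ.injective), ?_, ?_, ?_, ?_⟩
  · rw [Matrix.det_permute]
    refine mul_ne_zero ?_ hB
    exact_mod_cast (Equiv.Perm.sign σ).ne_zero
  · intro i l
    rw [hact, Function.comp_apply, h1]
    simp
  · intro i j h
    rw [hact] at h
    exact h2 _ _ h
  · intro i
    rw [hact]
    exact h3 _

lemma le_of_strictMono {d : ℕ} {κ : Fin d → ℕ} (h : StrictMono κ) (i : Fin d) : (i : ℕ) ≤ κ i := by
  obtain ⟨i, hi⟩ := i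
  induction i with
  | zero => simp
  | succ i ih =>
    have h1 := ih (by omega)
    have h2 : κ ⟨i, by omega⟩ < κ ⟨i + 1, hi⟩ := h (by simp [Fin.lt_def])
    simp only at h1 ⊢
    omega

lemma tri_le {d : ℕ} {κ : Fin d → ℕ} (h : StrictMono κ) : tri d ≤ ∑ i, κ i :=
  Finset.sum_le_sum fun i _ => le_of_strictMono h i

lemma eps_eq {d n : ℕ} (ε : ℤ) (hε : ε ≠ 0) (κ κ' : Fin d → Fin n)
    (h : ∀ i, ε * (κ' i : ℕ) ≤ ε * (κ i : ℕ)) (hs : ∑ i, (κ' i : ℕ) = ∑ i, (κ i : ℕ)) : κ' = κ := by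
  have h1 : ∑ i, ε * ((κ' i : ℕ) : ℤ) = ∑ i, ε * ((κ i : ℕ) : ℤ) := by
    rw [← Finset.mul_sum, ← Finset.mul_sum]
    congr 1
    exact_mod_cast hs
  rw [Finset.sum_eq_sum_iff_of_le (fun i _ => h i)] at h1
  funext i
  have := mul_left_cancel₀ hε (h1 i (Finset.mem_univ _))
  exact Fin.ext (by exact_mod_cast this)

lemma lead_coeff {d n : ℕ} (ε : ℤ) (hε : ε ≠ 0) (g : Fin d → ℂ[X]) (hn : ∀ i, g i ∈ degreeLT ℂ n)
    (κ : Fin d → Fin n) (h1 : ∀ i, (g i).coeff (κ i) = 1)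
    (h2 : ∀ i (j : Fin n), (g i).coeff j ≠ 0 → ε * (j : ℕ) ≤ ε * (κ i : ℕ)) (m : ℕ)
    (hm : m + tri d = ∑ i, (κ i : ℕ)) : (wronskDet d g).coeff m = Vd fun i => (κ i : ℕ) := by
  rw [wronsk_coeff g hn m, Finset.sum_eq_single κ]
  · rw [if_pos hm]
    simp [h1]
  · intro κ' _ hne
    split_ifs with h
    · by_contra h0
      have h3 := right_ne_zero_of_mul h0
      rw [Finset.prod_ne_zero_iff] at h3
      exact hne (eps_eq ε hε κ κ' (fun i => h2 i _ (h3 i (Finset.mem_univ _))) (h ▸ hm))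
    · rfl
  · simp

lemma lead_vanish {d n : ℕ} (ε : ℤ) (g : Fin d → ℂ[X]) (hn : ∀ i, g i ∈ degreeLT ℂ n)
    (κ : Fin d → Fin n) 
    (h2 : ∀ i (j : Fin n), (g i).coeff j ≠ 0 → ε * (j : ℕ) ≤ ε * (κ i : ℕ)) (m : ℕ)
    (hm : ε * (∑ i, (κ i : ℕ) : ℕ) < ε * (m + tri d : ℕ)) : (wronskDet d g).coeff m = 0 := by
  rw [wronsk_coeff g hn m, Finset.sum_eq_zero]
  intro κ' _
  split_ifs with h
  · by_contra h0
    have h3 := right_ne_zero_of_mul h0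
    rw [Finset.prod_ne_zero_iff] at h3
    have h4 : ∑ i, ε * ((κ' i : ℕ) : ℤ) ≤ ∑ i, ε * ((κ i : ℕ) : ℤ) :=
      Finset.sum_le_sum fun i _ => h2 i _ (h3 i (Finset.mem_univ _))
    rw [← Finset.mul_sum, ← Finset.mul_sum] at h4
    rw [h] at hm
    push_cast at hm
    linarith
  · rfl

end WrFix

open Polynomial

namespace WrFix

/-- index set of the coordinates of the cell of `J` -/
abbrev Cidx {d n : ℕ} (J : Fin d → Fin n) : Type :=
  {p : Fin d × Fin n // p.2 < J p.1 ∧ ∀ l, J l ≠ p.2}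

/-- echelon coefficients -/
def cf {R : Type} [Zero R] [One R] {d n : ℕ} (J : Fin d → Fin n) (c : Cidx J → R) (i : Fin d) (k : Fin n) : R :=
  if J i = k then 1 else if h : (k < J i ∧ ∀ l, J l ≠ k) then c ⟨(i, k), h⟩ else 0

/-- echelon basis -/
noncomputable def fpoly {d n : ℕ} (J : Fin d → Fin n) (c : Cidx J → ℂ) (i : Fin d) : ℂ[X] :=
  ∑ k : Fin n, C (cf J c i k) * X ^ (k : ℕ)

lemma fpoly_coeff {d n : ℕ} (J : Fin d → Fin n) (c : Cidx J → ℂ) (i : Fin d) (k : Fin n) :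
    (fpoly J c i).coeff k = cf J c i k := by
  simp only [fpoly, finsetSum_coeff, coeff_C_mul_X_pow]
  rw [Finset.sum_eq_single k]
  · simp
  · intro b _ hb
    rw [if_neg]
    exact fun h => hb (Fin.ext h.symm)
  · simp

lemma fpoly_mem {d n : ℕ} (J : Fin d → Fin n) (c : Cidx J → ℂ) (i : Fin d) :
    fpoly J c i ∈ degreeLT ℂ n := by
  refine Submodule.sum_mem _ fun k _ => ?_
  rw [mem_degreeLT]
  refine lt_of_le_of_lt (degree_C_mul_X_pow_le _ _) ?_
  exact_mod_cast k.2

lemma ext_degreeLT {n : ℕ} {f g : ℂ[X]} (hf : f ∈ degreeLT ℂ n) (hg : g ∈ degreeLT ℂ n)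
    (h : ∀ k : Fin n, f.coeff k = g.coeff k) : f = g := by
  ext m
  by_cases hm : m < n
  · exact h ⟨m, hm⟩
  · rw [mem_degreeLT] at hf hg
    have : (n : WithBot ℕ) ≤ (m : WithBot ℕ) := by exact_mod_cast not_lt.1 hm
    rw [coeff_eq_zero_of_degree_lt (hf.trans_le this), coeff_eq_zero_of_degree_lt (hg.trans_le this)]

lemma cf_J {d n : ℕ} {J : Fin d → Fin n} (hJ : StrictMono J) (c : Cidx J → ℂ) (i l : Fin d) :
    cf J c i (J l) = if i = l then 1 else 0 := by
  unfold cf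
  by_cases h : i = l
  · simp [h]
  · rw [if_neg (fun e => h (hJ.injective e)), dif_neg (fun e => e.2 l rfl), if_neg h]

lemma cf_le {d n : ℕ} (J : Fin d → Fin n) (c : Cidx J → ℂ) (i : Fin d) (k : Fin n)
    (h : cf J c i k ≠ 0) : k ≤ J i := by
  unfold cf at h
  split_ifs at h with h1 h2
  · exact h1.ge
  · exact h2.1.le
  · exact absurd rfl h

lemma cf_idx {d n : ℕ} (J : Fin d → Fin n) (c : Cidx J → ℂ) (p : Cidx J) :
    cf J c p.1.1 p.1.2 = c p := by
  unfold cf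
  rw [if_neg (p.2.2 _), dif_pos p.2]

lemma fpoly_li {d n : ℕ} {J : Fin d → Fin n} (hJ : StrictMono J) (c : Cidx J → ℂ) :
    LinearIndependent ℂ (fpoly J c) := by
  rw [Fintype.linearIndependent_iff]
  intro v hv l
  have := congrArg (fun p => p.coeff (J l)) hv
  simp only [finsetSum_coeff, coeff_smul, fpoly_coeff, cf_J hJ, coeff_zero] at this
  simpa using this

lemma fpoly_inj {d n : ℕ} {J : Fin d → Fin n} (hJ : StrictMono J) (c c' : Cidx J → ℂ)
    (h : Submodule.span ℂ (Set.range (fpoly J c)) = Submodule.span ℂ (Set.range (fpoly J c'))) :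
    c = c' := by
  obtain ⟨B, -, hB⟩ := exists_matAct (fpoly_li hJ c) h
  have h1 : B = 1 := by
    ext i l
    have := congrArg (fun p => (p i).coeff (J l)) hB
    simp only [matAct, finsetSum_coeff, coeff_smul, fpoly_coeff, cf_J hJ] at this
    rw [Matrix.one_apply, this]
    simp
  rw [h1, matAct_one] at hB
  funext p
  rw [← cf_idx J c p, ← cf_idx J c' p, ← fpoly_coeff, ← fpoly_coeff, hB]

lemma fpoly_surj {d n : ℕ} {J : Fin d → Fin n} (g : Fin d → ℂ[X])
    (hn : ∀ i, g i ∈ degreeLT ℂ n)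
    (h1 : ∀ i l, (g i).coeff (J l) = if i = l then 1 else 0)
    (h2 : ∀ i (j : Fin n), (g i).coeff j ≠ 0 → j ≤ J i) : ∃ c, g = fpoly J c := by
  refine ⟨fun p => (g p.1.1).coeff p.1.2, funext fun i => ext_degreeLT (hn i) (fpoly_mem J _ i) fun k => ?_⟩
  rw [fpoly_coeff]
  unfold cf
  split_ifs with h3 h4
  · rw [← h3, h1, if_pos rfl]
  · rfl
  · by_contra h0
    apply h4
    refine ⟨lt_of_le_of_ne (h2 i k h0) (Ne.symm h3), fun l hl => ?_⟩
    rw [← hl, h1] at h0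
    by_cases hil : i = l
    · exact h3 (hil ▸ hl)
    · simp [hil] at h0

/-- the Wronskian coordinates -/
noncomputable def PhiJ {d n : ℕ} (J : Fin d → Fin n) (r : ℕ) : MvPolynomial (Cidx J) ℂ :=
  ∑ κ : Fin d → Fin n, if r + tri d = ∑ i, (κ i : ℕ) then
    MvPolynomial.C ((Vd fun i => (J i : ℕ))⁻¹ * Vd (fun i => (κ i : ℕ))) *
      ∏ i, cf J (fun p => (MvPolynomial.X p : MvPolynomial (Cidx J) ℂ)) i (κ i) else 0

lemma eval_cf {d n : ℕ} (J : Fin d → Fin n) (c : Cidx J → ℂ) (i : Fin d) (k : Fin n) :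
    MvPolynomial.eval c (cf J (fun p => (MvPolynomial.X p : MvPolynomial (Cidx J) ℂ)) i k) =
      cf J c i k := by
  unfold cf
  split_ifs <;> simp

lemma VdJ_ne {d n : ℕ} {J : Fin d → Fin n} (hJ : StrictMono J) : Vd (fun i => (J i : ℕ)) ≠ 0 :=
  (Vd_ne_zero_iff _).2 fun _ _ h => hJ.injective (Fin.ext h)

lemma eval_PhiJ {d n : ℕ} {J : Fin d → Fin n} (hJ : StrictMono J) (r : ℕ) (c : Cidx J → ℂ) :
    (wronskDet d (fpoly J c)).coeff r =
      Vd (fun i => (J i : ℕ)) * MvPolynomial.eval c (PhiJ J r) := by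
  rw [wronsk_coeff _ (fpoly_mem J c), PhiJ, map_sum, Finset.mul_sum]
  refine Finset.sum_congr rfl fun κ _ => ?_
  split_ifs with h
  · rw [map_mul, map_prod, MvPolynomial.eval_C]
    simp only [eval_cf, fpoly_coeff]
    rw [← mul_assoc, ← mul_assoc, mul_inv_cancel₀ (VdJ_ne hJ), one_mul]
  · simp

/-- weights of the cell coordinates -/
def wJ {d n : ℕ} (J : Fin d → Fin n) (p : Cidx J) : ℕ := (J p.1.1 : ℕ) - (p.1.2 : ℕ)

lemma wJ_pos {d n : ℕ} (J : Fin d → Fin n) (p : Cidx J) : 0 < wJ J p := by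
  have := p.2.1
  rw [Fin.lt_def] at this
  unfold wJ
  omega

lemma PhiJ_hom {d n : ℕ} (J : Fin d → Fin n) {NJ : ℕ} (hN : NJ + tri d = ∑ i, (J i : ℕ)) (r : ℕ) (hr : r ≤ NJ) :
    MvPolynomial.IsWeightedHomogeneous (wJ J) (PhiJ J r) (NJ - r) := by
  refine MvPolynomial.IsWeightedHomogeneous.sum _ _ _ fun κ _ => ?_
  split_ifs with h
  · by_cases hle : ∀ i, κ i ≤ J i
    · have h1 : ∀ i, MvPolynomial.IsWeightedHomogeneous (wJ J)
          (cf J (fun p => (MvPolynomial.X p : MvPolynomial (Cidx J) ℂ)) i (κ i)) ((J i : ℕ) - (κ i : ℕ)) := by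
        intro i
        unfold cf
        split_ifs with h1 h2
        · rw [h1, Nat.sub_self]
          exact MvPolynomial.isWeightedHomogeneous_one _ _
        · exact MvPolynomial.isWeightedHomogeneous_X ℂ (wJ J) _
        · exact MvPolynomial.isWeightedHomogeneous_zero _ _ _
      have h2 := (MvPolynomial.isWeightedHomogeneous_C (wJ J)
        ((Vd fun i => (J i : ℕ))⁻¹ * Vd (fun i => (κ i : ℕ)))).mul
        (MvPolynomial.IsWeightedHomogeneous.prod Finset.univ _ _ fun i _ => h1 i)
      have h3 : NJ - r = 0 + ∑ i, ((J i : ℕ) - (κ i : ℕ)) := by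
        have : ∑ i, ((J i : ℕ) - (κ i : ℕ)) + ∑ i, (κ i : ℕ) = ∑ i, (J i : ℕ) := by
          rw [← Finset.sum_add_distrib]
          refine Finset.sum_congr rfl fun i _ => Nat.sub_add_cancel (hle i)
        omega
      rw [h3]
      exact h2
    · push Not at hle
      obtain ⟨i, hi⟩ := hle
      have : cf J (fun p => (MvPolynomial.X p : MvPolynomial (Cidx J) ℂ)) i (κ i) = 0 := by
        unfold cf
        rw [if_neg hi.ne, dif_neg fun e => absurd e.1 (not_lt.2 hi.le)]
      rw [Finset.prod_eq_zero (Finset.mem_univ i) this, mul_zero]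
      exact MvPolynomial.isWeightedHomogeneous_zero _ _ _
  · exact MvPolynomial.isWeightedHomogeneous_zero _ _ _

end WrFix

open Polynomial

namespace WrFix

lemma fpoly_top {d n : ℕ} {J : Fin d → Fin n} (hJ : StrictMono J) {NJ : ℕ}
    (hN : NJ + tri d = ∑ i, (J i : ℕ)) (c : Cidx J → ℂ) :
    (wronskDet d (fpoly J c)).coeff NJ = Vd fun i => (J i : ℕ) := by
  refine lead_coeff 1 one_ne_zero _ (fpoly_mem J c) J (fun i => ?_) (fun i j h => ?_) NJ hN
  · rw [fpoly_coeff, cf_J hJ, if_pos rfl]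
  · rw [fpoly_coeff] at h
    have := cf_le J c i j h
    rw [Fin.le_def] at this
    omega

lemma fpoly_above {d n : ℕ} {J : Fin d → Fin n} {NJ : ℕ}
    (hN : NJ + tri d = ∑ i, (J i : ℕ)) (c : Cidx J → ℂ) (m : ℕ) (hm : NJ < m) :
    (wronskDet d (fpoly J c)).coeff m = 0 := by
  refine lead_vanish 1 _ (fpoly_mem J c) J (fun i j h => ?_) m ?_
  · rw [fpoly_coeff] at h
    have := cf_le J c i j h
    rw [Fin.le_def] at this
    omega
  · rw [← hN]
    push_cast
    omega

lemma fpoly_wronsk {d n : ℕ} {J : Fin d → Fin n} (hJ : StrictMono J) {NJ : ℕ}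
    (hN : NJ + tri d = ∑ i, (J i : ℕ)) (c : Cidx J → ℂ) (h : ℂ[X]) (hm : h.Monic) (hd : h.natDegree = NJ) :
    wronskDet d (fpoly J c) = Vd (fun i => (J i : ℕ)) • h ↔
      c ∈ Zf (fun r : Fin NJ => PhiJ J r) (fun r => h.coeff r) := by
  constructor
  · intro e r
    have := eval_PhiJ hJ r c
    rw [e, coeff_smul, smul_eq_mul] at this
    exact (mul_left_cancel₀ (VdJ_ne hJ) this).symm
  · intro e
    ext m
    rw [coeff_smul, smul_eq_mul]
    rcases lt_trichotomy m NJ with h1 | h1 | h1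
    · rw [eval_PhiJ hJ, e ⟨m, h1⟩]
    · rw [h1, fpoly_top hJ hN]
      have : h.coeff NJ = 1 := by rw [← hd]; exact hm
      rw [this, mul_one]
    · rw [fpoly_above hN c m h1, coeff_eq_zero_of_natDegree_lt (hd ▸ h1), mul_zero]

lemma zero_fibre {d n : ℕ} {J : Fin d → Fin n} (hJ : StrictMono J) {NJ : ℕ}
    (hN : NJ + tri d = ∑ i, (J i : ℕ)) (c : Cidx J → ℂ)
    (h : ∀ r : Fin NJ, MvPolynomial.eval c (PhiJ J r) = 0) : c = 0 := by
  have hW : wronskDet d (fpoly J c) = Vd (fun i => (J i : ℕ)) • X ^ NJ := by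
    rw [fpoly_wronsk hJ hN c _ (monic_X_pow _) (natDegree_X_pow _)]
    intro r
    simp only
    rw [h r, coeff_X_pow, if_neg r.2.ne]
  obtain ⟨κ, B, hκ, hB, h1, h2, h3⟩ := echelon' (fpoly_li hJ c) (fpoly_mem J c) (fun j => (-1) * (j : ℕ))
  have hκ' : StrictMono (fun i => (κ i : ℕ)) := fun i j hij => hκ hij
  obtain ⟨m, hm⟩ := Nat.exists_eq_add_of_le' (tri_le hκ')
  have h4 := lead_coeff (-1) (by norm_num) _ h3 κ (fun i => by rw [h1, if_pos rfl]) h2 m hm.symm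
  rw [wronsk_matAct, hW, coeff_smul, coeff_smul, coeff_X_pow] at h4
  have hmN : m = NJ := by
    by_contra hne
    rw [if_neg hne] at h4
    simp only [smul_zero] at h4
    exact VdJ_ne hκ h4.symm
  have hsum : ∑ i, (κ i : ℕ) = ∑ i, (J i : ℕ) := by rw [hm, hmN, hN]
  -- a permutation with nonzero entries
  have hdet : (Matrix.of fun i l : Fin d => (fpoly J c i).coeff (κ l)).det ≠ 0 := by
    intro h0
    have e : B * (Matrix.of fun i l : Fin d => (fpoly J c i).coeff (κ l)) = 1 := by
      ext i l
      rw [Matrix.mul_apply, Matrix.one_apply, ← h1]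
      simp [matAct, finsetSum_coeff]
    have := congrArg Matrix.det e
    rw [Matrix.det_mul, h0, mul_zero, Matrix.det_one] at this
    exact zero_ne_one this
  rw [Matrix.det_apply] at hdet
  obtain ⟨σ, -, hσ⟩ := Finset.exists_ne_zero_of_sum_ne_zero hdet
  have hσ' : ∀ i, (fpoly J c (σ i)).coeff (κ i) ≠ 0 := by
    intro i h0
    apply hσ
    rw [Finset.prod_eq_zero (Finset.mem_univ i) (by simpa using h0), smul_zero]
  have hle : ∀ i, κ i ≤ J (σ i) := fun i => cf_le J c _ _ (by rw [← fpoly_coeff]; exact hσ' i)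
  have heq : κ = fun i => J (σ i) := by
    refine eps_eq 1 one_ne_zero _ _ (fun i => ?_) ?_
    · have := hle i
      rw [Fin.le_def] at this
      omega
    · rw [hsum]
      exact (Equiv.sum_comp σ fun i => (J i : ℕ)).symm
  have hB' : ∀ i l, B i (σ l) = if i = l then 1 else 0 := by
    intro i l
    have := h1 i l
    rw [heq] at this
    simp only [matAct, finsetSum_coeff, coeff_smul, fpoly_coeff, cf_J hJ] at this
    rw [← this]
    simp
  have hg : ∀ i, matAct B (fpoly J c) i = fpoly J c (σ i) := by
    intro i
    unfold matAct
    rw [← Equiv.sum_comp σ]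
    simp [hB']
  funext p
  by_contra h0
  rw [← cf_idx J c p, ← fpoly_coeff] at h0
  have h5 := h2 (σ.symm p.1.1) p.1.2 (by rw [hg, Equiv.apply_symm_apply]; exact h0)
  rw [heq] at h5
  simp only [Equiv.apply_symm_apply] at h5
  have := p.2.1
  rw [Fin.lt_def] at this
  omega

/-- fibre of the Wronski map -/
def Fib (n d : ℕ) (h : ℂ[X]) : Set (Submodule ℂ ℂ[X]) := {x | IsGrPoint n d x ∧ InFibre d x h}

lemma fib_bij {d n : ℕ} {J : Fin d → Fin n} (hJ : StrictMono J) {NJ : ℕ}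
    (hN : NJ + tri d = ∑ i, (J i : ℕ))
    (hmax : ∀ κ : Fin d → Fin n, StrictMono κ → ∑ i, (κ i : ℕ) = ∑ i, (J i : ℕ) → κ = J)
    (h : ℂ[X]) (hm : h.Monic) (hd : h.natDegree = NJ) :
    Set.BijOn (fun c => Submodule.span ℂ (Set.range (fpoly J c)))
      (Zf (fun r : Fin NJ => PhiJ J r) (fun r => h.coeff r)) (Fib n d h) := by
  refine ⟨?_, ?_, ?_⟩
  · intro c hc
    refine ⟨⟨?_, ?_⟩, fpoly J c, _, VdJ_ne hJ, fpoly_li hJ c, rfl, (fpoly_wronsk hJ hN c h hm hd).2 hc⟩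
    · rw [Submodule.span_le]
      rintro _ ⟨i, rfl⟩
      exact fpoly_mem J c i
    · exact (li_iff_finrank _).1 (fpoly_li hJ c)
  · intro c _ c' _ e
    exact fpoly_inj hJ c c' e
  · rintro x ⟨⟨hx1, hx2⟩, f, c0, hc0, hf, rfl, hw⟩
    have hfn : ∀ i, f i ∈ degreeLT ℂ n := fun i => hx1 (Submodule.subset_span ⟨i, rfl⟩)
    obtain ⟨κ, B, hκ, hB, h1, h2, h3⟩ := echelon' hf hfn (fun j => 1 * (j : ℕ))
    have hκ' : StrictMono (fun i => (κ i : ℕ)) := fun i j hij => hκ hij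
    obtain ⟨m, hm'⟩ := Nat.exists_eq_add_of_le' (tri_le hκ')
    have h4 := lead_coeff 1 (by norm_num) _ h3 κ (fun i => by rw [h1, if_pos rfl]) h2 m hm'.symm
    have h5 := lead_vanish 1 _ h3 κ h2
    have hw' : wronskDet d (matAct B f) = (B.det * c0) • h := by
      rw [wronsk_matAct, hw, smul_smul]
    have hne : B.det * c0 ≠ 0 := mul_ne_zero hB hc0
    have hmN : m = NJ := by
      rcases lt_trichotomy m NJ with h6 | h6 | h6
      · have := h5 NJ (by rw [hm']; push_cast; omega)
        rw [hw', coeff_smul, ← hd, coeff_natDegree, hm.leadingCoeff, smul_eq_mul, mul_one] at this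
        exact absurd this hne
      · exact h6
      · rw [hw', coeff_smul, coeff_eq_zero_of_natDegree_lt (hd ▸ h6), smul_zero] at h4
        exact absurd h4.symm (VdJ_ne hκ)
    have hκJ : κ = J := hmax κ hκ (by rw [hm', hmN, hN])
    subst hκJ
    obtain ⟨c, hc⟩ := fpoly_surj _ h3 h1 (fun i j hj => by
      have := h2 i j hj
      rw [Fin.le_def]
      omega)
    refine ⟨c, ?_, ?_⟩
    · rw [← fpoly_wronsk hJ hN c h hm hd, ← hc, hw']
      congr 1
      rw [← h4, hw', hmN, coeff_smul, ← hd, coeff_natDegree, hm.leadingCoeff, smul_eq_mul, mul_one]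
    · simp only
      rw [← hc, span_matAct hB]

/-- the diagonal involution -/
def Dm : Matrix (Fin 2) (Fin 2) ℂ := !![1, 0; 0, -1]

lemma mobiusMap_apply (n : ℕ) (M : Matrix (Fin 2) (Fin 2) ℂ) (f : ℂ[X]) :
    mobiusMap n M f = ∑ k ∈ Finset.range n, C (f.coeff k) *
      ((C (M 1 1) * X + C (M 0 1)) ^ k * (C (M 1 0) * X + C (M 0 0)) ^ (n - 1 - k)) := by
  simp [mobiusMap, LinearMap.sum_apply, smul_eq_C_mul]

lemma mobius_Dm_coeff (n : ℕ) (f : ℂ[X]) (k : Fin n) :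
    (mobiusMap n Dm f).coeff k = (-1) ^ (k : ℕ) * f.coeff k := by
  have h1 : mobiusMap n Dm f = ∑ k ∈ Finset.range n, C ((-1) ^ k * f.coeff k) * X ^ k := by
    rw [mobiusMap_apply]
    refine Finset.sum_congr rfl fun k _ => ?_
    simp [Dm]
    rw [neg_pow]
    ring
  rw [h1, finsetSum_coeff]
  simp only [coeff_C_mul_X_pow]
  rw [Finset.sum_ite_eq, if_pos (Finset.mem_range.2 k.2)]

lemma mobius_Dm_mem (n : ℕ) (f : ℂ[X]) : mobiusMap n Dm f ∈ degreeLT ℂ n := by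
  rw [mobiusMap_apply]
  refine Submodule.sum_mem _ fun k hk => ?_
  rw [Finset.mem_range] at hk
  simp only [Dm]
  simp
  rw [neg_pow]
  rw [mem_degreeLT]
  have : C (f.coeff k) * ((-1) ^ k * X ^ k) = C (f.coeff k * (-1) ^ k) * X ^ k := by
    simp; ring
  rw [this]
  refine lt_of_le_of_lt (degree_C_mul_X_pow_le _ _) ?_
  exact_mod_cast hk

lemma span_tau {d n : ℕ} {J : Fin d → Fin n} (c : Cidx J → ℂ) :
    Submodule.span ℂ (Set.range (fpoly J (tau (wJ J) c))) =
      Submodule.map (mobiusMap n Dm) (Submodule.span ℂ (Set.range (fpoly J c))) := by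
  have h1 : ∀ i, fpoly J (tau (wJ J) c) i = ((-1 : ℂ) ^ (J i : ℕ)) • mobiusMap n Dm (fpoly J c i) := by
    intro i
    refine ext_degreeLT (fpoly_mem J _ i) (Submodule.smul_mem _ _ (mobius_Dm_mem n _)) fun k => ?_
    rw [coeff_smul, mobius_Dm_coeff, fpoly_coeff, fpoly_coeff, smul_eq_mul]
    unfold cf
    split_ifs with h1 h2
    · rw [← h1, mul_one, ← mul_pow]; simp
    · simp only [tau, wJ]
      rw [← mul_assoc, ← pow_add]
      congr 1
      have : (J i : ℕ) + k = ((J i : ℕ) - k) + 2 * k := by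
        have := h2.1
        rw [Fin.lt_def] at this
        omega
      rw [this, pow_add, pow_mul]; simp
    · simp
  have h2 : fpoly J (tau (wJ J) c) = matAct (Matrix.diagonal fun i => (-1 : ℂ) ^ (J i : ℕ))
      (fun i => mobiusMap n Dm (fpoly J c i)) := by
    funext i
    rw [h1, matAct, Finset.sum_eq_single i]
    · simp
    · intro b _ hb
      rw [Matrix.diagonal_apply_ne' _ hb, zero_smul]
    · simp
  rw [h2, span_matAct, Submodule.map_span, ← Set.range_comp]
  · rfl
  · rw [Matrix.det_diagonal]
    exact Finset.prod_ne_zero_iff.2 fun i _ => pow_ne_zero _ (by norm_num)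

end WrFix

open Polynomial

namespace WrFix

lemma cidx_prod {d n : ℕ} {J : Fin d → Fin n} (hJ : StrictMono J) (F : Fin d → Fin n → ℕ) :
    (∏ p : Cidx J, F p.1.1 p.1.2) * ∏ i, ∏ l ∈ Finset.Iio i, F i (J l) =
      ∏ i, ∏ k ∈ Finset.Iio (J i), F i k := by
  classical
  have h1 : ∏ p : Cidx J, F p.1.1 p.1.2 =
      ∏ i, ∏ k ∈ Finset.univ.filter (fun k => k < J i ∧ ∀ l, J l ≠ k), F i k := by
    rw [← Finset.prod_subtype (p := fun p : Fin d × Fin n => p.2 < J p.1 ∧ ∀ l, J l ≠ p.2)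
      (Finset.univ.filter (fun p : Fin d × Fin n => p.2 < J p.1 ∧ ∀ l, J l ≠ p.2)) (by simp)
      (fun p => F p.1 p.2)]
    rw [Finset.prod_filter, Fintype.prod_prod_type]
    refine Finset.prod_congr rfl fun i _ => ?_
    rw [Finset.prod_filter]
  rw [h1, ← Finset.prod_mul_distrib]
  refine Finset.prod_congr rfl fun i _ => ?_
  have h2 : ∏ l ∈ Finset.Iio i, F i (J l) = ∏ k ∈ (Finset.Iio i).image J, F i k := by
    rw [Finset.prod_image fun a _ b _ h => hJ.injective h]
  rw [h2, ← Finset.prod_union]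
  · refine Finset.prod_congr ?_ fun _ _ => rfl
    ext k
    simp only [Finset.mem_union, Finset.mem_filter, Finset.mem_univ, true_and, Finset.mem_image,
      Finset.mem_Iio]
    constructor
    · rintro (h | ⟨l, hl, rfl⟩)
      · exact h.1
      · exact hJ hl
    · intro h
      by_cases hk : ∃ l, J l = k
      · obtain ⟨l, rfl⟩ := hk
        exact Or.inr ⟨l, hJ.lt_iff_lt.1 h, rfl⟩
      · push Not at hk
        exact Or.inl ⟨h, hk⟩
  · rw [Finset.disjoint_left]
    intro k hk hk'
    rw [Finset.mem_filter] at hk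
    rw [Finset.mem_image] at hk'
    obtain ⟨l, -, hl⟩ := hk'
    exact hk.2.2 l hl

lemma cidx_card {d n : ℕ} {J : Fin d → Fin n} (hJ : StrictMono J) {NJ : ℕ}
    (hN : NJ + tri d = ∑ i, (J i : ℕ)) : Fintype.card (Cidx J) = NJ := by
  have h := cidx_prod hJ (fun _ _ => 2)
  simp only [Finset.prod_const, Fin.card_Iio, Finset.card_univ] at h
  rw [Finset.prod_pow_eq_pow_sum, Finset.prod_pow_eq_pow_sum, ← pow_add] at h
  have := Nat.pow_right_injective le_rfl h
  change Fintype.card (Cidx J) + tri d = _ at this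
  omega

lemma cidx_w {d n : ℕ} {J : Fin d → Fin n} (hJ : StrictMono J) :
    (∏ p : Cidx J, wJ J p) * ∏ i, ∏ l ∈ Finset.Iio i, ((J i : ℕ) - (J l : ℕ)) =
      ∏ i, (J i : ℕ).factorial := by
  have h := cidx_prod hJ (fun i k => (J i : ℕ) - (k : ℕ))
  refine h.trans (Finset.prod_congr rfl fun i _ => ?_)
  have h2 : ∏ k ∈ Finset.Iio (J i), ((J i : ℕ) - (k : ℕ)) = ∏ k ∈ Finset.range (J i), ((J i : ℕ) - k) := by
    refine Finset.prod_bij (fun k _ => (k : ℕ)) ?_ ?_ ?_ ?_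
    · intro a ha
      rw [Finset.mem_Iio, Fin.lt_def] at ha
      exact Finset.mem_range.2 ha
    · intro a _ b _ h
      exact Fin.ext h
    · intro b hb
      rw [Finset.mem_range] at hb
      exact ⟨⟨b, hb.trans (J i).2⟩, by rw [Finset.mem_Iio, Fin.lt_def]; exact hb, rfl⟩
    · intros; rfl
  rw [h2, ← Nat.descFactorial_eq_prod_range, Nat.descFactorial_self]

theorem cell_fix {d n : ℕ} {J : Fin d → Fin n} (hJ : StrictMono J) {NJ : ℕ}
    (hN : NJ + tri d = ∑ i, (J i : ℕ))
    (hmax : ∀ κ : Fin d → Fin n, StrictMono κ → ∑ i, (κ i : ℕ) = ∑ i, (J i : ℕ) → κ = J)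
    (K : ℕ) (hK : NJ.factorial ≤ K * ∏ p, wJ J p) (h h' : ℂ[X])
    (hm : h.Monic) (hd : h.natDegree = NJ) (hm' : h'.Monic) (hd' : h'.natDegree = NJ)
    (ho : ∀ r, r < NJ → Odd (NJ - r) → h.coeff r = 0)
    (ho' : ∀ r, r < NJ → Odd (NJ - r) → h'.coeff r = 0)
    (hc : (Fib n d h).ncard = K) (hc' : (Fib n d h').ncard = K) :
    {x ∈ Fib n d h | Submodule.map (mobiusMap n Dm) x = x}.ncard =
      {x ∈ Fib n d h' | Submodule.map (mobiusMap n Dm) x = x}.ncard := by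
  have hprod : ∏ r : Fin NJ, (NJ - (r : ℕ)) = NJ.factorial := by
    rw [Fin.prod_univ_eq_prod_range (fun r => NJ - r), ← Nat.descFactorial_eq_prod_range,
      Nat.descFactorial_self]
  obtain ⟨-, habs⟩ := abstract_fix (cidx_card hJ hN) (wJ J) (wJ_pos J) (fun r : Fin NJ => NJ - (r : ℕ))
    (fun r => Nat.sub_pos_of_lt r.2) (fun r => PhiJ J r) (fun r => PhiJ_hom J hN r r.2.le)
    (fun c hc => zero_fibre hJ hN c hc) K (by rw [hprod]; exact hK)
  have key : ∀ h : ℂ[X], h.Monic → h.natDegree = NJ →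
      (Fib n d h).ncard = (Zf (fun r : Fin NJ => PhiJ J r) (fun r => h.coeff r)).ncard ∧
      {x ∈ Fib n d h | Submodule.map (mobiusMap n Dm) x = x}.ncard =
      {c ∈ Zf (fun r : Fin NJ => PhiJ J r) (fun r => h.coeff r) | tau (wJ J) c = c}.ncard := by
    intro h hm hd
    have hb := fib_bij hJ hN hmax h hm hd
    constructor
    · rw [← hb.image_eq, Set.ncard_image_of_injOn hb.injOn]
    · have : {x ∈ Fib n d h | Submodule.map (mobiusMap n Dm) x = x} =
          (fun c => Submodule.span ℂ (Set.range (fpoly J c))) ''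
          {c ∈ Zf (fun r : Fin NJ => PhiJ J r) (fun r => h.coeff r) | tau (wJ J) c = c} := by
        ext x
        constructor
        · rintro ⟨hx, hfx⟩
          obtain ⟨c, hc, rfl⟩ := hb.surjOn hx
          refine ⟨c, ⟨hc, ?_⟩, rfl⟩
          apply fpoly_inj hJ
          rw [span_tau, hfx]
        · rintro ⟨c, ⟨hc, hfc⟩, rfl⟩
          refine ⟨hb.mapsTo hc, ?_⟩
          simp only
          rw [← span_tau, hfc]
      rw [this, Set.ncard_image_of_injOn (hb.injOn.mono fun c hc => hc.1)]
  obtain ⟨k1, k2⟩ := key h hm hd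
  obtain ⟨k1', k2'⟩ := key h' hm' hd'
  rw [k2, k2']
  exact habs _ _ (fun r hr => ho r r.2 hr) (fun r hr => ho' r r.2 hr) (k1 ▸ hc) (k1' ▸ hc')

end WrFix

open Polynomial

namespace WrFix

/-- product of differences -/
def Pd {d : ℕ} (J : Fin d → ℕ) : ℕ := ∏ i, ∏ l ∈ Finset.Iio i, (J i - J l)

lemma Vd_eq_Pd {d : ℕ} {J : Fin d → ℕ} (hJ : StrictMono J) : Vd J = (Pd J : ℂ) := by
  rw [Vd_eq, Matrix.det_vandermonde, Pd]
  push_cast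
  rw [Finset.prod_comm' (s' := fun j => Finset.Iio j) (t' := Finset.univ) (by simp)]
  refine Finset.prod_congr rfl fun i _ => Finset.prod_congr rfl fun l hl => ?_
  rw [Nat.cast_sub (hJ (Finset.mem_Iio.1 hl)).le]

lemma desc_ident (n k : ℕ) (hn : 0 < n) :
    (n : ℂ) * ((n - 1).descFactorial k : ℂ) = ((n : ℂ) - k) * (n.descFactorial k : ℂ) := by
  obtain ⟨m, rfl⟩ := Nat.exists_eq_succ_of_ne_zero hn.ne'
  have h1 := Nat.succ_descFactorial_succ m k
  rw [Nat.descFactorial_succ] at h1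
  simp only [Nat.succ_eq_add_one, Nat.add_sub_cancel] at *
  by_cases h : k ≤ m + 1
  · rw [← Nat.cast_sub h]
    exact_mod_cast h1.symm
  · rw [Nat.descFactorial_of_lt (by omega), Nat.descFactorial_of_lt (by omega)]
    simp

lemma Vd_ident {d : ℕ} (J : Fin d → ℕ) :
    ∑ i, (J i : ℂ) * Vd (Function.update J i (J i - 1)) = ((∑ i, J i : ℕ) - (tri d : ℂ)) * Vd J := by
  have h1 : ∀ i, (J i : ℂ) * Vd (Function.update J i (J i - 1)) =
      ∑ σ : Equiv.Perm (Fin d), ((Equiv.Perm.sign σ : ℤ) : ℂ) *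
        (((J i : ℂ) - (σ i : ℕ)) * ∏ l, ((J l).descFactorial (σ l) : ℂ)) := by
    intro i
    rw [Vd, ← Matrix.det_transpose, Matrix.det_apply', Finset.mul_sum]
    refine Finset.sum_congr rfl fun σ _ => ?_
    simp only [Matrix.transpose_apply, Matrix.of_apply]
    rw [← Finset.mul_prod_erase _ _ (Finset.mem_univ i),
      ← Finset.mul_prod_erase _ (fun l => ((J l).descFactorial (σ l) : ℂ)) (Finset.mem_univ i)]
    have h2 : ∏ l ∈ Finset.univ.erase i, ((Function.update J i (J i - 1) l).descFactorial (σ l) : ℂ) =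
        ∏ l ∈ Finset.univ.erase i, ((J l).descFactorial (σ l) : ℂ) := by
      refine Finset.prod_congr rfl fun l hl => ?_
      rw [Function.update_of_ne (Finset.ne_of_mem_erase hl)]
    rw [h2, Function.update_self]
    rcases Nat.eq_zero_or_pos (J i) with h0 | h0
    · rw [h0]
      rcases Nat.eq_zero_or_pos (σ i : ℕ) with h3 | h3
      · simp [h3]
      · rw [Nat.descFactorial_of_lt (by omega)]
        simp
    · linear_combination ((Equiv.Perm.sign σ : ℤ) : ℂ) * (∏ l ∈ Finset.univ.erase i, ((J l).descFactorial (σ l) : ℂ)) * desc_ident (J i) (σ i) h0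
  rw [Finset.sum_congr rfl fun i _ => h1 i, Finset.sum_comm]
  rw [Vd, ← Matrix.det_transpose, Matrix.det_apply', Finset.mul_sum]
  refine Finset.sum_congr rfl fun σ _ => ?_
  simp only [Matrix.transpose_apply, Matrix.of_apply]
  rw [← Finset.mul_sum, ← Finset.sum_mul, Finset.sum_sub_distrib]
  have h3 : ∑ i, ((σ i : ℕ) : ℂ) = (tri d : ℂ) := by
    rw [tri, Nat.cast_sum]
    exact Equiv.sum_comp σ fun i => ((i : ℕ) : ℂ)
  rw [h3, Nat.cast_sum]
  ring

open Classical in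
lemma Pd_ident {d : ℕ} {J : Fin d → ℕ} (hJ : StrictMono J) (m : ℕ) (hm : ∑ i, J i = m + 1 + tri d) :
    (m + 1) * Pd J = ∑ i ∈ Finset.univ.filter
      (fun i => 0 < J i ∧ StrictMono (Function.update J i (J i - 1))),
      J i * Pd (Function.update J i (J i - 1)) := by
  have h := Vd_ident J
  rw [hm, Vd_eq_Pd hJ] at h
  rw [← Finset.sum_filter_of_ne (p := fun i => 0 < J i ∧ StrictMono (Function.update J i (J i - 1)))] at h
  · rw [Finset.sum_congr rfl (g := fun i => ((J i * Pd (Function.update J i (J i - 1)) : ℕ) : ℂ))] at h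
    · have h2 : ((m + 1 + tri d : ℕ) : ℂ) - (tri d : ℂ) = ((m + 1 : ℕ) : ℂ) := by
        push_cast; ring
      rw [h2, ← Nat.cast_sum] at h
      exact_mod_cast h.symm
    · intro i hi
      rw [Finset.mem_filter] at hi
      rw [Vd_eq_Pd hi.2.2]
      push_cast
      rfl
  · intro i _ hne
    have h1 := left_ne_zero_of_mul hne
    have h2 := right_ne_zero_of_mul hne
    rw [Vd_ne_zero_iff] at h2
    have h3 : 0 < J i := Nat.pos_of_ne_zero fun e => h1 (by simp [e])
    refine ⟨h3, Monotone.strictMono_of_injective ?_ h2⟩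
    intro a b hab
    rcases hab.eq_or_lt with e | hlt
    · rw [e]
    have := hJ hlt
    simp only [Function.update_apply]
    split_ifs with e1 e2 e2
    · exact le_rfl
    · subst e1; omega
    · subst e2; omega
    · omega

/-- tableaux whose row lengths are `J i - i` -/
def IsT {d : ℕ} (J : Fin d → ℕ) (m : ℕ) (E : Fin d → ℕ → ℕ) : Prop :=
  (∀ i j, J i ≤ j + i → E i j = 0) ∧
  (∀ i j, j + i < J i → 1 ≤ E i j ∧ E i j ≤ m) ∧
  (∀ i j, j + 1 + i < J i → E i j < E i (j + 1)) ∧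
  (∀ i i' j, i < i' → j + i < J i → E i' j < E i j) ∧
  (∀ k, 1 ≤ k → k ≤ m → ∃ i j, j + i < J i ∧ E i j = k)

/-- insert the largest entry -/
def insT {d : ℕ} (J : Fin d → ℕ) (m : ℕ) (i₀ : Fin d) (E : Fin d → ℕ → ℕ) : Fin d → ℕ → ℕ :=
  fun i j => if i = i₀ ∧ j + i₀ + 1 = J i₀ then m + 1 else E i j

lemma smono_gap {d : ℕ} {J : Fin d → ℕ} (hJ : StrictMono J) {i i' : Fin d} (h : i ≤ i') :
    J i + i' ≤ J i' + i := by
  obtain ⟨i', hi'⟩ := i'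
  obtain ⟨i, hi⟩ := i
  simp only [Fin.mk_le_mk] at h
  simp only
  induction i', h using Nat.le_induction with
  | base => rfl
  | succ k hk ih =>
    have h1 := ih (by omega)
    have h2 : J ⟨k, by omega⟩ < J ⟨k + 1, hi'⟩ := hJ (by simp [Fin.lt_def])
    omega

lemma insT_mem {d : ℕ} {J : Fin d → ℕ} {m : ℕ} {i₀ : Fin d} {E : Fin d → ℕ → ℕ} 
    (h0 : 0 < J i₀) (hs : StrictMono (Function.update J i₀ (J i₀ - 1)))
    (hE : IsT (Function.update J i₀ (J i₀ - 1)) m E) : IsT J (m + 1) (insT J m i₀ E) := by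
  obtain ⟨e0, e1, e2, e3, e4⟩ := hE
  set J' := Function.update J i₀ (J i₀ - 1) with hJ'
  have hJ0 : J' i₀ = J i₀ - 1 := Function.update_self _ _ _
  have hJ1 : ∀ i, i ≠ i₀ → J' i = J i := fun i hi => Function.update_of_ne hi _ _
  have hle := le_of_strictMono hs i₀
  rw [hJ0] at hle
  have hEm : ∀ i j, E i j ≤ m := by
    intro i j
    by_cases h : j + i < J' i
    · exact (e1 i j h).2
    · rw [e0 i j (by omega)]; omega
  refine ⟨?_, ?_, ?_, ?_, ?_⟩
  · intro i j h
    unfold insT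
    rw [if_neg (by rintro ⟨rfl, h2⟩; omega)]
    apply e0
    by_cases hi : i = i₀
    · subst hi; omega
    · rw [hJ1 i hi]; exact h
  · intro i j h
    unfold insT
    split_ifs with h1
    · omega
    · have := e1 i j (by
        by_cases hi : i = i₀
        · subst hi; simp only [true_and] at h1; omega
        · rw [hJ1 i hi]; exact h)
      omega
  · intro i j h
    have ha : insT J m i₀ E i j = E i j := if_neg (by rintro ⟨rfl, h2⟩; omega)
    rw [ha]
    unfold insT
    split_ifs with h1
    · have := hEm i j; omega
    · refine e2 i j ?_
      by_cases hi : i = i₀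
      · subst hi; simp only [true_and] at h1; omega
      · rw [hJ1 i hi]; exact h
  · intro i i' j hlt h
    have ha : insT J m i₀ E i' j = E i' j := by
      refine if_neg ?_
      rintro ⟨rfl, h2⟩
      have := smono_gap hs hlt.le
      rw [hJ0, hJ1 i hlt.ne] at this
      omega
    rw [ha]
    unfold insT
    split_ifs with h1
    · have := hEm i' j; omega
    · refine e3 i i' j hlt ?_
      by_cases hi : i = i₀
      · subst hi; simp only [true_and] at h1; omega
      · rw [hJ1 i hi]; exact h
  · intro k hk1 hk2
    by_cases hk : k = m + 1
    · refine ⟨i₀, J i₀ - 1 - i₀, by omega, ?_⟩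
      unfold insT
      rw [if_pos ⟨rfl, by omega⟩, hk]
    · obtain ⟨i, j, hij, hEk⟩ := e4 k hk1 (by omega)
      have hne : ¬ (i = i₀ ∧ j + i₀ + 1 = J i₀) := by rintro ⟨rfl, h2⟩; omega
      refine ⟨i, j, ?_, ?_⟩
      · by_cases hi : i = i₀
        · subst hi; omega
        · rw [hJ1 i hi] at hij; exact hij
      · unfold insT
        rw [if_neg hne, hEk]

lemma IsT_finite {d : ℕ} (J : Fin d → ℕ) (m : ℕ) : {E | IsT J m E}.Finite := by
  let W := ∑ i, J i
  refine Set.Finite.of_injOn (f := fun E => fun (p : Fin d × Fin W) => (min (E p.1 p.2) m : ℕ))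
    (t := Set.pi Set.univ fun _ => Set.Iic m) ?_ ?_ (Set.Finite.pi fun _ => Set.finite_Iic m)
  · intro E _ p _
    exact Set.mem_Iic.2 (min_le_right _ _)
  · intro E hE E' hE' he
    have hm : ∀ E, IsT J m E → ∀ i j, E i j ≤ m := by
      intro E hE i j
      by_cases h : j + i < J i
      · exact (hE.2.1 i j h).2
      · rw [hE.1 i j (by omega)]; omega
    funext i j
    have hW : J i ≤ W := Finset.single_le_sum (f := J) (fun _ _ => Nat.zero_le _) (Finset.mem_univ i)
    by_cases hj : j < W
    · have := congrFun he (i, ⟨j, hj⟩)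
      simp only [min_eq_left (hm E hE i j), min_eq_left (hm E' hE' i j)] at this
      exact this
    · rw [hE.1 i j (by omega), hE'.1 i j (by omega)]

open Classical in
lemma IsT_count {d : ℕ} (J : Fin d → ℕ) (m : ℕ) :
    ∑ i ∈ Finset.univ.filter (fun i => 0 < J i ∧ StrictMono (Function.update J i (J i - 1))),
      {E | IsT (Function.update J i (J i - 1)) m E}.ncard ≤ {E | IsT J (m + 1) E}.ncard := by
  set S := Finset.univ.filter (fun i => 0 < J i ∧ StrictMono (Function.update J i (J i - 1))) with hS
  let T : Fin d → Finset (Fin d → ℕ → ℕ) := fun i => (IsT_finite (Function.update J i (J i - 1)) m).toFinset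
  have h1 : ∀ i, {E | IsT (Function.update J i (J i - 1)) m E}.ncard = (T i).card :=
    fun i => Set.ncard_eq_toFinset_card _ (IsT_finite _ m)
  rw [Set.ncard_eq_toFinset_card _ (IsT_finite J (m + 1)), Finset.sum_congr rfl fun i _ => h1 i,
    ← Finset.card_sigma]
  have hT : ∀ i E, E ∈ T i ↔ IsT (Function.update J i (J i - 1)) m E := by
    intro i E; simp [T]
  have hEm : ∀ i E, E ∈ T i → ∀ i' j, E i' j ≤ m := by
    intro i E hE i' j
    rw [hT] at hE
    by_cases h : j + i' < Function.update J i (J i - 1) i'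
    · exact (hE.2.1 i' j h).2
    · rw [hE.1 i' j (by omega)]; omega
  refine Finset.card_le_card_of_injOn (fun p => insT J m p.1 p.2) ?_ ?_
  · rintro ⟨i, E⟩ h
    simp only [Finset.coe_sigma, Set.mem_sigma_iff, Finset.mem_coe, hT] at h
    have hi := (Finset.mem_filter.1 h.1).2
    simp only [Set.Finite.coe_toFinset, Set.mem_setOf_eq]
    exact insT_mem hi.1 hi.2 h.2
  · rintro ⟨i, E⟩ h ⟨i', E'⟩ h' e
    simp only [Finset.coe_sigma, Set.mem_sigma_iff, Finset.mem_coe] at h h'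
    have hi := (Finset.mem_filter.1 h.1).2
    have hle := le_of_strictMono hi.2 i
    rw [Function.update_self] at hle
    simp only at e
    have hii : i = i' := by
      have := congrFun (congrFun e i) (J i - 1 - i)
      unfold insT at this
      rw [if_pos ⟨rfl, by omega⟩] at this
      split_ifs at this with h3
      · exact h3.1
      · have h4 := hEm i' E' h'.2 i (J i - 1 - i)
        omega
    subst hii
    congr 1
    funext a j
    by_cases h3 : a = i ∧ j + i + 1 = J i
    · rw [hT] at h h'
      rw [h.2.1 a j, h'.2.1 a j]
      all_goals
        rw [h3.1, Function.update_self]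
        omega
    · have := congrFun (congrFun e a) j
      unfold insT at this
      rwa [if_neg h3, if_neg h3] at this

lemma fact_update {d : ℕ} (J : Fin d → ℕ) (i : Fin d) (h : 0 < J i) :
    J i * ∏ l, (Function.update J i (J i - 1) l).factorial = ∏ l, (J l).factorial := by
  rw [← Finset.mul_prod_erase _ _ (Finset.mem_univ i),
    ← Finset.mul_prod_erase _ (fun l => (J l).factorial) (Finset.mem_univ i), ← mul_assoc,
    Function.update_self, Nat.mul_factorial_pred h.ne']
  congr 1
  refine Finset.prod_congr rfl fun l hl => ?_
  rw [Function.update_of_ne (Finset.ne_of_mem_erase hl)]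

lemma sum_update {d : ℕ} (J : Fin d → ℕ) (i : Fin d) (h : 0 < J i) :
    ∑ l, Function.update J i (J i - 1) l + 1 = ∑ l, J l := by
  rw [← Finset.add_sum_erase _ _ (Finset.mem_univ i),
    ← Finset.add_sum_erase _ (fun l => J l) (Finset.mem_univ i), Function.update_self]
  have : ∑ l ∈ Finset.univ.erase i, Function.update J i (J i - 1) l = ∑ l ∈ Finset.univ.erase i, J l := by
    refine Finset.sum_congr rfl fun l hl => ?_
    rw [Function.update_of_ne (Finset.ne_of_mem_erase hl)]
  omega

theorem IsT_bound {d : ℕ} (m : ℕ) : ∀ (J : Fin d → ℕ), StrictMono J → ∑ i, J i = m + tri d →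
    m.factorial * Pd J ≤ {E | IsT J m E}.ncard * ∏ i, (J i).factorial := by
  induction m with
  | zero =>
    intro J hJ hs
    have h1 : ∀ i, J i = i := by
      have := (Finset.sum_eq_sum_iff_of_le (s := Finset.univ) (f := fun i : Fin d => (i : ℕ)) (g := J)
        (fun i _ => le_of_strictMono hJ i)).1 (by rw [hs, tri]; simp)
      exact fun i => (this i (Finset.mem_univ i)).symm
    have h2 : Pd J = ∏ i, (J i).factorial := by
      unfold Pd
      refine Finset.prod_congr rfl fun i _ => ?_
      rw [← Nat.descFactorial_self, Nat.descFactorial_eq_prod_range, h1 i]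
      refine Finset.prod_bij (fun l _ => (l : ℕ)) ?_ ?_ ?_ ?_
      · intro a ha
        rw [Finset.mem_Iio, Fin.lt_def] at ha
        exact Finset.mem_range.2 ha
      · intro a _ b _ h
        exact Fin.ext h
      · intro b hb
        rw [Finset.mem_range] at hb
        exact ⟨⟨b, hb.trans i.2⟩, by rw [Finset.mem_Iio, Fin.lt_def]; exact hb, rfl⟩
      · intro a _
        rw [h1 a]
    rw [h2, Nat.factorial_zero]
    refine Nat.mul_le_mul_right _ ?_
    rw [Nat.one_le_iff_ne_zero, ← Nat.pos_iff_ne_zero, Set.ncard_pos (IsT_finite J 0)]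
    refine ⟨fun _ _ => 0, fun _ _ _ => rfl, ?_, ?_, ?_, ?_⟩
    · intro i j h; rw [h1 i] at h; omega
    · intro i j h; rw [h1 i] at h; omega
    · intro i _ j _ h; rw [h1 i] at h; omega
    · intro k h1 h2; omega
  | succ m ih =>
    intro J hJ hs
    classical
    rw [Nat.factorial_succ, mul_comm (m + 1), mul_assoc, Pd_ident hJ m hs, Finset.mul_sum]
    refine le_trans (Finset.sum_le_sum (g := fun i =>
      {E | IsT (Function.update J i (J i - 1)) m E}.ncard * ∏ l, (J l).factorial) ?_) ?_
    · intro i hi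
      have hi' := (Finset.mem_filter.1 hi).2
      have h1 := ih _ hi'.2 (by have := sum_update J i hi'.1; omega)
      rw [← fact_update J i hi'.1]
      calc _ = J i * (m.factorial * Pd (Function.update J i (J i - 1))) := by ring
        _ ≤ J i * _ := Nat.mul_le_mul_left _ h1
        _ = _ := by ring
    · rw [← Finset.sum_mul]
      exact Nat.mul_le_mul_right _ (IsT_count J m)

end WrFix

open Polynomial

namespace WrFix

lemma SYT_finite (d w : ℕ) : {E | IsSYT d w E}.Finite := by
  refine Set.Finite.of_injOn (f := fun E => fun (p : Fin d × Fin w) => (min (E p.1 p.2) (d * w) : ℕ))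
    (t := Set.pi Set.univ fun _ => Set.Iic (d * w)) ?_ ?_ (Set.Finite.pi fun _ => Set.finite_Iic _)
  · intro E _ p _
    exact Set.mem_Iic.2 (min_le_right _ _)
  · intro E hE E' hE' he
    funext i j
    by_cases hij : i < d ∧ j < w
    · have := congrFun he (⟨i, hij.1⟩, ⟨j, hij.2⟩)
      simp only [min_eq_left (hE.2.1 i j hij.1 hij.2).2, min_eq_left (hE'.2.1 i j hij.1 hij.2).2] at this
      exact this
    · have : d ≤ i ∨ w ≤ j := by omega
      rw [hE.1 i j this, hE'.1 i j this]

lemma IsT_le_SYT (d w : ℕ) :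
    {E | IsT (fun i : Fin d => w + (i : ℕ)) (d * w) E}.ncard ≤ {E | IsSYT d w E}.ncard := by
  refine Set.ncard_le_ncard_of_injOn (fun E => fun i j => if h : i < d then E (Fin.rev ⟨i, h⟩) j else 0)
    ?_ ?_ (SYT_finite d w)
  · rintro E ⟨e0, e1, e2, e3, e4⟩
    simp only at e0 e1 e2 e3 e4
    refine ⟨?_, ?_, ?_, ?_, ?_⟩
    · intro i j h
      simp only
      split_ifs with h1
      · exact e0 _ _ (by omega)
      · rfl
    · intro i j hi hj
      simp only [dif_pos hi]
      exact e1 _ _ (by omega)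
    · intro i j hi hj
      simp only [dif_pos hi]
      exact e2 _ _ (by omega)
    · intro i j hi hj
      simp only [dif_pos hi, dif_pos (show i < d by omega)]
      refine e3 _ _ _ ?_ (by omega)
      rw [Fin.rev_lt_rev, Fin.mk_lt_mk]
      omega
    · intro m h1 h2
      obtain ⟨i, j, hij, h⟩ := e4 m h1 h2
      refine ⟨Fin.rev i, j, (Fin.rev i).2, by omega, ?_⟩
      simp only [Fin.is_lt, dif_pos, Fin.eta, Fin.rev_rev]
      exact h
  · intro E _ E' _ he
    funext i j
    have := congrFun (congrFun he (Fin.rev i)) j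
    simp only [Fin.is_lt, dif_pos, Fin.eta, Fin.rev_rev] at this
    exact this

lemma Pd_pos {d : ℕ} {J : Fin d → ℕ} (hJ : StrictMono J) : 0 < Pd J :=
  Finset.prod_pos fun _ _ => Finset.prod_pos fun _ hl => Nat.sub_pos_of_lt (hJ (Finset.mem_Iio.1 hl))

lemma hK_of {d n : ℕ} {J : Fin d → Fin n} (hJ : StrictMono J) {NJ : ℕ}
    (hN : NJ + tri d = ∑ i, (J i : ℕ)) (K : ℕ)
    (hT : {E | IsT (fun i => (J i : ℕ)) NJ E}.ncard ≤ K) : NJ.factorial ≤ K * ∏ p, wJ J p := by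
  have hJ' : StrictMono (fun i => (J i : ℕ)) := fun i j hij => hJ hij
  have h1 := IsT_bound NJ _ hJ' hN.symm
  have h2 := cidx_w hJ
  rw [← h2, ← mul_assoc] at h1
  have h3 := Nat.le_of_mul_le_mul_right h1 (Pd_pos hJ')
  exact h3.trans (Nat.mul_le_mul_right _ hT)

lemma kappa_le {d n : ℕ} {κ : Fin d → Fin n} (hκ : StrictMono κ) (hdn : d < n) (i : Fin d) :
    (κ i : ℕ) ≤ n - d + i := by
  have hi := i.2
  have hκ' : StrictMono (fun i => (κ i : ℕ)) := fun i j hij => hκ hij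
  have := smono_gap hκ' (i := i) (i' := ⟨d - 1, by omega⟩) (by rw [Fin.le_def]; simp; omega)
  have h2 := (κ ⟨d - 1, by omega⟩).2
  simp only at this
  omega

/-- top cell -/
def Jr (d n : ℕ) (hdn : d < n) (i : Fin d) : Fin n := ⟨n - d + i, by omega⟩

/-- subtop cell -/
def Jr' (d n : ℕ) (hdn : d < n) (i : Fin d) : Fin n :=
  ⟨if (i : ℕ) = 0 then n - d - 1 else n - d + i, by split_ifs <;> omega⟩

lemma Jr_mono {d n : ℕ} (hdn : d < n) : StrictMono (Jr d n hdn) := by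
  intro i j h
  rw [Fin.lt_def] at *
  simp only [Jr]
  omega

lemma Jr'_mono {d n : ℕ} (hdn : d < n) : StrictMono (Jr' d n hdn) := by
  intro i j h
  rw [Fin.lt_def] at *
  simp only [Jr']
  split_ifs <;> omega

lemma Jr_sum {d n : ℕ} (hdn : d < n) : d * (n - d) + tri d = ∑ i, (Jr d n hdn i : ℕ) := by
  simp only [Jr, Finset.sum_add_distrib]
  simp [tri]

lemma Jr'_update {d n : ℕ} (hd : 0 < d) (hdn : d < n) :
    (fun i => (Jr' d n hdn i : ℕ)) = Function.update (fun i : Fin d => n - d + (i : ℕ)) ⟨0, hd⟩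
      ((fun i : Fin d => n - d + (i : ℕ)) ⟨0, hd⟩ - 1) := by
  funext i
  rw [Function.update_apply]
  simp only [Jr']
  by_cases h : (i : ℕ) = 0
  · rw [if_pos h, if_pos (Fin.ext h)]; rfl
  · rw [if_neg h, if_neg (fun e => h (by rw [e]))]

lemma Jr'_sum {d n : ℕ} (hd : 0 < d) (hdn : d < n) :
    (d * (n - d) - 1) + tri d = ∑ i, (Jr' d n hdn i : ℕ) := by
  have h1 := Jr'_update hd hdn
  have h2 := sum_update (fun i : Fin d => n - d + (i : ℕ)) ⟨0, hd⟩ (by simp; omega)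
  rw [← h1] at h2
  beta_reduce at h2
  have h3 := Jr_sum hdn
  simp only [Jr] at h3
  have : 0 < d * (n - d) := Nat.mul_pos hd (by omega)
  omega

lemma Jr_max {d n : ℕ} (hdn : d < n) (κ : Fin d → Fin n) (hκ : StrictMono κ)
    (hs : ∑ i, (κ i : ℕ) = ∑ i, (Jr d n hdn i : ℕ)) : κ = Jr d n hdn := by
  refine eps_eq 1 one_ne_zero _ _ (fun i => ?_) hs
  have := kappa_le hκ hdn i
  simp only [Jr]
  omega

lemma Jr'_max {d n : ℕ} (hd : 0 < d) (hdn : d < n) (κ : Fin d → Fin n) (hκ : StrictMono κ)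
    (hs : ∑ i, (κ i : ℕ) = ∑ i, (Jr' d n hdn i : ℕ)) : κ = Jr' d n hdn := by
  have hκ' : StrictMono (fun i => (κ i : ℕ)) := fun i j hij => hκ hij
  let z : Fin d := ⟨0, hd⟩
  let Δ : Fin d → ℕ := fun i => n - d + i - κ i
  have hΔ : ∀ i, Δ i + κ i = n - d + i := fun i => Nat.sub_add_cancel (kappa_le hκ hdn i)
  have hsum : ∑ i, Δ i = 1 := by
    have h1 : ∑ i, Δ i + ∑ i, (κ i : ℕ) = d * (n - d) + tri d := by
      rw [← Finset.sum_add_distrib, Finset.sum_congr rfl fun i _ => hΔ i, Jr_sum hdn]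
      rfl
    rw [hs, ← Jr'_sum hd hdn] at h1
    have : 0 < d * (n - d) := Nat.mul_pos hd (by omega)
    omega
  have hgap : ∀ i, Δ i ≤ Δ z := by
    intro i
    have := smono_gap hκ' (i := z) (i' := i) (by rw [Fin.le_def]; simp [z])
    have h1 := hΔ i
    have h2 := hΔ z
    have h3 : (z : ℕ) = 0 := rfl
    beta_reduce at this
    omega
  have hz : Δ z ≠ 0 := by
    intro h0
    have : ∑ i, Δ i = 0 := Finset.sum_eq_zero fun i _ => by have := hgap i; omega
    omega
  have hadd := Finset.add_sum_erase Finset.univ Δ (Finset.mem_univ z)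
  rw [hsum] at hadd
  have h0 : ∑ i ∈ Finset.univ.erase z, Δ i = 0 := by omega
  have hz1 : Δ z = 1 := by omega
  funext i
  apply Fin.ext
  simp only [Jr']
  have h1 := hΔ i
  split_ifs with h
  · have : i = z := Fin.ext h
    rw [this] at h1 ⊢
    have h3 : (z : ℕ) = 0 := rfl
    omega
  · have : Δ i = 0 := by
      rw [Finset.sum_eq_zero_iff] at h0
      exact h0 i (Finset.mem_erase.2 ⟨fun e => h (by rw [e]), Finset.mem_univ _⟩)
    omega

lemma Jr_K {d n : ℕ} (hdn : d < n) :
    {E | IsT (fun i => (Jr d n hdn i : ℕ)) (d * (n - d)) E}.ncard ≤ {E | IsSYT d (n - d) E}.ncard :=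
  IsT_le_SYT d (n - d)

lemma Jr'_K {d n : ℕ} (hd : 0 < d) (hdn : d < n) :
    {E | IsT (fun i => (Jr' d n hdn i : ℕ)) (d * (n - d) - 1) E}.ncard ≤ {E | IsSYT d (n - d) E}.ncard := by
  classical
  refine le_trans ?_ (IsT_le_SYT d (n - d))
  have hpos : 0 < d * (n - d) := Nat.mul_pos hd (by omega)
  have h := IsT_count (fun i : Fin d => n - d + (i : ℕ)) (d * (n - d) - 1)
  rw [Nat.sub_add_cancel hpos] at h
  refine le_trans ?_ h
  rw [Jr'_update hd hdn]
  refine Finset.single_le_sum (f := fun i => Set.ncard {E | IsT (Function.update (fun i : Fin d => n - d + (i : ℕ)) i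
      ((fun i : Fin d => n - d + (i : ℕ)) i - 1)) (d * (n - d) - 1) E}) (fun _ _ => Nat.zero_le _) ?_
  rw [Finset.mem_filter]
  refine ⟨Finset.mem_univ _, by simp; omega, ?_⟩
  rw [← Jr'_update hd hdn]
  exact fun i j hij => Jr'_mono hdn hij

/-- The two cases together. -/
theorem cell_final {d n : ℕ} (hd : 0 < d) (hdn : d < n) (NJ : ℕ)
    (hNJ : NJ = d * (n - d) ∨ NJ = d * (n - d) - 1)
    (h h' : ℂ[X])
    (hm : h.Monic) (hd0 : h.natDegree = NJ) (hm' : h'.Monic) (hd' : h'.natDegree = NJ)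
    (ho : ∀ r, r < NJ → Odd (NJ - r) → h.coeff r = 0)
    (ho' : ∀ r, r < NJ → Odd (NJ - r) → h'.coeff r = 0)
    (hc : (Fib n d h).ncard = {E | IsSYT d (n - d) E}.ncard)
    (hc' : (Fib n d h').ncard = {E | IsSYT d (n - d) E}.ncard) :
    {x ∈ Fib n d h | Submodule.map (mobiusMap n Dm) x = x}.ncard =
      {x ∈ Fib n d h' | Submodule.map (mobiusMap n Dm) x = x}.ncard := by
  rcases hNJ with rfl | rfl
  · exact cell_fix (Jr_mono hdn) (Jr_sum hdn) (Jr_max hdn) _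
      (hK_of (Jr_mono hdn) (Jr_sum hdn) _ (Jr_K hdn)) h h' hm hd0 hm' hd' ho ho' hc hc'
  · exact cell_fix (Jr'_mono hdn) (Jr'_sum hd hdn) (Jr'_max hd hdn) _
      (hK_of (Jr'_mono hdn) (Jr'_sum hd hdn) _ (Jr'_K hd hdn)) h h' hm hd0 hm' hd' ho ho' hc hc'

end WrFix

open Polynomial

namespace WrFix

/-- denominator -/
noncomputable def lpol (M : Matrix (Fin 2) (Fin 2) ℂ) : ℂ[X] := C (M 1 0) * X + C (M 0 0)
/-- numerator -/
noncomputable def ppol (M : Matrix (Fin 2) (Fin 2) ℂ) : ℂ[X] := C (M 1 1) * X + C (M 0 1)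

lemma mob_apply (n : ℕ) (M : Matrix (Fin 2) (Fin 2) ℂ) (f : ℂ[X]) :
    mobiusMap n M f = ∑ k ∈ Finset.range n, C (f.coeff k) * (ppol M ^ k * lpol M ^ (n - 1 - k)) :=
  mobiusMap_apply n M f

lemma lpol_ne {M : Matrix (Fin 2) (Fin 2) ℂ} (h : M.det ≠ 0) : lpol M ≠ 0 := by
  intro h0
  have h1 := congrArg (fun p => p.coeff 1) h0
  have h2 := congrArg (fun p => p.coeff 0) h0
  simp [lpol] at h1 h2
  apply h
  rw [Matrix.det_fin_two, h1, h2]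
  ring

lemma eq_of_eval_off {l p q : ℂ[X]} (hl : l ≠ 0) (h : ∀ z, l.eval z ≠ 0 → p.eval z = q.eval z) :
    p = q := by
  have : l * (p - q) = 0 := by
    apply Polynomial.funext
    intro z
    by_cases hz : l.eval z = 0
    · simp [hz]
    · simp [h z hz]
  rcases mul_eq_zero.1 this with h | h
  · exact absurd h hl
  · exact sub_eq_zero.1 h

lemma eval_of_degreeLT {n : ℕ} {f : ℂ[X]} (hf : f ∈ degreeLT ℂ n) (w : ℂ) :
    f.eval w = ∑ k ∈ Finset.range n, f.coeff k * w ^ k := by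
  rw [mem_degreeLT] at hf
  by_cases h0 : f = 0
  · simp [h0]
  · rw [← natDegree_lt_iff_degree_lt h0] at hf
    exact eval_eq_sum_range' hf w

lemma mob_eval {n : ℕ} (M : Matrix (Fin 2) (Fin 2) ℂ) {f : ℂ[X]} (hf : f ∈ degreeLT ℂ n) (z : ℂ)
    (hz : (lpol M).eval z ≠ 0) : (mobiusMap n M f).eval z =
      (lpol M).eval z ^ (n - 1) * f.eval ((ppol M).eval z / (lpol M).eval z) := by
  rw [mob_apply, eval_finset_sum, eval_of_degreeLT hf, Finset.mul_sum]
  refine Finset.sum_congr rfl fun k hk => ?_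
  rw [Finset.mem_range] at hk
  simp only [eval_mul, eval_C, eval_pow]
  have : n - 1 = k + (n - 1 - k) := by omega
  conv_rhs => rw [this]
  rw [pow_add, div_pow]
  field_simp

lemma mob_mem (n : ℕ) (M : Matrix (Fin 2) (Fin 2) ℂ) (f : ℂ[X]) : mobiusMap n M f ∈ degreeLT ℂ n := by
  rw [mob_apply]
  refine Submodule.sum_mem _ fun k hk => ?_
  rw [Finset.mem_range] at hk
  rw [mem_degreeLT]
  have h1 : (C (f.coeff k) * (ppol M ^ k * lpol M ^ (n - 1 - k))).natDegree ≤ n - 1 := by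
    refine (natDegree_C_mul_le _ _).trans (natDegree_mul_le.trans ?_)
    have h2 := natDegree_pow_le_of_le k (natDegree_linear_le (a := M 1 1) (b := M 0 1))
    have h3 := natDegree_pow_le_of_le (n - 1 - k) (natDegree_linear_le (a := M 1 0) (b := M 0 0))
    change (ppol M ^ k).natDegree ≤ _ at h2
    change (lpol M ^ (n - 1 - k)).natDegree ≤ _ at h3
    omega
  refine lt_of_le_of_lt degree_le_natDegree ?_
  have : (C (f.coeff k) * (ppol M ^ k * lpol M ^ (n - 1 - k))).natDegree < n := by omega
  exact_mod_cast this

lemma mob_comp {n : ℕ} {A B : Matrix (Fin 2) (Fin 2) ℂ} (hA : A.det ≠ 0) (hB : B.det ≠ 0)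
    {f : ℂ[X]} (hf : f ∈ degreeLT ℂ n) :
    mobiusMap n A (mobiusMap n B f) = mobiusMap n (A * B) f := by
  have hAB : (A * B).det ≠ 0 := by rw [Matrix.det_mul]; exact mul_ne_zero hA hB
  refine eq_of_eval_off (mul_ne_zero (lpol_ne hA) (lpol_ne hAB)) fun z hz => ?_
  rw [eval_mul] at hz
  have hz1 := left_ne_zero_of_mul hz
  have hz2 := right_ne_zero_of_mul hz
  have e1 : (lpol (A * B)).eval z = (lpol A).eval z * (lpol B).eval ((ppol A).eval z / (lpol A).eval z) := by
    simp only [lpol, ppol, eval_add, eval_mul, eval_C, eval_X, Matrix.mul_apply, Fin.sum_univ_two] at *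
    field_simp
    ring
  have e2 : (ppol (A * B)).eval z = (lpol A).eval z * (ppol B).eval ((ppol A).eval z / (lpol A).eval z) := by
    simp only [lpol, ppol, eval_add, eval_mul, eval_C, eval_X, Matrix.mul_apply, Fin.sum_univ_two] at *
    field_simp
    ring
  have hz3 : (lpol B).eval ((ppol A).eval z / (lpol A).eval z) ≠ 0 := by
    rw [e1] at hz2
    exact right_ne_zero_of_mul hz2
  rw [mob_eval A (mob_mem n B f) z hz1, mob_eval B hf _ hz3, mob_eval _ hf z hz2, e1, e2,
    mul_div_mul_left _ _ hz1, mul_pow, mul_assoc]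

lemma mob_one {n : ℕ} {f : ℂ[X]} (hf : f ∈ degreeLT ℂ n) : mobiusMap n 1 f = f := by
  have hl : lpol 1 = 1 := by simp [lpol]
  have hp : ppol 1 = X := by simp [ppol]
  refine eq_of_eval_off one_ne_zero fun z _ => ?_
  rw [mob_eval 1 hf z (by rw [hl]; simp), hl, hp]
  simp

lemma mob_smul {n : ℕ} (s : ℂ) (M : Matrix (Fin 2) (Fin 2) ℂ) (f : ℂ[X]) :
    mobiusMap n (s • M) f = s ^ (n - 1) • mobiusMap n M f := by
  have hl : lpol (s • M) = C s * lpol M := by simp [lpol]; ring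
  have hp : ppol (s • M) = C s * ppol M := by simp [ppol]; ring
  rw [mob_apply, mob_apply, Finset.smul_sum]
  refine Finset.sum_congr rfl fun k hk => ?_
  rw [Finset.mem_range] at hk
  have : n - 1 = k + (n - 1 - k) := by omega
  rw [hl, hp, mul_pow, mul_pow, smul_eq_C_mul, C_pow]
  conv_rhs => rw [this, pow_add]
  simp only [Nat.add_sub_cancel_left]
  ring

lemma mob_mul {m₁ m₂ : ℕ} {M : Matrix (Fin 2) (Fin 2) ℂ} (hM : M.det ≠ 0) {f g : ℂ[X]}
    (hf : f ∈ degreeLT ℂ (m₁ + 1)) (hg : g ∈ degreeLT ℂ (m₂ + 1)) :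
    f * g ∈ degreeLT ℂ (m₁ + m₂ + 1) ∧
    mobiusMap (m₁ + m₂ + 1) M (f * g) = mobiusMap (m₁ + 1) M f * mobiusMap (m₂ + 1) M g := by
  have hfg : f * g ∈ degreeLT ℂ (m₁ + m₂ + 1) := by
    rw [degreeLT_succ_eq_degreeLE, mem_degreeLE] at *
    refine (degree_mul_le _ _).trans ?_
    push_cast
    exact add_le_add hf hg
  refine ⟨hfg, eq_of_eval_off (lpol_ne hM) fun z hz => ?_⟩
  rw [eval_mul, mob_eval M hfg z hz, mob_eval M hf z hz, mob_eval M hg z hz, eval_mul]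
  simp only [Nat.add_sub_cancel]
  ring

lemma mob_prod {M : Matrix (Fin 2) (Fin 2) ℂ} (hM : M.det ≠ 0) {N : ℕ} (F : Fin N → ℂ[X])
    (hF : ∀ i, F i ∈ degreeLT ℂ 2) :
    ∏ i, F i ∈ degreeLT ℂ (N + 1) ∧
      mobiusMap (N + 1) M (∏ i, F i) = ∏ i, mobiusMap 2 M (F i) := by
  induction N with
  | zero =>
    constructor
    · rw [mem_degreeLT]; simp
    · simp [mob_apply]
  | succ N ih =>
    obtain ⟨h1, h2⟩ := ih (fun i => F i.castSucc) (fun i => hF _)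
    obtain ⟨h3, h4⟩ := mob_mul (m₁ := N) (m₂ := 1) hM h1 (hF (Fin.last N))
    rw [Fin.prod_univ_castSucc, Fin.prod_univ_castSucc]
    refine ⟨h3, ?_⟩
    rw [← h2]
    exact h4

lemma mob_deriv (m : ℕ) (M : Matrix (Fin 2) (Fin 2) ℂ) (f : ℂ[X]) :
    lpol M * derivative (mobiusMap (m + 1) M f) =
      C (m : ℂ) * C (M 1 0) * mobiusMap (m + 1) M f + C M.det * mobiusMap m M (derivative f) := by
  have hl : derivative (lpol M) = C (M 1 0) := by simp [lpol]
  have hp : derivative (ppol M) = C (M 1 1) := by simp [ppol]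
  have hdet : C (M 1 1) * lpol M - ppol M * C (M 1 0) = C M.det := by
    rw [Matrix.det_fin_two]
    simp only [lpol, ppol, map_sub, map_mul]
    ring
  have hmono : ∀ k, k ≤ m → lpol M * derivative (ppol M ^ k * lpol M ^ (m - k)) =
      C (m : ℂ) * C (M 1 0) * (ppol M ^ k * lpol M ^ (m - k)) +
      C M.det * (C (k : ℂ) * (ppol M ^ (k - 1) * lpol M ^ (m - k))) := by
    intro k hk
    obtain ⟨e, rfl⟩ := Nat.exists_eq_add_of_le hk
    rw [Nat.add_sub_cancel_left, ← hdet, derivative_mul, derivative_pow, derivative_pow, hl, hp]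
    rcases k with _ | k
    · rcases e with _ | e
      · simp
      · simp only [Nat.add_sub_cancel, pow_succ, Nat.cast_add, map_add, map_natCast, Nat.cast_one, Nat.cast_zero, map_one, map_zero, pow_zero, zero_add]
        ring
    · rcases e with _ | e
      · simp only [Nat.add_sub_cancel, pow_succ, Nat.cast_add, map_add, map_natCast, Nat.cast_one, Nat.cast_zero, map_one, map_zero, pow_zero, add_zero]
        ring
      · simp only [Nat.add_sub_cancel, pow_succ, Nat.cast_add, map_add, map_natCast, Nat.cast_one, Nat.cast_zero, map_one, map_zero, pow_zero]
        ring
  have h3 : mobiusMap m M (derivative f) =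
      ∑ k ∈ Finset.range (m + 1), C (f.coeff k) * (C (k : ℂ) * (ppol M ^ (k - 1) * lpol M ^ (m - k))) := by
    rw [mob_apply, Finset.sum_range_succ']
    simp only [Nat.cast_zero, map_zero, zero_mul, mul_zero, add_zero]
    refine Finset.sum_congr rfl fun k hk => ?_
    rw [coeff_derivative, Nat.add_sub_cancel, show m - (k + 1) = m - 1 - k by omega]
    simp only [map_mul, Nat.cast_add, Nat.cast_one]
    simp only [map_add, map_one]
    ring
  rw [h3, mob_apply, derivative_sum, Finset.mul_sum, Finset.mul_sum, Finset.mul_sum, ← Finset.sum_add_distrib]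
  refine Finset.sum_congr rfl fun k hk => ?_
  rw [Finset.mem_range] at hk
  rw [derivative_C_mul, Nat.add_sub_cancel]
  linear_combination C (f.coeff k) * hmono k (by omega)

end WrFix

open Polynomial

namespace WrFix

lemma mob_iter (n : ℕ) (M : Matrix (Fin 2) (Fin 2) ℂ) (j : ℕ) (hj : j < n) :
    ∃ t : ℕ → ℂ[X], t j = C (M.det ^ j) ∧ (∀ k, j < k → t k = 0) ∧ ∀ f : ℂ[X],
      lpol M ^ j * (⇑derivative)^[j] (mobiusMap n M f) =
        ∑ k ∈ Finset.range n, t k * mobiusMap (n - k) M ((⇑derivative)^[k] f) := by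
  induction j with
  | zero =>
    refine ⟨fun k => if k = 0 then 1 else 0, by simp, fun k hk => by simp [hk.ne'], fun f => ?_⟩
    rw [Finset.sum_eq_single 0]
    · simp
    · intro k _ hk
      simp [hk]
    · intro h
      exact absurd (Finset.mem_range.2 hj) h
  | succ j ih =>
    obtain ⟨t, ht, ht0, hf⟩ := ih (by omega)
    refine ⟨fun k => lpol M * derivative (t k) + C ((n - k - 1 : ℕ) : ℂ) * C (M 1 0) * t k
      - C (j : ℂ) * C (M 1 0) * t k + if k = 0 then 0 else C M.det * t (k - 1), ?_, ?_, ?_⟩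
    · simp only [Nat.succ_ne_zero, if_false, Nat.add_sub_cancel, ht0 (j + 1) (by omega), ht]
      simp only [derivative_zero, mul_zero, add_zero, sub_zero, zero_add]
      rw [← C_mul, pow_succ']
    · intro k hk
      simp only [ht0 k (by omega), ht0 (k - 1) (by omega)]
      simp
    · intro f
      have hl : derivative (lpol M) = C (M 1 0) := by simp [lpol]
      have h1 : lpol M ^ (j + 1) * (⇑derivative)^[j + 1] (mobiusMap n M f) =
          lpol M * derivative (lpol M ^ j * (⇑derivative)^[j] (mobiusMap n M f)) -
          C (j : ℂ) * C (M 1 0) * (lpol M ^ j * (⇑derivative)^[j] (mobiusMap n M f)) := by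
        rw [Function.iterate_succ_apply', derivative_mul, derivative_pow, hl]
        rcases j with _ | j
        · simp
        · simp only [Nat.add_sub_cancel, pow_succ]
          ring
      rw [h1, hf, derivative_sum, Finset.mul_sum, Finset.mul_sum, ← Finset.sum_sub_distrib]
      have h2 : ∀ k ∈ Finset.range n, lpol M * derivative (t k * mobiusMap (n - k) M ((⇑derivative)^[k] f)) -
          C (j : ℂ) * C (M 1 0) * (t k * mobiusMap (n - k) M ((⇑derivative)^[k] f)) =
          (lpol M * derivative (t k) + C ((n - k - 1 : ℕ) : ℂ) * C (M 1 0) * t k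
            - C (j : ℂ) * C (M 1 0) * t k) * mobiusMap (n - k) M ((⇑derivative)^[k] f) +
          C M.det * t k * mobiusMap (n - (k + 1)) M ((⇑derivative)^[k + 1] f) := by
        intro k hk
        rw [Finset.mem_range] at hk
        obtain ⟨m, hm⟩ : ∃ m, n - k = m + 1 := ⟨n - k - 1, by omega⟩
        have h3 := mob_deriv m M ((⇑derivative)^[k] f)
        rw [← Function.iterate_succ_apply' (⇑derivative) k f] at h3
        have h4 : n - (k + 1) = m := by omega
        have h5 : n - k - 1 = m := by omega
        rw [h4, h5, hm, derivative_mul]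
        linear_combination t k * h3
      rw [Finset.sum_congr rfl h2, Finset.sum_add_distrib]
      simp only [add_mul]
      rw [Finset.sum_add_distrib (g := fun k => (if k = 0 then 0 else C M.det * t (k - 1)) *
        mobiusMap (n - k) M ((⇑derivative)^[k] f))]
      have h6 : ∑ k ∈ Finset.range n, (if k = 0 then 0 else C M.det * t (k - 1)) *
          mobiusMap (n - k) M ((⇑derivative)^[k] f) =
          ∑ k ∈ Finset.range n, C M.det * t k * mobiusMap (n - (k + 1)) M ((⇑derivative)^[k + 1] f) := by
        obtain ⟨m, rfl⟩ : ∃ m, n = m + 1 := ⟨n - 1, by omega⟩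
        rw [Finset.sum_range_succ', Finset.sum_range_succ]
        simp only [if_true, zero_mul, add_zero, Nat.succ_ne_zero, if_false, Nat.add_sub_cancel]
        rw [ht0 m (by omega)]
        simp
      rw [h6]

lemma iter_mem {n : ℕ} {f : ℂ[X]} (hf : f ∈ degreeLT ℂ n) (k : ℕ) :
    (⇑derivative)^[k] f ∈ degreeLT ℂ (n - k) := by
  rw [mem_degreeLT, degree_lt_iff_coeff_zero] at *
  intro m hm
  rw [coeff_iterate_derivative, hf (m + k) (by exact_mod_cast (by omega)), smul_zero]

lemma tri_two (d : ℕ) : tri d + tri d = d * (d - 1) := by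
  have : tri d = ∑ i ∈ Finset.range d, i := by
    rw [tri, Fin.sum_univ_eq_sum_range (fun i => i)]
  rw [this, ← mul_two, Finset.sum_range_id_mul_two]

lemma wronsk_mem {d n : ℕ} (hdn : d < n) {f : Fin d → ℂ[X]} (hf : LinearIndependent ℂ f)
    (hn : ∀ i, f i ∈ degreeLT ℂ n) : wronskDet d f ∈ degreeLT ℂ (d * (n - d) + 1) := by
  rw [mem_degreeLT, degree_lt_iff_coeff_zero]
  intro m hm
  have hm' : d * (n - d) + 1 ≤ m := by exact_mod_cast hm
  obtain ⟨κ, B, hκ, hB, h1, h2, h3⟩ := echelon' hf hn (fun j => 1 * (j : ℕ))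
  have h4 := lead_vanish 1 _ h3 κ h2 m (by
    have : ∑ i, (κ i : ℕ) ≤ d * (n - d) + tri d := by
      rw [Jr_sum hdn]
      exact Finset.sum_le_sum fun i _ => kappa_le hκ hdn i
    omega)
  rw [wronsk_matAct, coeff_smul, smul_eq_mul] at h4
  exact (mul_eq_zero.1 h4).resolve_left hB

theorem wronsk_equiv {d n : ℕ} (hdn : d < n) {M : Matrix (Fin 2) (Fin 2) ℂ} (hM : M.det ≠ 0)
    {f : Fin d → ℂ[X]} (hf : LinearIndependent ℂ f) (hn : ∀ i, f i ∈ degreeLT ℂ n) :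
    wronskDet d (fun i => mobiusMap n M (f i)) =
      M.det ^ tri d • mobiusMap (d * (n - d) + 1) M (wronskDet d f) := by
  have ht : ∀ j : Fin d, ∃ t : ℕ → ℂ[X], t j = C (M.det ^ (j : ℕ)) ∧ (∀ k, (j : ℕ) < k → t k = 0) ∧ ∀ f : ℂ[X],
      lpol M ^ (j : ℕ) * (⇑derivative)^[j] (mobiusMap n M f) =
        ∑ k ∈ Finset.range n, t k * mobiusMap (n - k) M ((⇑derivative)^[k] f) :=
    fun j => mob_iter n M j (by omega)
  choose t ht1 ht2 ht3 using ht
  refine eq_of_eval_off (lpol_ne hM) fun z hz => ?_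
  set l := (lpol M).eval z with hl
  set w := (ppol M).eval z / l with hw
  have key : ∀ (i j : Fin d), l ^ (j : ℕ) * ((⇑derivative)^[j] (mobiusMap n M (f i))).eval z =
      ∑ k : Fin d, (l ^ (n - 1 - k) * ((⇑derivative)^[k] (f i)).eval w) * (t j k).eval z := by
    intro i j
    have h1 := congrArg (eval z) (ht3 j (f i))
    rw [eval_mul, eval_pow, eval_finset_sum] at h1
    rw [h1, Fin.sum_univ_eq_sum_range (fun k => (l ^ (n - 1 - k) * ((⇑derivative)^[k] (f i)).eval w) * (t j k).eval z) d]
    rw [← Finset.sum_subset (Finset.range_subset_range.2 hdn.le)]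
    · refine Finset.sum_congr rfl fun k _ => ?_
      rw [eval_mul, mob_eval M (iter_mem (hn i) k) z hz, show n - k - 1 = n - 1 - k by omega]
      ring
    · intro k _ hk
      rw [Finset.mem_range, not_lt] at hk
      rw [ht2 j k (by omega), zero_mul, eval_zero]
  have hdet1 : ∀ (g : Fin d → ℂ[X]) (y : ℂ), (wronskDet d g).eval y =
      Matrix.det (Matrix.of fun i j : Fin d => ((⇑derivative)^[(j : ℕ)] (g i)).eval y) := by
    intro g y
    rw [wronskDet, ← coe_evalRingHom, RingHom.map_det]
    rfl
  have hmat : (Matrix.of fun i j : Fin d => l ^ (j : ℕ) *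
      (Matrix.of fun i j : Fin d => ((⇑derivative)^[(j : ℕ)] (mobiusMap n M (f i))).eval z) i j) =
      (Matrix.of fun i k : Fin d => l ^ (n - 1 - (k : ℕ)) *
        (Matrix.of fun i k : Fin d => ((⇑derivative)^[(k : ℕ)] (f i)).eval w) i k) *
      (Matrix.of fun k j : Fin d => (t j k).eval z) := by
    ext i j
    rw [Matrix.mul_apply]
    exact key i j
  have hT : (Matrix.of fun k j : Fin d => (t j k).eval z).det = M.det ^ tri d := by
    rw [Matrix.det_of_upperTriangular]
    · simp only [Matrix.of_apply, ht1, eval_C]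
      rw [Finset.prod_pow_eq_pow_sum]
      rfl
    · intro k j hkj
      simp only [id] at hkj
      simp only [Matrix.of_apply]
      rw [ht2 j k hkj, eval_zero]
  have h5 := congrArg Matrix.det hmat
  rw [Matrix.det_mul, hT, Matrix.det_mul_row (fun j : Fin d => l ^ (j : ℕ)),
    Matrix.det_mul_row (fun j : Fin d => l ^ (n - 1 - (j : ℕ))), ← hdet1, ← hdet1,
    Finset.prod_pow_eq_pow_sum, Finset.prod_pow_eq_pow_sum] at h5
  have h6 : ∑ i : Fin d, (n - 1 - (i : ℕ)) = tri d + d * (n - d) := by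
    have h7 : ∑ i : Fin d, (n - 1 - (i : ℕ)) + tri d = d * (n - 1) := by
      rw [tri, ← Finset.sum_add_distrib, Finset.sum_congr rfl (g := fun _ => n - 1)]
      · simp
      · intro i _; omega
    have h8 := tri_two d
    have h9 : d * (n - 1) = d * (d - 1) + d * (n - d) := by
      rcases d with _ | d
      · simp
      · rw [← Nat.mul_add]; congr 1; omega
    omega
  rw [h6, pow_add] at h5
  rw [eval_smul, mob_eval M (wronsk_mem hdn hf hn) z hz, Nat.add_sub_cancel, smul_eq_mul]
  have h10 : l ^ tri d ≠ 0 := pow_ne_zero _ hz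
  apply mul_left_cancel₀ h10
  change l ^ tri d * _ = _ at h5
  rw [h5]
  ring

end WrFix

open Polynomial

namespace WrFix

/-- linear factor of a point -/
noncomputable def fac (p : Option ℂ) : ℂ[X] := p.elim 1 (fun c => X + C c)

lemma fac_mem (p : Option ℂ) : fac p ∈ degreeLT ℂ 2 := by
  rw [mem_degreeLT]
  rcases p with _ | c
  · simp only [fac, Option.elim]
    rw [degree_one]; norm_num
  · simp only [fac, Option.elim]
    rw [degree_X_add_C]; norm_num

lemma fac_inj {p q : Option ℂ} {k k' : ℂ} (hk : k ≠ 0) (hk' : k' ≠ 0) (h : k • fac p = k' • fac q) :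
    p = q := by
  have h1 := congrArg (fun p => p.coeff 1) h
  have h0 := congrArg (fun p => p.coeff 0) h
  rcases p with _ | p <;> rcases q with _ | q
  · rfl
  · simp [fac, coeff_one] at h1; exact absurd h1.symm hk'
  · simp [fac, coeff_one] at h1; exact absurd h1 hk
  · simp [fac, coeff_one] at h1 h0
    subst h1
    rw [mul_right_inj' hk] at h0
    rw [h0]

lemma mob_fac {M : Matrix (Fin 2) (Fin 2) ℂ} (hM : M.det ≠ 0) (p : Option ℂ) :
    ∃ k : ℂ, k ≠ 0 ∧ mobiusMap 2 M (fac p) = k • fac (mobP1 M p) := by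
  rw [Matrix.det_fin_two] at hM
  rcases p with _ | c
  · by_cases h : M 1 0 = 0
    · refine ⟨M 0 0, ?_, ?_⟩
      · rintro h'; apply hM; rw [h, h']; ring
      · rw [mob_apply]
        simp [fac, mobP1, h, Finset.sum_range_succ, lpol, smul_eq_C_mul, coeff_one]
    · refine ⟨M 1 0, h, ?_⟩
      rw [mob_apply]
      simp only [fac, mobP1, h, if_false, Option.elim, Finset.sum_range_succ, lpol, smul_eq_C_mul, mul_add, ← C_mul]
      rw [mul_div_cancel₀ _ h]
      simp [coeff_one]
  · by_cases h : M 1 0 * c + M 1 1 = 0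
    · refine ⟨M 0 0 * c + M 0 1, ?_, ?_⟩
      · rintro h'; apply hM
        linear_combination M 0 0 * h - M 1 0 * h'
      · rw [mob_apply]
        simp only [fac, mobP1, h, if_true, Option.elim, Finset.sum_range_succ, lpol, ppol, smul_eq_C_mul]
        have := congrArg (fun x => (C x : ℂ[X])) h
        simp only [C_add, C_mul, C_0] at this
        simp
        linear_combination X * this
    · refine ⟨M 1 0 * c + M 1 1, h, ?_⟩
      rw [mob_apply]
      simp only [fac, mobP1, h, if_false, Option.elim, Finset.sum_range_succ, lpol, ppol, smul_eq_C_mul, mul_add, ← C_mul]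
      rw [mul_div_cancel₀ _ h]
      simp
      ring

lemma mobP1_mul {A B : Matrix (Fin 2) (Fin 2) ℂ} (hA : A.det ≠ 0) (hB : B.det ≠ 0) (p : Option ℂ) :
    mobP1 (A * B) p = mobP1 A (mobP1 B p) := by
  have hAB : (A * B).det ≠ 0 := by rw [Matrix.det_mul]; exact mul_ne_zero hA hB
  obtain ⟨k, hk, e⟩ := mob_fac hAB p
  obtain ⟨k1, hk1, e1⟩ := mob_fac hB p
  obtain ⟨k2, hk2, e2⟩ := mob_fac hA (mobP1 B p)
  rw [← mob_comp hA hB (fac_mem p), e1, map_smul, e2, smul_smul] at e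
  exact (fac_inj (mul_ne_zero hk1 hk2) hk e).symm

lemma mobP1_smul {M : Matrix (Fin 2) (Fin 2) ℂ} (hM : M.det ≠ 0) {s : ℂ} (hs : s ≠ 0) (p : Option ℂ) :
    mobP1 (s • M) p = mobP1 M p := by
  have hM' : (s • M).det ≠ 0 := by rw [Matrix.det_smul]; exact mul_ne_zero (pow_ne_zero _ hs) hM
  obtain ⟨k, hk, e⟩ := mob_fac hM' p
  obtain ⟨k1, hk1, e1⟩ := mob_fac hM p
  rw [mob_smul, e1, smul_smul] at e
  exact (fac_inj (mul_ne_zero (pow_ne_zero _ hs) hk1) hk e).symm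

lemma mobP1_one (p : Option ℂ) : mobP1 1 p = p := by
  rcases p with _ | p <;> simp [mobP1]

lemma mobP1_inj {M : Matrix (Fin 2) (Fin 2) ℂ} (hM : M.det ≠ 0) : Function.Injective (mobP1 M) := by
  have hu : IsUnit M.det := isUnit_iff_ne_zero.2 hM
  have hi : (M⁻¹).det ≠ 0 := by
    rw [Matrix.det_nonsing_inv]; simpa using hM
  refine Function.LeftInverse.injective (g := mobP1 M⁻¹) fun p => ?_
  rw [← mobP1_mul hi hM, Matrix.nonsing_inv_mul _ hu, mobP1_one]

lemma roots_mem {N : ℕ} (a : Fin N → Option ℂ) : rootsPoly N a ∈ degreeLT ℂ (N + 1) :=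
  (mob_prod (M := 1) (by simp) (fun i => fac (a i)) (fun i => fac_mem _)).1

lemma mob_roots {M : Matrix (Fin 2) (Fin 2) ℂ} (hM : M.det ≠ 0) {N : ℕ} (a : Fin N → Option ℂ) :
    ∃ k : ℂ, k ≠ 0 ∧ mobiusMap (N + 1) M (rootsPoly N a) = k • rootsPoly N (mobP1 M ∘ a) := by
  have h := (mob_prod hM (fun i => fac (a i)) (fun i => fac_mem _)).2
  choose k hk e using fun i => mob_fac hM (a i)
  refine ⟨∏ i, k i, Finset.prod_ne_zero_iff.2 fun i _ => hk i, ?_⟩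
  refine h.trans ?_
  simp_rw [e, smul_eq_C_mul]
  rw [Finset.prod_mul_distrib, map_prod]
  rfl

lemma mob_map_comp {n : ℕ} {A B : Matrix (Fin 2) (Fin 2) ℂ} (hA : A.det ≠ 0) (hB : B.det ≠ 0)
    {x : Submodule ℂ ℂ[X]} (hx : x ≤ degreeLT ℂ n) :
    Submodule.map (mobiusMap n A) (Submodule.map (mobiusMap n B) x) = Submodule.map (mobiusMap n (A * B)) x := by
  ext y
  simp only [Submodule.mem_map]
  constructor
  · rintro ⟨_, ⟨z, hz, rfl⟩, rfl⟩
    exact ⟨z, hz, (mob_comp hA hB (hx hz)).symm⟩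
  · rintro ⟨z, hz, rfl⟩
    exact ⟨_, ⟨z, hz, rfl⟩, mob_comp hA hB (hx hz)⟩

lemma mob_map_one {n : ℕ} {x : Submodule ℂ ℂ[X]} (hx : x ≤ degreeLT ℂ n) :
    Submodule.map (mobiusMap n 1) x = x := by
  ext y
  simp only [Submodule.mem_map]
  constructor
  · rintro ⟨z, hz, rfl⟩
    rwa [mob_one (hx hz)]
  · intro hy
    exact ⟨y, hy, mob_one (hx hy)⟩

lemma mob_map_smul {n : ℕ} {s : ℂ} (hs : s ≠ 0) (M : Matrix (Fin 2) (Fin 2) ℂ) (x : Submodule ℂ ℂ[X]) :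
    Submodule.map (mobiusMap n (s • M)) x = Submodule.map (mobiusMap n M) x := by
  have : mobiusMap n (s • M) = s ^ (n - 1) • mobiusMap n M := by
    exact LinearMap.ext fun f => mob_smul s M f
  rw [this, Submodule.map_smul _ _ _ (pow_ne_zero _ hs)]

lemma mob_map_le (n : ℕ) (M : Matrix (Fin 2) (Fin 2) ℂ) (x : Submodule ℂ ℂ[X]) :
    Submodule.map (mobiusMap n M) x ≤ degreeLT ℂ n := by
  rintro _ ⟨z, -, rfl⟩
  exact mob_mem n M z

lemma mob_map_left {n : ℕ} {P : Matrix (Fin 2) (Fin 2) ℂ} (hP : P.det ≠ 0)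
    {x : Submodule ℂ ℂ[X]} (hx : x ≤ degreeLT ℂ n) :
    Submodule.map (mobiusMap n P⁻¹) (Submodule.map (mobiusMap n P) x) = x := by
  have hu : IsUnit P.det := isUnit_iff_ne_zero.2 hP
  have hi : (P⁻¹).det ≠ 0 := by
    rw [Matrix.det_nonsing_inv]; simpa using hP
  rw [mob_map_comp hi hP hx, Matrix.nonsing_inv_mul _ hu, mob_map_one hx]

lemma mob_injOn {n : ℕ} {P : Matrix (Fin 2) (Fin 2) ℂ} (hP : P.det ≠ 0) {f g : ℂ[X]}
    (hf : f ∈ degreeLT ℂ n) (hg : g ∈ degreeLT ℂ n) (h : mobiusMap n P f = mobiusMap n P g) : f = g := by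
  have hu : IsUnit P.det := isUnit_iff_ne_zero.2 hP
  have hi : (P⁻¹).det ≠ 0 := by
    rw [Matrix.det_nonsing_inv]; simpa using hP
  have := congrArg (mobiusMap n P⁻¹) h
  rwa [mob_comp hi hP hf, mob_comp hi hP hg, Matrix.nonsing_inv_mul _ hu, mob_one hf, mob_one hg] at this

lemma fib_smul {n d : ℕ} {k : ℂ} (hk : k ≠ 0) {h : ℂ[X]} {x : Submodule ℂ ℂ[X]}
    (hx : x ∈ Fib n d (k • h)) : x ∈ Fib n d h := by
  obtain ⟨h1, f, c, hc, hf, hs, hw⟩ := hx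
  exact ⟨h1, f, c * k, mul_ne_zero hc hk, hf, hs, by rw [hw, smul_smul]⟩

lemma fib_mob {n d : ℕ} (hdn : d < n) {P : Matrix (Fin 2) (Fin 2) ℂ} (hP : P.det ≠ 0) {h : ℂ[X]}
    {x : Submodule ℂ ℂ[X]} (hx : x ∈ Fib n d h) :
    Submodule.map (mobiusMap n P) x ∈ Fib n d (mobiusMap (d * (n - d) + 1) P h) := by
  obtain ⟨⟨h1, h2⟩, f, c, hc, hf, hs, hw⟩ := hx
  have hfn : ∀ i, f i ∈ degreeLT ℂ n := fun i => h1 (hs ▸ Submodule.subset_span ⟨i, rfl⟩)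
  have hspan : Submodule.span ℂ (Set.range fun i => mobiusMap n P (f i)) = Submodule.map (mobiusMap n P) x := by
    rw [← hs, Submodule.map_span, ← Set.range_comp]; rfl
  have hli : LinearIndependent ℂ fun i => mobiusMap n P (f i) := by
    refine hf.map_injOn (mobiusMap n P) ?_
    rw [hs]
    intro u hu v hv huv
    exact mob_injOn hP (h1 hu) (h1 hv) huv
  refine ⟨⟨mob_map_le n P x, ?_⟩, _, P.det ^ tri d * c, mul_ne_zero (pow_ne_zero _ hP) hc, hli, hspan, ?_⟩
  · rw [← hspan]; exact (li_iff_finrank _).1 hli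
  · rw [wronsk_equiv hdn hP hf hfn, hw, map_smul, smul_smul]

lemma fib_roots {n d : ℕ} (hdn : d < n) {P : Matrix (Fin 2) (Fin 2) ℂ} (hP : P.det ≠ 0)
    (a : Fin (d * (n - d)) → Option ℂ)
    {x : Submodule ℂ ℂ[X]} (hx : x ∈ Fib n d (rootsPoly _ a)) :
    Submodule.map (mobiusMap n P) x ∈ Fib n d (rootsPoly _ (mobP1 P ∘ a)) := by
  obtain ⟨k, hk, e⟩ := mob_roots hP a
  have := fib_mob hdn hP hx
  rw [e] at this
  exact fib_smul hk this

lemma fib_bijOn {n d : ℕ} (hdn : d < n) {P : Matrix (Fin 2) (Fin 2) ℂ} (hP : P.det ≠ 0)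
    (a : Fin (d * (n - d)) → Option ℂ) :
    Set.BijOn (Submodule.map (mobiusMap n P)) (Fib n d (rootsPoly _ a))
      (Fib n d (rootsPoly _ (mobP1 P ∘ a))) := by
  have hu : IsUnit P.det := isUnit_iff_ne_zero.2 hP
  have hi : (P⁻¹).det ≠ 0 := by
    rw [Matrix.det_nonsing_inv]; simpa using hP
  refine ⟨fun x hx => fib_roots hdn hP a hx, ?_, ?_⟩
  · intro x hx y hy hxy
    have := congrArg (Submodule.map (mobiusMap n P⁻¹)) hxy
    rwa [mob_map_left hP hx.1.1, mob_map_left hP hy.1.1] at this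
  · intro y hy
    have h := fib_roots hdn hi _ hy
    have e : mobP1 P⁻¹ ∘ (mobP1 P ∘ a) = a := by
      funext i
      simp only [Function.comp]
      rw [← mobP1_mul hi hP, Matrix.nonsing_inv_mul _ hu, mobP1_one]
    rw [e] at h
    refine ⟨_, h, ?_⟩
    rw [mob_map_comp hP hi hy.1.1, Matrix.mul_nonsing_inv _ hu, mob_map_one hy.1.1]

lemma fib_ncard {n d : ℕ} (hdn : d < n) {P : Matrix (Fin 2) (Fin 2) ℂ} (hP : P.det ≠ 0)
    (a : Fin (d * (n - d)) → Option ℂ) :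
    (Fib n d (rootsPoly _ (mobP1 P ∘ a))).ncard = (Fib n d (rootsPoly _ a)).ncard := by
  have h := fib_bijOn hdn hP a
  rw [← h.image_eq, Set.ncard_image_of_injOn h.injOn]

lemma det_Dm : Dm.det ≠ 0 := by simp [Dm]

lemma fib_fix_ncard {n d : ℕ} (hdn : d < n) {P M : Matrix (Fin 2) (Fin 2) ℂ} (hP : P.det ≠ 0)
    (hM : M.det ≠ 0) {s : ℂ} (hs : s ≠ 0) (hPM : P * M = s • (Dm * P))
    (a : Fin (d * (n - d)) → Option ℂ) :
    {x ∈ Fib n d (rootsPoly _ (mobP1 P ∘ a)) | Submodule.map (mobiusMap n Dm) x = x}.ncard =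
    {x ∈ Fib n d (rootsPoly _ a) | Submodule.map (mobiusMap n M) x = x}.ncard := by
  have h := fib_bijOn hdn hP a
  have key : ∀ x ∈ Fib n d (rootsPoly _ a), (Submodule.map (mobiusMap n Dm) (Submodule.map (mobiusMap n P) x) =
      Submodule.map (mobiusMap n P) x ↔ Submodule.map (mobiusMap n M) x = x) := by
    intro x hx
    rw [mob_map_comp det_Dm hP hx.1.1, ← mob_map_smul hs, ← hPM, ← mob_map_comp hP hM hx.1.1]
    constructor
    · intro h'
      have := congrArg (Submodule.map (mobiusMap n P⁻¹)) h'
      rwa [mob_map_left hP hx.1.1, mob_map_left hP (mob_map_le _ _ _)] at this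
    · intro h'; rw [h']
  have him : {x ∈ Fib n d (rootsPoly _ (mobP1 P ∘ a)) | Submodule.map (mobiusMap n Dm) x = x} =
      Submodule.map (mobiusMap n P) '' {x ∈ Fib n d (rootsPoly _ a) | Submodule.map (mobiusMap n M) x = x} := by
    ext y
    constructor
    · rintro ⟨hy, hy'⟩
      obtain ⟨x, hx, rfl⟩ := h.surjOn hy
      exact ⟨x, ⟨hx, (key x hx).1 hy'⟩, rfl⟩
    · rintro ⟨x, ⟨hx, hx'⟩, rfl⟩
      exact ⟨h.mapsTo hx, (key x hx).2 hx'⟩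
  rw [him, Set.ncard_image_of_injOn (h.injOn.mono fun x hx => hx.1)]

end WrFix

open Polynomial

namespace WrFix

lemma exists_conj {M : Matrix (Fin 2) (Fin 2) ℂ}
    (hdet : M.det ≠ 0)
    (hinv : ∃ c : ℂ, c ≠ 0 ∧ M * M = c • (1 : Matrix (Fin 2) (Fin 2) ℂ))
    (hnotscalar : ¬ ∃ c : ℂ, M = c • (1 : Matrix (Fin 2) (Fin 2) ℂ)) :
    ∃ (P : Matrix (Fin 2) (Fin 2) ℂ) (s : ℂ), P.det ≠ 0 ∧ s ≠ 0 ∧ P * M = s • (Dm * P) := by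
  obtain ⟨c, hc, hMM⟩ := hinv
  have e00 := congrFun (congrFun hMM 0) 0
  have e01 := congrFun (congrFun hMM 0) 1
  have e10 := congrFun (congrFun hMM 1) 0
  have e11 := congrFun (congrFun hMM 1) 1
  simp [Matrix.mul_apply, Fin.sum_univ_two] at e00 e01 e10 e11
  have htr : M 0 0 + M 1 1 = 0 := by
    by_contra h
    have h1 : M 0 1 = 0 := by
      have : M 0 1 * (M 0 0 + M 1 1) = 0 := by linear_combination e01
      exact (mul_eq_zero.1 this).resolve_right h
    have h2 : M 1 0 = 0 := by
      have : M 1 0 * (M 0 0 + M 1 1) = 0 := by linear_combination e10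
      exact (mul_eq_zero.1 this).resolve_right h
    have h3 : M 0 0 = M 1 1 := by
      have : (M 0 0 - M 1 1) * (M 0 0 + M 1 1) = 0 := by linear_combination e00 - e11
      exact sub_eq_zero.1 ((mul_eq_zero.1 this).resolve_right h)
    apply hnotscalar
    refine ⟨M 0 0, ?_⟩
    ext i j
    fin_cases i <;> fin_cases j <;> simp [h1, h2, h3]
  have h11 : M 1 1 = - M 0 0 := by linear_combination htr
  by_cases hg : M 1 0 = 0
  · have hα : M 0 0 ≠ 0 := by
      intro h
      rw [h, hg] at e00
      apply hc; rw [← e00]; ring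
    refine ⟨!![2 * M 0 0, M 0 1; 0, 1], M 0 0, by simp [hα], hα, ?_⟩
    ext i j
    fin_cases i <;> fin_cases j <;>
      simp [Matrix.mul_apply, Fin.sum_univ_two, Dm, hg, h11] <;> ring
  · obtain ⟨s, hs⟩ := IsSquare.exists_sq c (IsAlgClosed.exists_eq_mul_self c |> fun ⟨z, hz⟩ => ⟨z, hz⟩)
    have hs0 : s ≠ 0 := by rintro rfl; apply hc; rw [hs]; ring
    refine ⟨!![M 1 0, s - M 0 0; M 1 0, - s - M 0 0], s, ?_, hs0, ?_⟩
    · rw [Matrix.det_fin_two]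
      simp only [Matrix.of_apply, Matrix.cons_val', Matrix.cons_val_zero, Matrix.cons_val_one]
      have : M 1 0 * (-s - M 0 0) - (s - M 0 0) * M 1 0 = -2 * (s * M 1 0) := by ring
      rw [this]
      exact mul_ne_zero (by norm_num) (mul_ne_zero hs0 hg)
    · have h00 : M 1 0 * M 0 1 = s ^ 2 - M 0 0 ^ 2 := by linear_combination e00 + hs
      ext i j
      fin_cases i <;> fin_cases j <;>
        simp [Matrix.mul_apply, Fin.sum_univ_two, Dm, h11, h00] <;> ring

/-- the swap matrix -/
def Sw : Matrix (Fin 2) (Fin 2) ℂ := !![0, 1; 1, 0]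

lemma det_Sw : Sw.det ≠ 0 := by simp [Sw]

lemma Dm_none : mobP1 Dm none = none := by simp [mobP1, Dm]
lemma Dm_some (c : ℂ) : mobP1 Dm (some c) = some (-c) := by simp [mobP1, Dm, div_neg]

lemma Dm_fix (p : Option ℂ) : mobP1 Dm p = p ↔ p = none ∨ p = some 0 := by
  rcases p with _ | c
  · simp [Dm_none]
  · rw [Dm_some]
    simp only [Option.some.injEq, reduceCtorEq, false_or]
    constructor
    · intro h
      have : 2 * c = 0 := by linear_combination -h
      simpa using this
    · rintro rfl; simp

lemma exists_good {M : Matrix (Fin 2) (Fin 2) ℂ}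
    (hdet : M.det ≠ 0)
    (hinv : ∃ c : ℂ, c ≠ 0 ∧ M * M = c • (1 : Matrix (Fin 2) (Fin 2) ℂ))
    (hnotscalar : ¬ ∃ c : ℂ, M = c • (1 : Matrix (Fin 2) (Fin 2) ℂ)) {N : ℕ} (a : Fin N → Option ℂ) :
    ∃ (P : Matrix (Fin 2) (Fin 2) ℂ) (s : ℂ), P.det ≠ 0 ∧ s ≠ 0 ∧ P * M = s • (Dm * P) ∧
      (none ∈ Set.range (mobP1 P ∘ a) → some 0 ∈ Set.range (mobP1 P ∘ a)) := by
  obtain ⟨P, s, hP, hs, h⟩ := exists_conj hdet hinv hnotscalar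
  by_cases hg : none ∈ Set.range (mobP1 P ∘ a) → some 0 ∈ Set.range (mobP1 P ∘ a)
  · exact ⟨P, s, hP, hs, h, hg⟩
  · push Not at hg
    refine ⟨Sw * P, -s, ?_, neg_ne_zero.2 hs, ?_, ?_⟩
    · rw [Matrix.det_mul]; exact mul_ne_zero det_Sw hP
    · have : Sw * Dm = - (Dm * Sw) := by
        ext i j
        fin_cases i <;> fin_cases j <;> simp [Sw, Dm, Matrix.mul_apply, Fin.sum_univ_two]
      rw [Matrix.mul_assoc, h, Matrix.mul_smul, ← Matrix.mul_assoc, this, ← Matrix.mul_assoc]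
      simp
    · intro _
      obtain ⟨i, hi⟩ := hg.1
      refine ⟨i, ?_⟩
      simp only [Function.comp] at hi ⊢
      rw [mobP1_mul det_Sw hP, hi]
      simp [mobP1, Sw]

lemma conj_point {P M : Matrix (Fin 2) (Fin 2) ℂ} (hP : P.det ≠ 0)
    (hM : M.det ≠ 0) {s : ℂ} (hs : s ≠ 0) (hPM : P * M = s • (Dm * P)) (p : Option ℂ) :
    mobP1 P (mobP1 M p) = mobP1 Dm (mobP1 P p) := by
  have hDP : (Dm * P).det ≠ 0 := by rw [Matrix.det_mul]; exact mul_ne_zero det_Dm hP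
  rw [← mobP1_mul hP hM, hPM, mobP1_smul hDP hs, mobP1_mul det_Dm hP]

lemma roots_monic {N : ℕ} (a : Fin N → Option ℂ) : (rootsPoly N a).Monic := by
  refine monic_prod_of_monic _ _ fun i _ => ?_
  rcases a i with _ | c
  · exact monic_one
  · exact monic_X_add_C c

lemma fac_natDegree (p : Option ℂ) : (fac p).natDegree = if p = none then 0 else 1 := by
  rcases p with _ | c
  · simp [fac]
  · simp only [fac, Option.elim]; rw [natDegree_X_add_C]; simp

lemma roots_natDegree {N : ℕ} {a : Fin N → Option ℂ} (ha : Function.Injective a) :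
    (rootsPoly N a).natDegree = N - if none ∈ Set.range a then 1 else 0 := by
  have h1 : (rootsPoly N a).natDegree = ∑ i, (fac (a i)).natDegree := by
    refine natDegree_prod_of_monic _ _ fun i _ => ?_
    rcases a i with _ | c
    · exact monic_one
    · exact monic_X_add_C c
  rw [h1]
  simp_rw [fac_natDegree]
  split_ifs with h
  · obtain ⟨i, hi⟩ := h
    have : ∀ j, (if a j = none then 0 else 1) = if j = i then 0 else 1 := by
      intro j
      have : a j = none ↔ j = i := by rw [← hi]; exact ha.eq_iff
      simp only [this]
    simp_rw [this]
    rw [← Finset.add_sum_erase _ _ (Finset.mem_univ i)]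
    rw [Finset.sum_congr rfl (g := fun _ => 1)]
    · simp
    · intro j hj
      simp [Finset.ne_of_mem_erase hj]
  · have : ∀ j, (if a j = none then 0 else 1) = 1 := fun j => if_neg fun hj => h ⟨j, hj⟩
    simp [this]

lemma roots_finprod {N : ℕ} {a : Fin N → Option ℂ} (ha : Function.Injective a) :
    rootsPoly N a = ∏ᶠ p ∈ Set.range a, fac p := by
  rw [finprod_mem_range ha, finprod_eq_prod_of_fintype]
  rfl

lemma roots_parity {N NJ : ℕ} {a : Fin N → Option ℂ} (ha : Function.Injective a)
    (hinv : mobP1 Dm '' Set.range a = Set.range a) (hN : (rootsPoly N a).natDegree = NJ) :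
    ∀ r, r < NJ → Odd (NJ - r) → (rootsPoly N a).coeff r = 0 := by
  intro r hr ho
  obtain ⟨k, hk, e⟩ := mob_roots det_Dm a
  have h2 : rootsPoly N (mobP1 Dm ∘ a) = rootsPoly N a := by
    rw [roots_finprod ha, roots_finprod ((mobP1_inj det_Dm).comp ha), Set.range_comp, hinv]
  rw [h2] at e
  have hNJ : NJ ≤ N := by
    rw [← hN, roots_natDegree ha]; omega
  have c1 := mobius_Dm_coeff (N + 1) (rootsPoly N a) ⟨NJ, by omega⟩
  have c2 := mobius_Dm_coeff (N + 1) (rootsPoly N a) ⟨r, by omega⟩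
  have hm : (rootsPoly N a).coeff NJ = 1 := by rw [← hN]; exact roots_monic a
  rw [e] at c1 c2
  simp only [coeff_smul, smul_eq_mul, hm, mul_one] at c1 c2
  rw [c1] at c2
  have h3 : NJ = r + (NJ - r) := by omega
  rw [h3, pow_add, ho.neg_one_pow] at c2
  have h4 : (2 * (-1 : ℂ) ^ r) * (rootsPoly N a).coeff r = 0 := by linear_combination -c2
  exact (mul_eq_zero.1 h4).resolve_left (mul_ne_zero two_ne_zero (pow_ne_zero _ (by norm_num)))

lemma fix_two {S : Set (Option ℂ)} (h : none ∈ S → some 0 ∈ S) :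
    none ∈ S ↔ {p ∈ S | mobP1 Dm p = p}.ncard = 2 := by
  simp_rw [Dm_fix]
  have hne : (none : Option ℂ) ≠ some 0 := by simp
  constructor
  · intro h0
    have : {p ∈ S | p = none ∨ p = some 0} = {none, some 0} := by
      ext p
      constructor
      · rintro ⟨-, h⟩; exact h
      · rintro (rfl | rfl)
        · exact ⟨h0, Or.inl rfl⟩
        · exact ⟨h h0, Or.inr rfl⟩
    rw [this, Set.ncard_pair hne]
  · intro h2
    by_contra h0
    have : {p ∈ S | p = none ∨ p = some 0} ⊆ {some 0} := by
      rintro p ⟨hp, rfl | rfl⟩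
      · exact absurd hp h0
      · rfl
    have := Set.ncard_le_ncard this
    rw [Set.ncard_singleton] at this
    omega

/-- Everything needed about one configuration. -/
lemma package {d n : ℕ} (hdn : d < n)
    {M : Matrix (Fin 2) (Fin 2) ℂ} (hdet : M.det ≠ 0)
    (hinv : ∃ c : ℂ, c ≠ 0 ∧ M * M = c • (1 : Matrix (Fin 2) (Fin 2) ℂ))
    (hnotscalar : ¬ ∃ c : ℂ, M = c • (1 : Matrix (Fin 2) (Fin 2) ℂ))
    {a : Fin (d * (n - d)) → Option ℂ}
    (ha : Function.Injective a)
    (hainv : mobP1 M '' Set.range a = Set.range a) :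
    ∃ h : ℂ[X], h.Monic ∧ h.natDegree = d * (n - d) -
        (if Set.ncard {p ∈ Set.range a | mobP1 M p = p} = 2 then 1 else 0) ∧
      (∀ r, r < h.natDegree → Odd (h.natDegree - r) → h.coeff r = 0) ∧
      (Fib n d h).ncard = (Fib n d (rootsPoly _ a)).ncard ∧
      {x ∈ Fib n d h | Submodule.map (mobiusMap n Dm) x = x}.ncard =
      {x ∈ Fib n d (rootsPoly _ a) | Submodule.map (mobiusMap n M) x = x}.ncard := by
  obtain ⟨P, s, hP, hs, hPM, hg⟩ := exists_good hdet hinv hnotscalar a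
  have hinj : Function.Injective (mobP1 P ∘ a) := (mobP1_inj hP).comp ha
  have hcp := conj_point hP hdet hs hPM
  have hDinv : mobP1 Dm '' Set.range (mobP1 P ∘ a) = Set.range (mobP1 P ∘ a) := by
    rw [Set.range_comp]
    conv_rhs => rw [← hainv]
    rw [Set.image_image, Set.image_image]
    simp_rw [hcp]
  have hfc : {p ∈ Set.range (mobP1 P ∘ a) | mobP1 Dm p = p}.ncard =
      {p ∈ Set.range a | mobP1 M p = p}.ncard := by
    rw [← Set.ncard_image_of_injective {p ∈ Set.range a | mobP1 M p = p} (mobP1_inj hP)]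
    congr 1
    ext q
    constructor
    · rintro ⟨⟨i, rfl⟩, hq⟩
      refine ⟨a i, ⟨⟨i, rfl⟩, ?_⟩, rfl⟩
      apply mobP1_inj hP
      rw [hcp]; exact hq
    · rintro ⟨_, ⟨⟨i, rfl⟩, hq⟩, rfl⟩
      refine ⟨⟨i, rfl⟩, ?_⟩
      rw [← hcp, hq]
  refine ⟨rootsPoly _ (mobP1 P ∘ a), roots_monic _, ?_, roots_parity hinj hDinv rfl,
    fib_ncard hdn hP a, fib_fix_ncard hdn hP hdet hs hPM a⟩
  rw [roots_natDegree hinj]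
  congr 1
  have := fix_two hg
  rw [hfc] at this
  simp only [this]

end WrFix

/-- Let `φ ∈ PGL₂(ℂ)` be an involution other than the
identity (represented by an invertible matrix `M` which is not scalar but whose
square is scalar), and let `𝐚 = {a₁, …, a_N} ⊂ ℂℙ¹` be a set of `N` distinct
points with `φ(𝐚) = 𝐚` such that the fibre `X(𝐚) = Wr⁻¹(∏_{aᵢ ≠ ∞} (z + aᵢ))`
is reduced (equivalently, it has the full number `|SYT((n-d)^d)|` of points).
Then the number of `φ`-fixed points in `X(𝐚)` depends only on the number of
`φ`-fixed elements of the set `𝐚`. -/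
theorem statement13 (d n : ℕ) (hd : 0 < d) (hdn : d < n)
    (M : Matrix (Fin 2) (Fin 2) ℂ) (hdet : M.det ≠ 0)
    (hinv : ∃ c : ℂ, c ≠ 0 ∧ M * M = c • (1 : Matrix (Fin 2) (Fin 2) ℂ))
    (hnotscalar : ¬ ∃ c : ℂ, M = c • (1 : Matrix (Fin 2) (Fin 2) ℂ))
    (a b : Fin (d * (n - d)) → Option ℂ)
    (ha : Function.Injective a) (hb : Function.Injective b)
    (hainv : mobP1 M '' Set.range a = Set.range a)
    (hbinv : mobP1 M '' Set.range b = Set.range b)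
    (hared : Set.ncard {x : Submodule ℂ (Polynomial ℂ) |
        IsGrPoint n d x ∧ InFibre d x (rootsPoly (d * (n - d)) a)} =
      Set.ncard {E : ℕ → ℕ → ℕ | IsSYT d (n - d) E})
    (hbred : Set.ncard {x : Submodule ℂ (Polynomial ℂ) |
        IsGrPoint n d x ∧ InFibre d x (rootsPoly (d * (n - d)) b)} =
      Set.ncard {E : ℕ → ℕ → ℕ | IsSYT d (n - d) E})
    (hfix : Set.ncard {p ∈ Set.range a | mobP1 M p = p} =
      Set.ncard {p ∈ Set.range b | mobP1 M p = p}) :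
    Set.ncard {x : Submodule ℂ (Polynomial ℂ) |
        IsGrPoint n d x ∧ InFibre d x (rootsPoly (d * (n - d)) a) ∧
        Submodule.map (mobiusMap n M) x = x} =
      Set.ncard {x : Submodule ℂ (Polynomial ℂ) |
        IsGrPoint n d x ∧ InFibre d x (rootsPoly (d * (n - d)) b) ∧
        Submodule.map (mobiusMap n M) x = x} := by
  obtain ⟨h, hm, hdeg, hpar, hcard, hfx⟩ := WrFix.package hdn hdet hinv hnotscalar ha hainv
  obtain ⟨h', hm', hdeg', hpar', hcard', hfx'⟩ := WrFix.package hdn hdet hinv hnotscalar hb hbinv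
  rw [hfix] at hdeg
  rw [hdeg] at hpar
  rw [hdeg'] at hpar'
  have key := WrFix.cell_final hd hdn _ (by split_ifs <;> simp) h h' hm hdeg hm' hdeg' hpar hpar'
    (hcard.trans hared) (hcard'.trans hbred)
  rw [hfx, hfx'] at key
  simp only [WrFix.Fib, Set.mem_setOf_eq, and_assoc] at key
  exact key
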